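/- Every sufficiently large odd number can be written as the sum of three primes. -/

import Mathlib

namespace Vinogradov

open Finset Filter Topology MeasureTheory

/-! ### Bounds for `L`-functions slightly to the left of the line `re s = 1` -/

lemma norm_cpow_neg_sub_le {a b : ℝ} (ha : 0 < a) (hab : a ≤ b) {s : ℂ} (hs : 0 < s.re) :
    ‖(b : ℂ) ^ (-s) - (a : ℂ) ^ (-s)‖ ≤ ‖s‖ / s.re * (a ^ (-s.re) - b ^ (-s.re)) := by
  have hs0 : s ≠ 0 := fun h ↦ by simp [h] at hs
  have hpos : ∀ x ∈ Set.uIcc a b, 0 < x := fun x hx ↦ by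
    rw [Set.uIcc_of_le hab] at hx; exact ha.trans_le hx.1
  have h0 : (0 : ℝ) ∉ Set.uIcc a b := fun h ↦ lt_irrefl _ (hpos 0 h)
  have h1 : ∫ x : ℝ in a..b, (x : ℂ) ^ (-s - 1) = ((b : ℂ) ^ (-s) - (a : ℂ) ^ (-s)) / (-s) := by
    rw [integral_cpow (Or.inr ⟨by simpa [sub_eq_iff_eq_add] using hs0, h0⟩)]
    simp
  have h2 : ∫ x : ℝ in a..b, x ^ (-s.re - 1) = (b ^ (-s.re) - a ^ (-s.re)) / (-s.re) := by
    rw [integral_rpow (Or.inr ⟨by intro h; linarith, h0⟩)]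
    simp
  have h3 : ‖∫ x : ℝ in a..b, (x : ℂ) ^ (-s - 1)‖ ≤ ∫ x : ℝ in a..b, x ^ (-s.re - 1) := by
    refine (intervalIntegral.norm_integral_le_integral_norm hab).trans (le_of_eq ?_)
    refine intervalIntegral.integral_congr fun x hx ↦ ?_
    simp [Complex.norm_cpow_eq_rpow_re_of_pos (hpos x hx)]
  rw [h1, h2, norm_div, norm_neg, div_le_iff₀ (norm_pos_iff.mpr hs0)] at h3
  calc _ ≤ _ := h3
    _ = _ := by field_simp; ring

lemma rpow_neg_sub_le {a : ℝ} (ha : 0 < a) {σ : ℝ} (hσ : 0 < σ) :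
    a ^ (-σ) - (a + 1) ^ (-σ) ≤ σ * a ^ (-σ - 1) := by
  have key : 1 - σ / a ≤ (1 + 1 / a) ^ (-σ) := by
    have h3 : 0 < 1 + 1 / a := by positivity
    rw [Real.rpow_def_of_pos h3]
    have := Real.add_one_le_exp (Real.log (1 + 1 / a) * -σ)
    have h4 : Real.log (1 + 1 / a) ≤ 1 / a := by
      have := Real.log_le_sub_one_of_pos h3; linarith
    have : Real.log (1 + 1 / a) * σ ≤ 1 / a * σ := by gcongr
    have e : 1 / a * σ = σ / a := by ring
    linarith
  have e1 : (a + 1) ^ (-σ) = a ^ (-σ) * (1 + 1 / a) ^ (-σ) := by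
    rw [← Real.mul_rpow ha.le (by positivity)]
    congr 1; field_simp
  have e2 : a ^ (-σ - 1) = a ^ (-σ) / a := by rw [Real.rpow_sub_one ha.ne']
  rw [e1, e2]
  have : 0 < a ^ (-σ) := by positivity
  have : a ^ (-σ) * (1 - σ / a) ≤ a ^ (-σ) * (1 + 1 / a) ^ (-σ) := by gcongr
  calc _ ≤ a ^ (-σ) - a ^ (-σ) * (1 - σ / a) := by linarith
    _ = _ := by ring

lemma hasSum_rpow_neg_sub {Y : ℕ} (hY : 1 ≤ Y) {σ : ℝ} (hσ : 0 < σ) :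
    HasSum (fun n : ℕ ↦ if n < Y then 0 else (n : ℝ) ^ (-σ) - ((n : ℝ) + 1) ^ (-σ))
      ((Y : ℝ) ^ (-σ)) := by
  have hnn : ∀ n : ℕ, 1 ≤ n → 0 ≤ (n : ℝ) ^ (-σ) - ((n : ℝ) + 1) ^ (-σ) := fun n hn ↦ by
    have : (0 : ℝ) < n := by exact_mod_cast hn
    have := Real.rpow_le_rpow_of_nonpos this (by linarith : (n : ℝ) ≤ n + 1) (by linarith : -σ ≤ 0)
    linarith
  rw [← hasSum_nat_add_iff' Y]
  have e : ∑ i ∈ range Y, (if i < Y then 0 else (i : ℝ) ^ (-σ) - ((i : ℝ) + 1) ^ (-σ)) = 0 :=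
    sum_eq_zero fun i hi ↦ by simp [mem_range.mp hi]
  rw [e, sub_zero]
  have hp : ∀ N : ℕ, ∑ i ∈ range N, (if i + Y < Y then 0 else
      ((i + Y : ℕ) : ℝ) ^ (-σ) - (((i + Y : ℕ) : ℝ) + 1) ^ (-σ))
      = (Y : ℝ) ^ (-σ) - ((N + Y : ℕ) : ℝ) ^ (-σ) := fun N ↦ by
    induction N with
    | zero => simp
    | succ n ih =>
      rw [sum_range_succ, ih]
      simp only [show ¬ (n + Y < Y) by omega, if_false]
      push_cast
      rw [show (n : ℝ) + 1 + Y = n + Y + 1 by ring]; ring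
  have hlim : Tendsto (fun N : ℕ ↦ (Y : ℝ) ^ (-σ) - ((N + Y : ℕ) : ℝ) ^ (-σ)) atTop
      (𝓝 ((Y : ℝ) ^ (-σ) - 0)) := by
    refine tendsto_const_nhds.sub ?_
    exact ((tendsto_rpow_neg_atTop hσ).comp tendsto_natCast_atTop_atTop).comp
      (tendsto_add_atTop_nat Y)
  rw [sub_zero] at hlim
  rw [hasSum_iff_tendsto_nat_of_nonneg]
  · simpa only [hp] using hlim
  · intro i
    simp only [show ¬ (i + Y < Y) by omega, if_false]
    exact hnn _ (by omega)

/-- A series of entire functions dominated by a telescoping series defines a holomorphic function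
on `0 < re s`. -/
lemma tail_series {g : ℕ → ℂ → ℂ} {K : ℂ → ℝ} {Y : ℕ} (hY : 1 ≤ Y)
    (hg : ∀ n, Differentiable ℂ (g n)) (h0 : ∀ n < Y, ∀ s, g n s = 0) (hK : Continuous K)
    (hK0 : ∀ s, 0 ≤ K s)
    (hb : ∀ n, Y ≤ n → ∀ s : ℂ, 0 < s.re →
      ‖g n s‖ ≤ K s / s.re * ((n : ℝ) ^ (-s.re) - ((n : ℝ) + 1) ^ (-s.re))) :
    DifferentiableOn ℂ (fun s ↦ ∑' n, g n s) {s | 0 < s.re} ∧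
    ∀ s : ℂ, 0 < s.re → Summable (fun n ↦ g n s) ∧
      ‖∑' n, g n s‖ ≤ K s / s.re * (Y : ℝ) ^ (-s.re) := by
  have hb' : ∀ n, ∀ s : ℂ, 0 < s.re → ‖g n s‖ ≤ K s / s.re *
      (if n < Y then 0 else (n : ℝ) ^ (-s.re) - ((n : ℝ) + 1) ^ (-s.re)) := fun n s hs ↦ by
    by_cases h : n < Y
    · simp [h0 n h, h]
    · simpa [h] using hb n (not_lt.mp h) s hs
  constructor
  · intro s₀ hs₀
    simp only [Set.mem_ofPred_eq] at hs₀
    obtain ⟨R, hR⟩ := (isCompact_closedBall s₀ (s₀.re / 2)).bddAbove_image hK.continuousOn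
    have hU : IsOpen (Metric.ball s₀ (s₀.re / 2)) := Metric.isOpen_ball
    have hsum : Summable (fun n : ℕ ↦ R * ((n : ℝ) ^ (-(s₀.re / 2) - 1))) :=
      (Real.summable_nat_rpow.mpr (by linarith)).mul_left R
    have := Complex.differentiableOn_tsum_of_summable_norm hsum
      (fun n ↦ (hg n).differentiableOn) hU (fun n s hs ↦ ?_)
    · exact (this.differentiableAt (hU.mem_nhds (Metric.mem_ball_self (by linarith)))).differentiableWithinAt
    · have hre : s₀.re / 2 < s.re := by
        have h1 : |(s - s₀).re| < s₀.re / 2 :=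
          (Complex.abs_re_le_norm _).trans_lt (by simpa [dist_eq_norm] using hs)
        have := (abs_lt.mp h1).1
        simp at this; linarith
      have hs' : 0 < s.re := by linarith
      have hKR : K s ≤ R := hR ⟨s, Metric.ball_subset_closedBall hs, rfl⟩
      have hR0 : 0 ≤ R := (hK0 s).trans hKR
      by_cases h : n < Y
      · simp only [h0 n h, norm_zero]; positivity
      · have hn : (1 : ℝ) ≤ n := by exact_mod_cast hY.trans (not_lt.mp h)
        refine (hb n (not_lt.mp h) s hs').trans ?_
        have h2 := rpow_neg_sub_le (by linarith : (0 : ℝ) < n) hs'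
        calc _ ≤ K s / s.re * (s.re * (n : ℝ) ^ (-s.re - 1)) := by
              have := hK0 s; gcongr
          _ = K s * (n : ℝ) ^ (-s.re - 1) := by field_simp
          _ ≤ R * (n : ℝ) ^ (-(s₀.re / 2) - 1) := by
              gcongr 1
              · exact Real.rpow_le_rpow_of_exponent_le hn (by linarith)
  · intro s hs
    have h1 := (hasSum_rpow_neg_sub hY hs).mul_left (K s / s.re)
    have h2 : Summable (fun n ↦ ‖g n s‖) :=
      Summable.of_nonneg_of_le (fun _ ↦ norm_nonneg _) (fun n ↦ hb' n s hs) h1.summable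
    refine ⟨h2.of_norm, (norm_tsum_le_tsum_norm h2).trans ?_⟩
    rw [← h1.tsum_eq]
    exact h2.tsum_le_tsum (fun n ↦ hb' n s hs) h1.summable

lemma eqOn_re_pos {f g : ℂ → ℂ} (hf : DifferentiableOn ℂ f {s | 0 < s.re})
    (hg : DifferentiableOn ℂ g {s | 0 < s.re}) (h : ∀ s : ℂ, 1 < s.re → f s = g s) :
    ∀ s : ℂ, 0 < s.re → f s = g s := by
  have ho : IsOpen {s : ℂ | 0 < s.re} := isOpen_lt continuous_const Complex.continuous_re
  have ho1 : IsOpen {s : ℂ | 1 < s.re} := isOpen_lt continuous_const Complex.continuous_re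
  have hc : IsPreconnected {s : ℂ | 0 < s.re} := (convex_halfSpace_re_gt 0).isPreconnected
  have := (hf.analyticOnNhd ho).eqOn_of_preconnected_of_eventuallyEq (hg.analyticOnNhd ho) hc
    (z₀ := 2) (by simp) (by filter_upwards [ho1.mem_nhds (by simp : (2 : ℂ) ∈ _)] with s hs using h s hs)
  exact fun s hs ↦ this hs

lemma norm_sum_range_zmod_le {q : ℕ} [NeZero q] {Φ : ZMod q → ℂ} (hΦ : ∀ x, ‖Φ x‖ ≤ 1)
    (hsum : ∑ x, Φ x = 0) (N : ℕ) : ‖∑ n ∈ range N, Φ n‖ ≤ q := by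
  have hq : 0 < q := Nat.pos_of_neZero q
  have hper : ∀ M, ∑ n ∈ range q, Φ ((M * q + n : ℕ)) = 0 := fun M ↦ by
    rw [← hsum]
    refine sum_bij' (fun n _ ↦ (n : ZMod q)) (fun x _ ↦ x.val) ?_ ?_ ?_ ?_ ?_
    · simp
    · simp [ZMod.val_lt]
    · intro n hn; simpa using ZMod.val_cast_of_lt (mem_range.mp hn)
    · simp
    · simp
  have hmul : ∀ M, ∑ n ∈ range (M * q), Φ n = 0 := fun M ↦ by
    induction M with
    | zero => simp
    | succ M ih => rw [Nat.succ_mul, sum_range_add, ih, hper, add_zero]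
  rw [← Nat.div_add_mod' N q, sum_range_add, hmul, zero_add]
  calc _ ≤ ∑ n ∈ range (N % q), (1 : ℝ) := norm_sum_le_of_le _ fun _ _ ↦ hΦ _
    _ ≤ q := by simpa using (Nat.mod_lt N hq).le

lemma tendsto_natCast_cpow_neg {s : ℂ} (hs : 0 < s.re) :
    Tendsto (fun N : ℕ ↦ (N : ℂ) ^ (-s)) atTop (𝓝 0) := by
  rw [tendsto_zero_iff_norm_tendsto_zero]
  have := (tendsto_rpow_neg_atTop hs).comp (tendsto_natCast_atTop_atTop (R := ℝ))
  refine this.congr' ?_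
  filter_upwards [eventually_gt_atTop 0] with N hN
  simp [Complex.norm_natCast_cpow_of_pos hN]

lemma differentiable_natCast_cpow_neg {n : ℕ} (hn : n ≠ 0) :
    Differentiable ℂ (fun s : ℂ ↦ (n : ℂ) ^ (-s)) :=
  (differentiable_id.neg).const_cpow (Or.inl (by exact_mod_cast hn))

/-- Truncated Dirichlet series bound for the `L`-function of a periodic function of mean zero. -/
lemma norm_LFunction_sub_sum_le {q : ℕ} [NeZero q] {Φ : ZMod q → ℂ} (hΦ : ∀ x, ‖Φ x‖ ≤ 1)
    (hsum : ∑ x, Φ x = 0) {Y : ℕ} (hY : 1 ≤ Y) {s : ℂ} (hs : 0 < s.re) :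
    ‖ZMod.LFunction Φ s - ∑ n ∈ Ico 1 Y, Φ n * (n : ℂ) ^ (-s)‖ ≤
      2 * q * ‖s‖ / s.re * (Y : ℝ) ^ (-s.re) := by
  set A : ℕ → ℂ := fun N ↦ ∑ n ∈ range N, Φ n - ∑ n ∈ range Y, Φ n with hA
  have hAb : ∀ N, ‖A N‖ ≤ 2 * q := fun N ↦ by
    have h1 := norm_sum_range_zmod_le hΦ hsum N
    have h2 := norm_sum_range_zmod_le hΦ hsum Y
    have := norm_sub_le (∑ n ∈ range N, Φ n) (∑ n ∈ range Y, Φ n)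
    linarith
  set g : ℕ → ℂ → ℂ := fun n s ↦ if n < Y then 0 else
    A (n + 1) * ((n : ℂ) ^ (-s) - ((n + 1 : ℕ) : ℂ) ^ (-s)) with hg
  have hgd : ∀ n, Differentiable ℂ (g n) := fun n ↦ by
    by_cases h : n < Y
    · simp only [hg, h, if_true]; exact differentiable_const 0
    · simp only [hg, h, if_false]
      exact ((differentiable_natCast_cpow_neg (by omega)).sub
        (differentiable_natCast_cpow_neg (by omega))).const_mul _
  obtain ⟨hd, hb⟩ := tail_series (g := g) (K := fun s ↦ 2 * q * ‖s‖) hY hgd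
    (fun n h s ↦ by simp [hg, h]) (by fun_prop) (fun s ↦ by positivity) (fun n hn s hs ↦ by
      simp only [hg, not_lt.mpr hn, if_false, norm_mul]
      have hn0 : (0 : ℝ) < n := by exact_mod_cast (by omega : 0 < n)
      have := norm_cpow_neg_sub_le hn0 (by linarith : (n : ℝ) ≤ n + 1) hs
      rw [norm_sub_rev] at this
      calc _ ≤ 2 * q * (‖s‖ / s.re * ((n : ℝ) ^ (-s.re) - ((n : ℝ) + 1) ^ (-s.re))) := by
            gcongr
            · exact hAb _
            · push_cast at this ⊢; exact this
        _ = _ := by ring)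
  have key : ∀ s : ℂ, 0 < s.re → ZMod.LFunction Φ s =
      ∑ n ∈ Ico 1 Y, Φ n * (n : ℂ) ^ (-s) + ∑' n, g n s := by
    refine eqOn_re_pos (ZMod.differentiable_LFunction_of_sum_zero hsum).differentiableOn ?_ ?_
    · refine DifferentiableOn.add (Differentiable.differentiableOn ?_) hd
      refine Differentiable.fun_sum fun n hn ↦ ?_
      exact (differentiable_natCast_cpow_neg (by simp at hn; omega)).const_mul _
    · intro s hs
      rw [ZMod.LFunction_eq_LSeries _ hs]
      have hsm : LSeriesSummable (fun n ↦ Φ n) s :=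
        LSeriesSummable_of_bounded_of_one_lt_re (m := 1) (fun n _ ↦ hΦ _) hs
      have t1 := hsm.hasSum.tendsto_sum_nat
      have hs0 : 0 < s.re := by linarith
      have t2 := (hb s hs0).1.hasSum.tendsto_sum_nat
      have t3 : Tendsto (fun N : ℕ ↦ A N * (N : ℂ) ^ (-s)) atTop (𝓝 0) := by
        have := (tendsto_natCast_cpow_neg hs0)
        rw [tendsto_zero_iff_norm_tendsto_zero] at this ⊢
        refine squeeze_zero (fun _ ↦ norm_nonneg _) (fun N ↦ ?_) (by simpa using this.const_mul (2 * q : ℝ))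
        rw [norm_mul]; gcongr; exact hAb N
      refine tendsto_nhds_unique t1 ?_
      have t4 := (tendsto_const_nhds (x := ∑ n ∈ Ico 1 Y, Φ n * (n : ℂ) ^ (-s))).add (t3.add t2)
      rw [zero_add] at t4
      refine t4.congr' ?_
      filter_upwards [eventually_ge_atTop Y] with N hN
      induction N, hN using Nat.le_induction with
      | base =>
        have e1 : ∑ i ∈ range Y, g i s = 0 :=
          sum_eq_zero fun i hi ↦ by simp [hg, mem_range.mp hi]
        rw [e1, range_eq_Ico, sum_eq_sum_Ico_succ_bot (show 0 < Y by omega)]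
        simp only [hA, sub_self, zero_mul, add_zero, LSeries.term_zero, zero_add]
        refine sum_congr rfl fun n hn ↦ ?_
        rw [LSeries.term_of_ne_zero (by simp at hn; omega), Complex.cpow_neg]; rfl
      | succ N hN ih =>
        rw [sum_range_succ, sum_range_succ _ N, ← ih]
        simp only [hg, not_lt.mpr hN, if_false]
        rw [LSeries.term_of_ne_zero (by omega), div_eq_mul_inv, ← Complex.cpow_neg]
        have : A (N + 1) = A N + Φ N := by simp only [hA, sum_range_succ]; ring
        rw [this]; ring
  rw [key s hs, add_sub_cancel_left]
  exact (hb s hs).2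

lemma LFunctionTrivChar₁_one_eq {s : ℂ} (hs : s ≠ 1) :
    DirichletCharacter.LFunctionTrivChar₁ 1 s = (s - 1) * riemannZeta s := by
  simp [DirichletCharacter.LFunctionTrivChar₁, DirichletCharacter.LFunctionTrivChar, hs]

lemma norm_zeta_sub_sum_le {Y : ℕ} (hY : 1 ≤ Y) {s : ℂ} (hs : 0 < s.re) :
    ‖DirichletCharacter.LFunctionTrivChar₁ 1 s -
      ((s - 1) * ∑ n ∈ Ico 1 Y, (n : ℂ) ^ (-s) + (Y : ℂ) * (Y : ℂ) ^ (-s))‖ ≤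
      ‖s - 1‖ * ‖s‖ / s.re * (Y : ℝ) ^ (-s.re) := by
  set g : ℕ → ℂ → ℂ := fun n s ↦ if n < Y then 0 else
    (s - 1) * (n : ℂ) ^ (-s) + ((n + 1 : ℕ) : ℂ) * ((n + 1 : ℕ) : ℂ) ^ (-s) - n * (n : ℂ) ^ (-s)
    with hg
  have hgd : ∀ n, Differentiable ℂ (g n) := fun n ↦ by
    by_cases h : n < Y
    · simp only [hg, h, if_true]; exact differentiable_const 0
    · simp only [hg, h, if_false]
      have h1 := differentiable_natCast_cpow_neg (n := n) (by omega)
      have h2 := differentiable_natCast_cpow_neg (n := n + 1) (by omega)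
      exact (((differentiable_id.sub_const 1).mul h1).add (h2.const_mul _)).sub (h1.const_mul _)
  obtain ⟨hd, hb⟩ := tail_series (g := g) (K := fun s ↦ ‖s - 1‖ * ‖s‖) hY hgd
    (fun n h s ↦ by simp [hg, h]) (by fun_prop) (fun s ↦ by positivity) (fun n hn s hs ↦ by
      simp only [hg, not_lt.mpr hn, if_false]
      have hn0 : (0 : ℝ) < n := by exact_mod_cast (by omega : 0 < n)
      have hn1 : (n : ℂ) ≠ 0 := by exact_mod_cast hn0.ne'
      have hn2 : ((n + 1 : ℕ) : ℂ) ≠ 0 := by exact_mod_cast (by omega : n + 1 ≠ 0)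
      rcases eq_or_ne s 1 with rfl | h1
      · have e1 : ((n + 1 : ℕ) : ℂ) * ((n + 1 : ℕ) : ℂ) ^ (-1 : ℂ) = 1 := by
          rw [Complex.cpow_neg_one, mul_inv_cancel₀ hn2]
        have e2 : (n : ℂ) * (n : ℂ) ^ (-1 : ℂ) = 1 := by
          rw [Complex.cpow_neg_one, mul_inv_cancel₀ hn1]
        rw [e1, e2]; simp
      have h0 : (0 : ℝ) ∉ Set.uIcc (n : ℝ) (n + 1) := by
        rw [Set.uIcc_of_le (by linarith)]; intro h; linarith [h.1]
      have e : ∫ u : ℝ in (n : ℝ)..(n + 1), (n : ℂ) ^ (-s) - (u : ℂ) ^ (-s) =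
          ((s - 1) * (n : ℂ) ^ (-s) + ((n + 1 : ℕ) : ℂ) * ((n + 1 : ℕ) : ℂ) ^ (-s)
            - n * (n : ℂ) ^ (-s)) / (s - 1) := by
        have hne : -s ≠ -1 := fun h ↦ h1 (neg_injective h)
        rw [intervalIntegral.integral_sub, integral_cpow (Or.inr ⟨hne, h0⟩)]
        · have h1' : s - 1 ≠ 0 := sub_ne_zero.mpr h1
          have h1'' : -s + 1 ≠ 0 := fun h ↦ h1' (by linear_combination -h)
          simp only [intervalIntegral.integral_const, add_sub_cancel_left, one_smul]
          push_cast at hn2 ⊢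
          rw [Complex.cpow_add _ _ hn2, Complex.cpow_add _ _ hn1, Complex.cpow_one, Complex.cpow_one]
          rw [show -s + 1 = -(s - 1) by ring]
          field_simp; ring
        · exact intervalIntegrable_const
        · refine intervalIntegral.intervalIntegrable_cpow (Or.inr h0)
      have hle : ‖∫ u : ℝ in (n : ℝ)..(n + 1), (n : ℂ) ^ (-s) - (u : ℂ) ^ (-s)‖ ≤
          ‖s‖ / s.re * ((n : ℝ) ^ (-s.re) - ((n : ℝ) + 1) ^ (-s.re)) := by
        have := intervalIntegral.norm_integral_le_of_norm_le_const (a := (n : ℝ)) (b := n + 1)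
          (C := ‖s‖ / s.re * ((n : ℝ) ^ (-s.re) - ((n : ℝ) + 1) ^ (-s.re)))
          (f := fun u : ℝ ↦ (n : ℂ) ^ (-s) - (u : ℂ) ^ (-s)) (fun u hu ↦ by
            rw [Set.uIoc_of_le (by linarith)] at hu
            have := norm_cpow_neg_sub_le hn0 hu.1.le hs
            rw [norm_sub_rev] at this
            refine this.trans ?_
            have := Real.rpow_le_rpow_of_nonpos (hn0.trans hu.1) hu.2 (by linarith : -s.re ≤ 0)
            gcongr)
        simpa using this
      rw [e, norm_div, div_le_iff₀ (norm_pos_iff.mpr (sub_ne_zero.mpr h1))] at hle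
      refine hle.trans (le_of_eq ?_)
      ring)
  have key : ∀ s : ℂ, 0 < s.re → DirichletCharacter.LFunctionTrivChar₁ 1 s =
      (s - 1) * ∑ n ∈ Ico 1 Y, (n : ℂ) ^ (-s) + (Y : ℂ) * (Y : ℂ) ^ (-s) + ∑' n, g n s := by
    refine eqOn_re_pos (DirichletCharacter.differentiable_LFunctionTrivChar₁ 1).differentiableOn ?_ ?_
    · refine DifferentiableOn.add (Differentiable.differentiableOn ?_) hd
      refine Differentiable.add (Differentiable.mul (by fun_prop) ?_)
        ((differentiable_natCast_cpow_neg (by omega)).const_mul _)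
      refine Differentiable.fun_sum fun n hn ↦ ?_
      exact differentiable_natCast_cpow_neg (by simp at hn; omega)
    · intro s hs
      have hs1 : s ≠ 1 := fun h ↦ by simp [h] at hs
      rw [LFunctionTrivChar₁_one_eq hs1, ← LSeries_one_eq_riemannZeta hs]
      have hsm : LSeriesSummable 1 s := LSeriesSummable_one_iff.mpr hs
      have t1 := hsm.hasSum.tendsto_sum_nat.const_mul (s - 1)
      have hs0 : 0 < s.re := by linarith
      have t2 := (hb s hs0).1.hasSum.tendsto_sum_nat
      have t3 : Tendsto (fun N : ℕ ↦ (N : ℂ) * (N : ℂ) ^ (-s)) atTop (𝓝 0) := by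
        refine (tendsto_natCast_cpow_neg (s := s - 1) (by simpa using hs)).congr' ?_
        filter_upwards [eventually_gt_atTop 0] with N hN
        rw [neg_sub, sub_eq_add_neg, Complex.cpow_add _ _ (by exact_mod_cast hN.ne'), Complex.cpow_one]
      refine tendsto_nhds_unique t1 ?_
      have t4 := ((tendsto_const_nhds (x := (s - 1) * ∑ n ∈ Ico 1 Y, (n : ℂ) ^ (-s) +
        (Y : ℂ) * (Y : ℂ) ^ (-s))).add t2).sub t3
      rw [sub_zero] at t4
      refine t4.congr' ?_
      filter_upwards [eventually_ge_atTop Y] with N hN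
      induction N, hN using Nat.le_induction with
      | base =>
        have e1 : ∑ i ∈ range Y, g i s = 0 :=
          sum_eq_zero fun i hi ↦ by simp [hg, mem_range.mp hi]
        rw [e1, range_eq_Ico, sum_eq_sum_Ico_succ_bot (show 0 < Y by omega)]
        simp only [add_zero, LSeries.term_zero, zero_add, add_sub_cancel_right]
        congr 1
        refine sum_congr rfl fun n hn ↦ ?_
        rw [LSeries.term_of_ne_zero (by simp at hn; omega), Complex.cpow_neg]; simp
      | succ N hN ih =>
        rw [sum_range_succ, sum_range_succ _ N, mul_add, ← ih]
        simp only [hg, not_lt.mpr hN, if_false]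
        rw [LSeries.term_of_ne_zero (by omega), div_eq_mul_inv, ← Complex.cpow_neg]
        simp only [Pi.one_apply]
        ring
  rw [key s hs, add_sub_cancel_left]
  exact (hb s hs).2

lemma sum_natCast_cpow_le {δ : ℝ} (hδ : 0 < δ) {Y : ℕ} (hY : 1 ≤ Y) {s : ℂ}
    (hs : 1 - δ / 2 ≤ s.re) {f : ℕ → ℂ} (hf : ∀ n, ‖f n‖ ≤ 1) :
    ‖∑ n ∈ Ico 1 Y, f n * (n : ℂ) ^ (-s)‖ ≤ (1 + 2 / δ) * (Y : ℝ) ^ δ := by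
  have hY1 : (1 : ℝ) ≤ Y := by exact_mod_cast hY
  have h1 : ∀ n ∈ Ico 1 Y, ‖f n * (n : ℂ) ^ (-s)‖ ≤ (Y : ℝ) ^ (δ / 2) * (n : ℝ)⁻¹ := fun n hn ↦ by
    simp only [mem_Ico] at hn
    have hn1 : (1 : ℝ) ≤ n := by exact_mod_cast hn.1
    have hnY : (n : ℝ) ≤ Y := by exact_mod_cast hn.2.le
    rw [norm_mul, Complex.norm_natCast_cpow_of_pos (by omega), Complex.neg_re]
    calc _ ≤ 1 * (n : ℝ) ^ (δ / 2 + -1) := by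
          gcongr
          · exact hf n
          · linarith
      _ = (n : ℝ) ^ (δ / 2) * (n : ℝ)⁻¹ := by
          rw [one_mul, Real.rpow_add (by linarith), Real.rpow_neg_one]
      _ ≤ _ := by gcongr
  refine (norm_sum_le_of_le _ h1).trans ?_
  rw [← mul_sum]
  have h2 : ∑ n ∈ Ico 1 Y, (n : ℝ)⁻¹ ≤ 1 + Real.log Y := by
    have := harmonic_le_one_add_log Y
    rw [harmonic_eq_sum_Icc] at this
    push_cast at this
    refine le_trans (sum_le_sum_of_subset_of_nonneg ?_ fun _ _ _ ↦ by positivity) this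
    intro n hn; simp at hn ⊢; omega
  have h3 := Real.log_le_rpow_div (by linarith : (0 : ℝ) ≤ Y) (half_pos hδ)
  have h4 : (1 : ℝ) ≤ (Y : ℝ) ^ (δ / 2) := Real.one_le_rpow hY1 (by linarith)
  have h5 : (Y : ℝ) ^ δ = (Y : ℝ) ^ (δ / 2) * (Y : ℝ) ^ (δ / 2) := by
    rw [← Real.rpow_add (by linarith)]; ring_nf
  calc _ ≤ (Y : ℝ) ^ (δ / 2) * ((Y : ℝ) ^ (δ / 2) + (Y : ℝ) ^ (δ / 2) / (δ / 2)) := by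
        gcongr; linarith
    _ = _ := by rw [h5]; field_simp

lemma norm_le_of_re_le {s : ℂ} {c : ℝ} (h0 : 0 ≤ s.re) (h : s.re ≤ c) : ‖s‖ ≤ |s.im| + c := by
  have := Complex.norm_le_abs_re_add_abs_im s
  rw [abs_of_nonneg h0] at this
  linarith

lemma exists_nat_between {T : ℝ} (hT : 1 ≤ T) : ∃ Y : ℕ, 1 ≤ Y ∧ T ≤ Y ∧ (Y : ℝ) ≤ 2 * T :=
  ⟨⌈T⌉₊, Nat.one_le_iff_ne_zero.mpr (by simp; linarith), Nat.le_ceil T, by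
    have := Nat.ceil_lt_add_one (by linarith : 0 ≤ T); linarith⟩

lemma rpow_le_two_mul {T δ : ℝ} (hT : 1 ≤ T) (hδ1 : δ ≤ 1) (hδ : 0 < δ) {Y : ℕ}
    (hY : (Y : ℝ) ≤ 2 * T) : (Y : ℝ) ^ δ ≤ 2 * T ^ δ := by
  calc (Y : ℝ) ^ δ ≤ (2 * T) ^ δ := by gcongr
    _ = 2 ^ δ * T ^ δ := Real.mul_rpow (by norm_num) (by linarith)
    _ ≤ 2 ^ (1 : ℝ) * T ^ δ := by gcongr; norm_num
    _ = _ := by norm_num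

theorem norm_LFunction_le {δ : ℝ} (hδ : 0 < δ) (hδ1 : δ ≤ 1) : ∃ C : ℝ, 1 ≤ C ∧
    ∀ (q : ℕ) [NeZero q] (Φ : ZMod q → ℂ), (∀ x, ‖Φ x‖ ≤ 1) → ∑ x, Φ x = 0 →
    ∀ s : ℂ, 1 - δ / 2 ≤ s.re → s.re ≤ 4 →
      ‖ZMod.LFunction Φ s‖ ≤ C * ((q : ℝ) * (|s.im| + 2)) ^ δ := by
  refine ⟨2 * (9 + 2 / δ), by have : 0 < 2 / δ := by positivity
                              linarith, fun q _ Φ hΦ hsum s hs hs4 ↦ ?_⟩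
  have hq : (1 : ℝ) ≤ q := by exact_mod_cast Nat.pos_of_neZero q
  have hT : 1 ≤ (q : ℝ) * (|s.im| + 2) := by
    have := abs_nonneg s.im
    nlinarith
  obtain ⟨Y, hY1, hTY, hYT⟩ := exists_nat_between hT
  have hY1' : (1 : ℝ) ≤ Y := by exact_mod_cast hY1
  have hY := rpow_le_two_mul hT hδ1 hδ hYT
  have h1 := norm_LFunction_sub_sum_le hΦ hsum hY1 (s := s) (by linarith)
  have h2 := sum_natCast_cpow_le hδ hY1 hs (f := fun n ↦ Φ n) (fun n ↦ hΦ _)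
  have h3 : 2 * q * ‖s‖ / s.re * (Y : ℝ) ^ (-s.re) ≤ 8 * (Y : ℝ) ^ δ := by
    have hn := norm_le_of_re_le (by linarith) hs4
    calc _ ≤ 2 * q * (|s.im| + 4) / (1 / 2) * (Y : ℝ) ^ (δ - 1) := by
          gcongr
          · linarith
          · linarith
      _ = 4 * (q * (|s.im| + 4)) * (Y : ℝ) ^ (δ - 1) := by ring
      _ ≤ 8 * Y * (Y : ℝ) ^ (δ - 1) := by
          have := abs_nonneg s.im
          refine mul_le_mul_of_nonneg_right ?_ (by positivity)
          nlinarith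
      _ = 8 * (Y : ℝ) ^ δ := by
          rw [mul_assoc, mul_comm (Y : ℝ), ← Real.rpow_add_one (by linarith)]; ring_nf
  have h4 := norm_sub_norm_le (ZMod.LFunction Φ s) (∑ n ∈ Ico 1 Y, Φ n * (n : ℂ) ^ (-s))
  calc ‖ZMod.LFunction Φ s‖ ≤ (9 + 2 / δ) * (Y : ℝ) ^ δ := by linarith
    _ ≤ (9 + 2 / δ) * (2 * ((q : ℝ) * (|s.im| + 2)) ^ δ) := by gcongr
    _ = _ := by ring

theorem norm_zeta_le {δ : ℝ} (hδ : 0 < δ) (hδ1 : δ ≤ 1) : ∃ C : ℝ, 1 ≤ C ∧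
    ∀ s : ℂ, 1 - δ / 2 ≤ s.re → s.re ≤ 4 →
      ‖DirichletCharacter.LFunctionTrivChar₁ 1 s‖ ≤ C * ((‖s - 1‖ + 1) * (|s.im| + 2) ^ δ) := by
  refine ⟨2 * (9 + 2 / δ), by have : 0 < 2 / δ := by positivity
                              linarith, fun s hs hs4 ↦ ?_⟩
  have hT : 1 ≤ |s.im| + 2 := by
    have := abs_nonneg s.im
    linarith
  obtain ⟨Y, hY1, hTY, hYT⟩ := exists_nat_between hT
  have hY1' : (1 : ℝ) ≤ Y := by exact_mod_cast hY1
  have hY := rpow_le_two_mul hT hδ1 hδ hYT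
  have h1 := norm_zeta_sub_sum_le hY1 (s := s) (by linarith)
  have h2 := sum_natCast_cpow_le hδ hY1 hs (f := fun n ↦ 1) (fun n ↦ by simp)
  simp only [one_mul] at h2
  have hYs : (Y : ℝ) * (Y : ℝ) ^ (δ - 1) = (Y : ℝ) ^ δ := by
    rw [mul_comm (Y : ℝ), ← Real.rpow_add_one (by linarith)]; ring_nf
  have h5 : (Y : ℝ) ^ (-s.re) ≤ (Y : ℝ) ^ (δ - 1) :=
    Real.rpow_le_rpow_of_exponent_le hY1' (by linarith)
  have h3 : ‖s - 1‖ * ‖s‖ / s.re * (Y : ℝ) ^ (-s.re) ≤ ‖s - 1‖ * (4 * (Y : ℝ) ^ δ) := by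
    have hn := norm_le_of_re_le (by linarith) hs4
    calc _ ≤ ‖s - 1‖ * (|s.im| + 4) / (1 / 2) * (Y : ℝ) ^ (δ - 1) := by
          gcongr
          · linarith
      _ = ‖s - 1‖ * (2 * (|s.im| + 4) * (Y : ℝ) ^ (δ - 1)) := by ring
      _ ≤ ‖s - 1‖ * (4 * Y * (Y : ℝ) ^ (δ - 1)) := by
          have := abs_nonneg s.im
          gcongr ?_ * (?_ * _)
          linarith
      _ = _ := by rw [mul_assoc 4, hYs]
  have h6 : ‖(Y : ℂ) * (Y : ℂ) ^ (-s)‖ ≤ (Y : ℝ) ^ δ := by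
    rw [norm_mul, Complex.norm_natCast_cpow_of_pos (by omega), Complex.norm_natCast, ← hYs]
    exact mul_le_mul_of_nonneg_left (by simpa using h5) (by positivity)
  have h4 := norm_sub_norm_le (DirichletCharacter.LFunctionTrivChar₁ 1 s)
    ((s - 1) * ∑ n ∈ Ico 1 Y, (n : ℂ) ^ (-s) + (Y : ℂ) * (Y : ℂ) ^ (-s))
  have h7 := norm_add_le ((s - 1) * ∑ n ∈ Ico 1 Y, (n : ℂ) ^ (-s)) ((Y : ℂ) * (Y : ℂ) ^ (-s))
  have h8 : ‖(s - 1) * ∑ n ∈ Ico 1 Y, (n : ℂ) ^ (-s)‖ ≤ ‖s - 1‖ * ((1 + 2 / δ) * (Y : ℝ) ^ δ) := by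
    rw [norm_mul]; gcongr
  have h9 : 0 < (Y : ℝ) ^ δ := by positivity
  have h10 := norm_nonneg (s - 1)
  calc ‖DirichletCharacter.LFunctionTrivChar₁ 1 s‖
      ≤ ‖s - 1‖ * ((5 + 2 / δ) * (Y : ℝ) ^ δ) + (Y : ℝ) ^ δ := by linarith
    _ ≤ ‖s - 1‖ * ((9 + 2 / δ) * (Y : ℝ) ^ δ) + (9 + 2 / δ) * (Y : ℝ) ^ δ := by
        have : 0 < 2 / δ := by positivity
        gcongr
        · linarith
        · nlinarith
    _ = (9 + 2 / δ) * (‖s - 1‖ + 1) * (Y : ℝ) ^ δ := by ring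
    _ ≤ (9 + 2 / δ) * (‖s - 1‖ + 1) * (2 * (|s.im| + 2) ^ δ) := by gcongr
    _ = _ := by ring

/-- The Dirichlet coefficients of `ζ(s) L(s, χ) L(s, ψ) L(s, χψ)`. -/
noncomputable def biquadraticCoeff {N : ℕ} (χ ψ : DirichletCharacter ℂ N) : ArithmeticFunction ℂ :=
  χ.zetaMul * (toArithmeticFunction (ψ ·) * toArithmeticFunction ((χ * ψ : DirichletCharacter ℂ N) ·))

lemma biquadraticCoeff_comm {N : ℕ} (χ ψ : DirichletCharacter ℂ N) :
    biquadraticCoeff χ ψ = biquadraticCoeff ψ χ := by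
  rw [biquadraticCoeff, biquadraticCoeff, DirichletCharacter.zetaMul, DirichletCharacter.zetaMul,
    mul_comm ψ χ]
  ring

lemma isMultiplicative_biquadraticCoeff {N : ℕ} (χ ψ : DirichletCharacter ℂ N) :
    (biquadraticCoeff χ ψ).IsMultiplicative :=
  χ.isMultiplicative_zetaMul.mul <|
    (DirichletCharacter.isMultiplicative_toArithmeticFunction ψ).mul
      (DirichletCharacter.isMultiplicative_toArithmeticFunction _)

lemma toArithmeticFunction_mul_apply {N : ℕ} (χ ψ : DirichletCharacter ℂ N) (n : ℕ) :
    (toArithmeticFunction (ψ ·) * toArithmeticFunction ((χ * ψ : DirichletCharacter ℂ N) ·)) n =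
      ψ n * χ.zetaMul n := by
  rw [DirichletCharacter.zetaMul, ArithmeticFunction.mul_apply, ArithmeticFunction.mul_apply,
    mul_sum]
  refine sum_congr rfl fun x hx ↦ ?_
  obtain ⟨hx, hn⟩ := Nat.mem_divisorsAntidiagonal.mp hx
  have h1 : x.1 ≠ 0 := fun h ↦ hn (by simp [← hx, h])
  have h2 : x.2 ≠ 0 := fun h ↦ hn (by simp [← hx, h])
  simp only [toArithmeticFunction, ArithmeticFunction.coe_mk, h1, h2, if_false, ← hx,
    ArithmeticFunction.natCoe_apply, ArithmeticFunction.zeta_apply, Nat.cast_mul, map_mul,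
    MulChar.mul_apply]
  simp; ring

open scoped ComplexOrder in
lemma biquadraticCoeff_prime_pow_nonneg_of_nonneg {N : ℕ} {χ ψ : DirichletCharacter ℂ N}
    (hχ : χ ^ 2 = 1) {p : ℕ} (hp : p.Prime) (k : ℕ) (h : ∀ j, 0 ≤ ψ p ^ j * χ.zetaMul (p ^ j)) :
    0 ≤ biquadraticCoeff χ ψ (p ^ k) := by
  rw [biquadraticCoeff, ArithmeticFunction.mul_apply]
  refine sum_nonneg fun x hx ↦ ?_
  obtain ⟨hx, hn⟩ := Nat.mem_divisorsAntidiagonal.mp hx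
  obtain ⟨i, -, hi⟩ := (Nat.dvd_prime_pow hp).mp (Dvd.intro _ hx)
  obtain ⟨j, -, hj⟩ := (Nat.dvd_prime_pow hp).mp (Dvd.intro_left _ hx)
  rw [toArithmeticFunction_mul_apply, hi, hj]
  refine mul_nonneg (DirichletCharacter.zetaMul_prime_pow_nonneg hχ hp i) ?_
  simpa using h j

open scoped ComplexOrder in
lemma biquadraticCoeff_nonneg {N : ℕ} {χ ψ : DirichletCharacter ℂ N}
    (hχ : χ ^ 2 = 1) (hψ : ψ ^ 2 = 1) (n : ℕ) : 0 ≤ biquadraticCoeff χ ψ n := by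
  rcases eq_or_ne n 0 with rfl | hn
  · simp
  rw [(isMultiplicative_biquadraticCoeff χ ψ).multiplicative_factorization _ hn]
  refine prod_nonneg fun p hp ↦ ?_
  have hp := Nat.prime_of_mem_primeFactors hp
  have key : ∀ {χ ψ : DirichletCharacter ℂ N}, χ ^ 2 = 1 → ψ ^ 2 = 1 → 0 ≤ ψ p → 
      ∀ k, 0 ≤ biquadraticCoeff χ ψ (p ^ k) := fun hχ hψ h k ↦
    biquadraticCoeff_prime_pow_nonneg_of_nonneg hχ hp k fun j ↦
      mul_nonneg (pow_nonneg h j) (DirichletCharacter.zetaMul_prime_pow_nonneg hχ hp j)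
  have hψp := MulChar.isQuadratic_iff_sq_eq_one.mpr hψ p
  have hχp := MulChar.isQuadratic_iff_sq_eq_one.mpr hχ p
  by_cases h1 : 0 ≤ ψ p
  · exact key hχ hψ h1 _
  by_cases h2 : 0 ≤ χ p
  · rw [biquadraticCoeff_comm]
    exact key hψ hχ h2 _
  have h1' : ψ p = -1 := by
    rcases hψp with h | h | h
    · simp [h] at h1
    · simp [h] at h1
    · exact h
  have h2' : χ p = -1 := by
    rcases hχp with h | h | h
    · simp [h] at h2
    · simp [h] at h2
    · exact h
  refine biquadraticCoeff_prime_pow_nonneg_of_nonneg hχ hp _ fun j ↦ ?_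
  rcases Nat.even_or_odd j with hj | hj
  · rw [h1', hj.neg_one_pow, one_mul]
    exact DirichletCharacter.zetaMul_prime_pow_nonneg hχ hp j
  · have : χ.zetaMul (p ^ j) = 0 := by
      rw [DirichletCharacter.zetaMul, ArithmeticFunction.coe_zeta_mul_apply,
        Nat.sum_divisors_prime_pow hp]
      have : ∀ i ∈ range (j + 1), toArithmeticFunction (χ ·) (p ^ i) = (-1) ^ i := fun i _ ↦ by
        simp [toArithmeticFunction, hp.ne_zero, h2']
      rw [sum_congr rfl this, neg_one_geom_sum, if_pos hj.add_one]
    simp [this]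

lemma lseriesSummable_toArithmeticFunction {N : ℕ} (χ : DirichletCharacter ℂ N) {s : ℂ}
    (hs : 1 < s.re) : LSeriesSummable (toArithmeticFunction (χ ·)) s :=
  LSeriesSummable_of_bounded_of_one_lt_re (m := 1) (fun n hn ↦ by
    simpa [toArithmeticFunction, hn] using DirichletCharacter.norm_le_one χ _) hs

lemma lseries_toArithmeticFunction {N : ℕ} [NeZero N] (χ : DirichletCharacter ℂ N) {s : ℂ}
    (hs : 1 < s.re) : LSeries (toArithmeticFunction (χ ·)) s = χ.LFunction s := by
  rw [DirichletCharacter.LFunction_eq_LSeries χ hs]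
  exact LSeries_congr (fun {n} hn ↦ by simp [toArithmeticFunction, hn]) s

lemma lseriesSummable_biquadraticCoeff {N : ℕ} (χ ψ : DirichletCharacter ℂ N) {s : ℂ}
    (hs : 1 < s.re) : LSeriesSummable (biquadraticCoeff χ ψ) s :=
  ArithmeticFunction.LSeriesSummable_mul (χ.LSeriesSummable_zetaMul hs) <|
    ArithmeticFunction.LSeriesSummable_mul (lseriesSummable_toArithmeticFunction _ hs)
      (lseriesSummable_toArithmeticFunction _ hs)

lemma lseries_biquadraticCoeff {N : ℕ} [NeZero N] (χ ψ : DirichletCharacter ℂ N) {s : ℂ}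
    (hs : 1 < s.re) : LSeries (biquadraticCoeff χ ψ) s =
      riemannZeta s * (χ.LFunction s * ψ.LFunction s * (χ * ψ).LFunction s) := by
  have h1 := lseriesSummable_toArithmeticFunction χ hs
  have h2 := lseriesSummable_toArithmeticFunction ψ hs
  have h3 := lseriesSummable_toArithmeticFunction (χ * ψ) hs
  rw [biquadraticCoeff, ArithmeticFunction.LSeries_mul' (χ.LSeriesSummable_zetaMul hs)
    (ArithmeticFunction.LSeriesSummable_mul h2 h3), ArithmeticFunction.LSeries_mul' h2 h3,
    DirichletCharacter.zetaMul, ArithmeticFunction.LSeries_mul' _ h1,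
    lseries_toArithmeticFunction χ hs, lseries_toArithmeticFunction ψ hs,
    lseries_toArithmeticFunction _ hs]
  · have := ArithmeticFunction.LSeries_zeta_eq_riemannZeta hs
    rw [show LSeries (fun n ↦ (ArithmeticFunction.zeta : ArithmeticFunction ℂ) n) s = riemannZeta s
      from this]
    ring
  · exact ArithmeticFunction.LSeriesSummable_zeta_iff.mpr hs

lemma le_mul_rpow_of_hasSum {c : ℕ → ℝ} {lam B x G : ℝ} (hB : 1 ≤ B)
    (hc : ∀ n, -lam ≤ c n) (hc0 : 1 - lam ≤ c 0) (hb : ∀ n, |c n| ≤ B * (2 / 3) ^ n)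
    (hx : 1 < x) (hx' : x ≤ 9 / 8) (hG : HasSum (fun n ↦ c n * x ^ n) G)
    (h : G - lam / (x - 1) ≤ 0) : x - 1 ≤ 12 * lam * B ^ (4 * (x - 1)) := by
  have hx0 : 0 < x - 1 := by linarith
  set m := ⌈4 * Real.log (8 * B)⌉₊ with hm
  have hlog : 0 < Real.log (8 * B) := Real.log_pos (by linarith)
  have hm1 : 1 ≤ m := Nat.one_le_ceil_iff.mpr (by positivity)
  have hm2 : 4 * Real.log (8 * B) ≤ m := Nat.le_ceil _
  have hm3 : (m : ℝ) ≤ 4 * Real.log (8 * B) + 1 := (Nat.ceil_lt_add_one (by positivity)).le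
  have head : 1 - lam * ((x ^ m - 1) / (x - 1)) ≤ ∑ n ∈ range m, c n * x ^ n := by
    rw [← geom_sum_eq hx.ne', mul_sum]
    obtain ⟨k, hk⟩ : ∃ k, m = k + 1 := ⟨m - 1, by omega⟩
    rw [hk, sum_range_succ', sum_range_succ']
    have : ∑ i ∈ range k, -(lam * x ^ (i + 1)) ≤ ∑ i ∈ range k, c (i + 1) * x ^ (i + 1) :=
      sum_le_sum fun i _ ↦ by
        rw [← neg_mul]
        exact mul_le_mul_of_nonneg_right (hc _) (by positivity)
    rw [sum_neg_distrib] at this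
    simp only [pow_zero, mul_one]
    linarith
  have tail : -(4 * B * (3 / 4) ^ m) ≤ G - ∑ n ∈ range m, c n * x ^ n := by
    have h1 : HasSum (fun n ↦ c (n + m) * x ^ (n + m)) (G - ∑ n ∈ range m, c n * x ^ n) := by
      refine (hasSum_nat_add_iff (f := fun n ↦ c n * x ^ n) m).mpr ?_
      simpa using hG
    have h2 : HasSum (fun n : ℕ ↦ -(B * (3 / 4) ^ m * (3 / 4 : ℝ) ^ n)) (-(4 * B * (3 / 4) ^ m)) := by
      have := (hasSum_geometric_of_lt_one (r := (3 / 4 : ℝ)) (by norm_num) (by norm_num)).mul_left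
        (B * (3 / 4) ^ m)
      rw [show -(4 * B * (3 / 4 : ℝ) ^ m) = -(B * (3 / 4) ^ m * (1 - 3 / 4)⁻¹) by norm_num; ring]
      exact this.neg
    refine hasSum_le (fun n ↦ ?_) h2 h1
    have h3 := hb (n + m)
    have h4 : |c (n + m) * x ^ (n + m)| ≤ B * (3 / 4) ^ m * (3 / 4 : ℝ) ^ n := by
      rw [abs_mul, abs_of_pos (by positivity : 0 < x ^ (n + m))]
      calc _ ≤ B * (2 / 3) ^ (n + m) * (9 / 8) ^ (n + m) := by gcongr
        _ = B * (2 / 3 * (9 / 8)) ^ (n + m) := by rw [mul_pow]; ring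
        _ = _ := by rw [pow_add]; norm_num; ring
    exact (abs_le.mp h4).1
  have hlog43 : (1 : ℝ) / 4 ≤ Real.log (4 / 3) := by
    have := Real.one_sub_inv_le_log_of_pos (by norm_num : (0 : ℝ) < 4 / 3)
    norm_num at this ⊢
    linarith
  have h43 : 8 * B ≤ (4 / 3 : ℝ) ^ m := by
    rw [← Real.log_le_log_iff (by positivity) (by positivity), Real.log_pow]
    nlinarith
  have h34 : 4 * B * (3 / 4) ^ m ≤ 1 / 2 := by
    have h5 : (3 / 4 : ℝ) ^ m * (4 / 3) ^ m = 1 := by rw [← mul_pow]; norm_num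
    have h6 : (0 : ℝ) < (3 / 4) ^ m := by positivity
    nlinarith
  have hxm : x ^ m ≤ 6 * B ^ (4 * (x - 1)) := by
    have e1 : x ^ m ≤ Real.exp ((x - 1) * m) := by
      rw [mul_comm, Real.exp_nat_mul]
      gcongr
      linarith [Real.add_one_le_exp (x - 1)]
    have e2 : Real.exp ((x - 1) * m) ≤
        Real.exp (1 / 8) * ((8 : ℝ) ^ (4 * (x - 1)) * B ^ (4 * (x - 1))) := by
      rw [← Real.mul_rpow (by norm_num) (by linarith),
        Real.rpow_def_of_pos (by positivity : 0 < 8 * B), ← Real.exp_add]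
      gcongr
      nlinarith
    have e3 : (8 : ℝ) ^ (4 * (x - 1)) ≤ 3 := by
      calc (8 : ℝ) ^ (4 * (x - 1)) ≤ (8 : ℝ) ^ (1 / 2 : ℝ) := by gcongr <;> linarith
        _ = √8 := (Real.sqrt_eq_rpow 8).symm
        _ ≤ 3 := Real.sqrt_le_iff.mpr (by norm_num)
    have e4 : Real.exp (1 / 8) ≤ 2 := by
      have := Real.exp_bound_div_one_sub_of_interval (x := 1 / 8) (by norm_num) (by norm_num)
      norm_num at this ⊢
      linarith
    calc x ^ m ≤ _ := e1.trans e2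
      _ ≤ 2 * (3 * B ^ (4 * (x - 1))) := by gcongr
      _ = _ := by ring
  have hfin : 1 / 2 ≤ lam * x ^ m / (x - 1) := by
    have : lam * x ^ m / (x - 1) = lam * ((x ^ m - 1) / (x - 1)) + lam / (x - 1) := by ring
    linarith
  rw [le_div_iff₀ hx0] at hfin
  have hlam : 0 ≤ lam := by
    by_contra hneg
    have : lam * x ^ m < 0 := mul_neg_of_neg_of_pos (by linarith) (by positivity)
    linarith
  nlinarith [mul_le_mul_of_nonneg_left hxm hlam]

lemma iteratedDeriv_inv_sub_one (n : ℕ) :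
    iteratedDeriv n (fun s : ℂ ↦ (s - 1)⁻¹) 2 = (-1) ^ n * n.factorial := by
  have := congrFun (iter_deriv_inv_linear_sub n (1 : ℂ) 1) 2
  rw [iteratedDeriv_eq_iterate]
  simp only [one_mul, one_pow, mul_one] at this
  rw [this]
  norm_num

open scoped ComplexOrder in
/-- Estermann's lower bound for the residue of a Dirichlet series with nonnegative coefficients,
`ζ` times an entire function, that is not positive at some point left of `1`. -/
lemma sub_le_mul_rpow_of_re_nonneg {P : ℂ → ℂ} (hP : Differentiable ℂ P) {r : ArithmeticFunction ℂ}
    (hr : ∀ n, 0 ≤ r n) (hr1 : r 1 = 1) (hsum : ∀ s : ℂ, 1 < s.re → LSeriesSummable r s)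
    (heq : ∀ s : ℂ, 1 < s.re → LSeries r s = riemannZeta s * P s) {lam B : ℝ} (hlam : P 1 = lam)
    (hB : 1 ≤ B) (hlB : |lam| ≤ B)
    (hb : ∀ s ∈ Metric.sphere (2 : ℂ) (3 / 2),
      ‖DirichletCharacter.LFunctionTrivChar₁ 1 s * P s‖ ≤ B) {β : ℝ} (hβ : 7 / 8 ≤ β) (hβ1 : β < 1)
    (hre : 0 ≤ (DirichletCharacter.LFunctionTrivChar₁ 1 β * P β).re) :
    1 - β ≤ 12 * lam * (4 * B) ^ (4 * (1 - β)) := by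
  set H := DirichletCharacter.LFunctionTrivChar₁ 1 with hH
  have hHd : Differentiable ℂ H := DirichletCharacter.differentiable_LFunctionTrivChar₁ 1
  have hH1 : H 1 = 1 := by simp [hH]
  set h : ℂ → ℂ := fun s ↦ H s * P s - lam with hh
  have hhd : Differentiable ℂ h := (hHd.mul hP).sub_const _
  set g := dslope h 1 with hg
  have hgd : Differentiable ℂ g := by
    rw [← differentiableOn_univ] at hhd ⊢
    exact (Complex.differentiableOn_dslope Filter.univ_mem).mpr hhd
  have hgs : ∀ s ≠ 1, g s = (H s * P s - lam) / (s - 1) := fun s hs ↦ by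
    rw [hg, dslope_of_ne h hs, slope_def_field]
    simp [hh, hH1, hlam]
  have hgB : ∀ z ∈ Metric.sphere (2 : ℂ) (3 / 2), ‖g z‖ ≤ 4 * B := fun z hz ↦ by
    have hz' : ‖z - 2‖ = 3 / 2 := by simpa [dist_eq_norm] using hz
    have h1 : 1 / 2 ≤ ‖z - 1‖ := by
      have := norm_sub_norm_le (z - 2) (-1)
      rw [hz', norm_neg, norm_one, show z - 2 - -1 = z - 1 by ring] at this
      linarith
    have hz1 : z ≠ 1 := fun h ↦ by rw [h] at h1; norm_num at h1
    rw [hgs z hz1, norm_div, div_le_iff₀ (by linarith)]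
    have h2 := norm_sub_le (H z * P z) lam
    rw [Complex.norm_real, Real.norm_eq_abs] at h2
    have := hb z hz
    nlinarith
  have habs : LSeries.abscissaOfAbsConv r ≤ (1 : ℝ) :=
    LSeries.abscissaOfAbsConv_le_of_forall_lt_LSeriesSummable fun y hy ↦ hsum _ (by simpa using hy)
  have h2 : LSeries.abscissaOfAbsConv r < ((2 : ℝ) : EReal) :=
    habs.trans_lt (by exact_mod_cast one_lt_two)
  have hev : g =ᶠ[𝓝 2] fun s ↦ LSeries r s - lam * (s - 1)⁻¹ := by
    have : {s : ℂ | 1 < s.re} ∈ 𝓝 (2 : ℂ) :=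
      (isOpen_lt continuous_const Complex.continuous_re).mem_nhds (by simp)
    filter_upwards [this] with s hs
    have hs1 : s ≠ 1 := fun h ↦ by simp [h] at hs
    have hs2 : s - 1 ≠ 0 := sub_ne_zero.mpr hs1
    rw [hgs s hs1, heq s hs, hH, LFunctionTrivChar₁_one_eq hs1]
    field_simp
  have han : AnalyticAt ℂ (LSeries r) 2 := LSeries_analyticOnNhd r 2 (by simpa using! h2)
  have hinv : AnalyticAt ℂ (fun s : ℂ ↦ (s - 1)⁻¹) 2 :=
    (analyticAt_id.sub analyticAt_const).inv (by norm_num)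
  have hder : ∀ n, iteratedDeriv n g 2 =
      iteratedDeriv n (LSeries r) 2 - lam * ((-1) ^ n * n.factorial) := fun n ↦ by
    rw [hev.iteratedDeriv_eq, iteratedDeriv_fun_sub han.contDiffAt
      (g := fun s : ℂ ↦ lam * (s - 1)⁻¹)
      (analyticAt_const.fun_mul hinv).contDiffAt, iteratedDeriv_const_mul_field,
      iteratedDeriv_inv_sub_one]
  set c : ℕ → ℝ := fun n ↦ ((-1 : ℂ) ^ n * (n.factorial : ℂ)⁻¹ * iteratedDeriv n g 2).re with hc
  have hone : ∀ n, ((-1 : ℂ) ^ n) * (-1) ^ n = 1 := fun n ↦ by rw [← mul_pow]; norm_num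
  have hcn : ∀ n, c n = ((n.factorial : ℂ)⁻¹ * ((-1 : ℂ) ^ n * iteratedDeriv n (LSeries r) 2)).re
      - lam := fun n ↦ by
    have hf : (n.factorial : ℂ) ≠ 0 := by exact_mod_cast n.factorial_ne_zero
    rw [hc]
    simp only
    rw [hder, show (-1 : ℂ) ^ n * (n.factorial : ℂ)⁻¹ *
        (iteratedDeriv n (LSeries r) 2 - lam * ((-1) ^ n * n.factorial)) = 
        (n.factorial : ℂ)⁻¹ * ((-1 : ℂ) ^ n * iteratedDeriv n (LSeries r) 2) -
        lam * (((-1 : ℂ) ^ n) * (-1) ^ n) * ((n.factorial : ℂ)⁻¹ * n.factorial) by ring,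
      hone, inv_mul_cancel₀ hf]
    simp
  have hcl : ∀ n, -lam ≤ c n := fun n ↦ by
    have h1 := ArithmeticFunction.iteratedDeriv_LSeries_alternating r hr h2 n
    have h3 : (0 : ℂ) ≤ (n.factorial : ℂ)⁻¹ := by
      rw [← Complex.ofReal_natCast, ← Complex.ofReal_inv]
      exact_mod_cast inv_nonneg.mpr (Nat.cast_nonneg _)
    have h4 := (Complex.le_def.mp (mul_nonneg h3 h1)).1
    rw [hcn]
    simp only [Complex.zero_re, Complex.ofReal_ofNat] at h4
    linarith
  have hc0 : 1 - lam ≤ c 0 := by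
    have h1 : 1 ≤ (LSeries r 2).re := by
      have h3 := Complex.hasSum_re (hsum 2 (by simp)).hasSum
      have h4 := le_hasSum h3 1 fun j _ ↦ ?_
      · rw [LSeries.term_of_ne_zero one_ne_zero, hr1] at h4
        simpa [LSeries] using h4
      · exact (Complex.le_def.mp (LSeries.term_nonneg (hr j) 2)).1
    rw [hcn]
    simp only [Nat.factorial_zero, Nat.cast_one, inv_one, pow_zero, iteratedDeriv_zero, one_mul]
    linarith
  have hcb : ∀ n, |c n| ≤ 4 * B * (2 / 3) ^ n := fun n ↦ by
    have h1 := Complex.norm_iteratedDeriv_le_of_forall_mem_sphere_norm_le n (by norm_num)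
      (hgd.diffContOnCl) hgB
    have hf : (0 : ℝ) < n.factorial := by exact_mod_cast n.factorial_pos
    refine (Complex.abs_re_le_norm _).trans ?_
    rw [norm_mul, norm_mul, norm_pow, norm_neg, norm_one, one_pow, one_mul, norm_inv,
      Complex.norm_natCast]
    calc _ ≤ (n.factorial : ℝ)⁻¹ * (n.factorial * (4 * B) / (3 / 2) ^ n) := by gcongr
      _ = 4 * B * ((3 / 2) ^ n)⁻¹ := by field_simp
      _ = _ := by rw [← inv_pow]; norm_num
  have hβ1' : (β : ℂ) ≠ 1 := by exact_mod_cast hβ1.ne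
  have hS : HasSum (fun n ↦ c n * (2 - β) ^ n) (g β).re := by
    have h1 := Complex.hasSum_re (Complex.hasSum_taylorSeries_of_entire hgd 2 β)
    refine h1.congr_fun fun n ↦ ?_
    simp only [hc, smul_eq_mul]
    rw [← Complex.re_mul_ofReal]
    congr 1
    push_cast
    rw [show (β : ℂ) - 2 = -1 * (2 - β) by ring, mul_pow]
    ring
  have := le_mul_rpow_of_hasSum (by linarith : 1 ≤ 4 * B) hcl hc0 hcb (x := 2 - β) (by linarith)
    (by linarith) hS ?_
  · rwa [show 2 - β - 1 = 1 - β by ring] at this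
  · rw [hgs _ hβ1']
    have e : ((H β * P β - lam) / ((β : ℂ) - 1)).re = ((H β * P β).re - lam) / (β - 1) := by
      rw [show (β : ℂ) - 1 = ((β - 1 : ℝ) : ℂ) by push_cast; ring, Complex.div_ofReal_re]
      simp
    rw [e, show 2 - β - 1 = -(β - 1) by ring, div_neg, sub_neg_eq_add, ← add_div, sub_add_cancel]
    exact div_nonpos_of_nonneg_of_nonpos hre (by linarith)

lemma norm_dirichlet_LFunction_le {δ : ℝ} (hδ : 0 < δ) (hδ1 : δ ≤ 1) : ∃ C, 1 ≤ C ∧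
    ∀ (q : ℕ) [NeZero q] (χ : DirichletCharacter ℂ q), χ ≠ 1 → ∀ s : ℂ, 1 - δ / 2 ≤ s.re →
      s.re ≤ 4 → ‖χ.LFunction s‖ ≤ C * ((q : ℝ) * (|s.im| + 2)) ^ δ := by
  obtain ⟨C, hC, h⟩ := norm_LFunction_le hδ hδ1
  exact ⟨C, hC, fun q _ χ hχ s h1 h2 ↦
    h q χ (fun x ↦ DirichletCharacter.norm_le_one χ x) (χ.sum_eq_zero_of_ne_one hχ) s h1 h2⟩

lemma exists_half_pow_mul_rpow_le_prod {ε : ℝ} (hε : 0 < ε) : ∃ c : ℝ, 0 < c ∧ ∀ q : ℕ, q ≠ 0 →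
    c * (q : ℝ) ^ (-ε) ≤ ∏ p ∈ q.primeFactors, (1 - (p : ℝ)⁻¹) := by
  set P₀ : ℕ := ⌈(2 : ℝ) ^ (1 / ε)⌉₊ with hP₀
  refine ⟨(1 / 2) ^ P₀, by positivity, fun q hq ↦ ?_⟩
  have h1 : ∀ p ∈ q.primeFactors,
      (if p < P₀ then (1 / 2 : ℝ) else 1) * (p : ℝ) ^ (-ε) ≤ 1 - (p : ℝ)⁻¹ := fun p hp ↦ by
    have hp2 : (2 : ℝ) ≤ p := by exact_mod_cast (Nat.prime_of_mem_primeFactors hp).two_le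
    have h2 : (1 / 2 : ℝ) ≤ 1 - (p : ℝ)⁻¹ := by
      have : (p : ℝ)⁻¹ ≤ 2⁻¹ := by gcongr
      linarith
    split_ifs with h
    · have : (p : ℝ) ^ (-ε) ≤ 1 := Real.rpow_le_one_of_one_le_of_nonpos (by linarith) (by linarith)
      linarith
    · have h3 : (2 : ℝ) ^ (1 / ε) ≤ p := (Nat.le_ceil _).trans (by exact_mod_cast not_lt.mp h)
      have h4 : 2 ≤ (p : ℝ) ^ ε := by
        calc (2 : ℝ) = ((2 : ℝ) ^ (1 / ε)) ^ ε := by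
              rw [← Real.rpow_mul (by norm_num), one_div_mul_cancel hε.ne', Real.rpow_one]
          _ ≤ _ := by gcongr
      rw [one_mul, Real.rpow_neg (by linarith)]
      refine le_trans ?_ h2
      rw [one_div]
      gcongr
  refine le_trans ?_ (prod_le_prod (fun p hp ↦ by split_ifs <;> positivity) h1)
  rw [prod_mul_distrib]
  refine mul_le_mul ?_ ?_ (by positivity) (prod_nonneg fun p _ ↦ by split_ifs <;> positivity)
  · rw [prod_ite, prod_const_one, mul_one, prod_const]
    refine pow_le_pow_of_le_one (by norm_num) (by norm_num) ?_
    calc _ ≤ #(range P₀) := card_le_card fun p hp ↦ by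
          simp only [mem_filter] at hp
          exact mem_range.mpr hp.2
      _ = _ := card_range _
  · rw [Real.finsetProd_rpow _ _ (fun p _ ↦ by positivity)]
    refine Real.rpow_le_rpow_of_nonpos ?_ ?_ (by linarith)
    · exact prod_pos fun p hp ↦ by exact_mod_cast (Nat.prime_of_mem_primeFactors hp).pos
    · rw [← Nat.cast_prod]
      exact_mod_cast Nat.le_of_dvd (Nat.pos_of_ne_zero hq) (Nat.prod_primeFactors_dvd q)

lemma tendsto_sum_LFunction {q : ℕ} [NeZero q] {χ : DirichletCharacter ℂ q} (hχ : χ ≠ 1) {s : ℂ}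
    (hs : 0 < s.re) :
    Tendsto (fun Y : ℕ ↦ ∑ n ∈ Ico 1 Y, χ n * (n : ℂ) ^ (-s)) atTop (𝓝 (χ.LFunction s)) := by
  rw [tendsto_iff_norm_sub_tendsto_zero]
  have h0 : Tendsto (fun Y : ℕ ↦ 2 * q * ‖s‖ / s.re * (Y : ℝ) ^ (-s.re)) atTop (𝓝 0) := by
    have := ((tendsto_rpow_neg_atTop hs).comp tendsto_natCast_atTop_atTop).const_mul
      (2 * q * ‖s‖ / s.re)
    simpa using this
  refine squeeze_zero' (Eventually.of_forall fun _ ↦ norm_nonneg _) ?_ h0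
  filter_upwards [eventually_ge_atTop 1] with Y hY
  rw [norm_sub_rev]
  exact norm_LFunction_sub_sum_le (fun x ↦ DirichletCharacter.norm_le_one χ x)
    (χ.sum_eq_zero_of_ne_one hχ) hY hs

lemma im_LFunction_ofReal_eq_zero {q : ℕ} [NeZero q] {χ : DirichletCharacter ℂ q} (hχ : χ ≠ 1)
    (h2 : χ ^ 2 = 1) {σ : ℝ} (hσ : 0 < σ) : (χ.LFunction σ).im = 0 := by
  have h := (Complex.continuous_im.tendsto _).comp
    (tendsto_sum_LFunction hχ (s := σ) (by simpa using hσ))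
  refine tendsto_nhds_unique h (tendsto_const_nhds.congr fun Y ↦ ?_)
  simp only [Function.comp_apply, Complex.im_sum]
  refine (sum_eq_zero fun n _ ↦ ?_).symm
  have hn : (n : ℂ) ^ (-(σ : ℂ)) = ((n : ℝ) ^ (-σ) : ℝ) := by
    rw [Complex.ofReal_cpow (by positivity)]; simp
  rw [hn]
  rcases MulChar.isQuadratic_iff_sq_eq_one.mpr h2 (n : ZMod q) with h | h | h <;> simp [h]

lemma re_LFunction_two_pos {q : ℕ} [NeZero q] (χ : DirichletCharacter ℂ q) :
    0 < (χ.LFunction 2).re := by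
  rw [DirichletCharacter.LFunction_eq_LSeries χ (by simp)]
  have h1 : LSeriesSummable (χ ·) 2 := χ.LSeriesSummable_of_one_lt_re (by simp)
  have h2 := Complex.hasSum_re h1.hasSum
  have h3 : HasSum (fun n : ℕ ↦ (if n = 1 then (2 : ℝ) else 0) - 1 / (n : ℝ) ^ 2)
      (2 - Real.pi ^ 2 / 6) := (hasSum_ite_eq 1 2).sub hasSum_zeta_two
  have h4 := hasSum_le (fun n ↦ ?_) h3 h2
  · have : Real.pi ^ 2 < 12 := by nlinarith [Real.pi_lt_d2, Real.pi_pos]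
    rw [LSeries]
    linarith
  · rcases eq_or_ne n 1 with rfl | hn
    · simp [LSeries.term]
      norm_num
    rcases eq_or_ne n 0 with rfl | hn0
    · simp [LSeries.term]
    · rw [if_neg hn, zero_sub]
      refine (abs_le.mp ((Complex.abs_re_le_norm _).trans ?_)).1
      rw [LSeries.norm_term_eq, if_neg hn0]
      simp only [Complex.re_ofNat]
      rw [show (n : ℝ) ^ (2 : ℝ) = (n : ℝ) ^ 2 by norm_cast]
      gcongr
      exact DirichletCharacter.norm_le_one χ _

lemma re_LFunction_pos {q : ℕ} [NeZero q] {χ : DirichletCharacter ℂ q} (hχ : χ ≠ 1)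
    (h2 : χ ^ 2 = 1) {β : ℝ} (hβ : 0 < β) (hβ1 : β ≤ 1)
    (h0 : ∀ σ : ℝ, β ≤ σ → σ < 1 → χ.LFunction σ ≠ 0) : 0 < (χ.LFunction β).re := by
  by_contra! hneg
  have hcont : ContinuousOn (fun σ : ℝ ↦ (χ.LFunction σ).re) (Set.Icc β 2) :=
    (Complex.continuous_re.comp ((DirichletCharacter.differentiable_LFunction hχ).continuous.comp
      Complex.continuous_ofReal)).continuousOn
  obtain ⟨σ, hσ, hz⟩ := intermediate_value_Icc (by linarith : β ≤ 2) hcont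
    ⟨hneg, by simpa using (re_LFunction_two_pos χ).le⟩
  have hz' : χ.LFunction σ = 0 :=
    Complex.ext hz (im_LFunction_ofReal_eq_zero hχ h2 (by linarith [hσ.1]))
  rcases lt_or_ge σ 1 with h | h
  · exact h0 σ hσ.1 h hz'
  · exact DirichletCharacter.LFunction_ne_zero_of_one_le_re χ (Or.inl hχ) (by simpa using h) hz'

lemma exists_sub_le_mul_norm_LFunction_one : ∃ C, 1 ≤ C ∧
    ∀ (N : ℕ) [NeZero N] (χ ψ : DirichletCharacter ℂ N), χ ^ 2 = 1 → ψ ^ 2 = 1 → χ ≠ 1 → ψ ≠ 1 →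
      χ * ψ ≠ 1 → ∀ β : ℝ, 7 / 8 ≤ β → β < 1 → 
      0 ≤ (DirichletCharacter.LFunctionTrivChar₁ 1 β *
        (χ.LFunction β * ψ.LFunction β * (χ * ψ).LFunction β)).re →
      1 - β ≤ 12 * (‖χ.LFunction 1‖ * ‖ψ.LFunction 1‖ * ‖(χ * ψ).LFunction 1‖) *
        (C * (N : ℝ) ^ 3) ^ (4 * (1 - β)) := by
  obtain ⟨C₁, hC₁, hL⟩ := norm_dirichlet_LFunction_le one_pos le_rfl
  obtain ⟨C₂, hC₂, hZ⟩ := norm_zeta_le one_pos le_rfl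
  refine ⟨4 * (13 * C₂ * (4 * C₁) ^ 3), ?_, fun N _ χ ψ hχ hψ hχ1 hψ1 hχψ1 β hβ hβ1 hre ↦ ?_⟩
  · have : 1 ≤ C₁ ^ 3 := one_le_pow₀ hC₁
    nlinarith
  have hχψ : (χ * ψ) ^ 2 = 1 := by rw [mul_pow, hχ, hψ, one_mul]
  have hN : (1 : ℝ) ≤ N := by exact_mod_cast NeZero.one_le
  have hreal : ∀ {θ : DirichletCharacter ℂ N}, θ ≠ 1 → θ ^ 2 = 1 →
      θ.LFunction 1 = ((θ.LFunction 1).re : ℂ) := fun h1 h2 ↦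
    Complex.ext rfl (by simpa using im_LFunction_ofReal_eq_zero h1 h2 one_pos)
  set lam : ℝ := (χ.LFunction 1).re * (ψ.LFunction 1).re * ((χ * ψ).LFunction 1).re with hlam
  have hP1 : χ.LFunction 1 * ψ.LFunction 1 * (χ * ψ).LFunction 1 = lam := by
    rw [hreal hχ1 hχ, hreal hψ1 hψ, hreal hχψ1 hχψ, hlam]
    push_cast
    rfl
  have hnlam : |lam| = ‖χ.LFunction 1‖ * ‖ψ.LFunction 1‖ * ‖(χ * ψ).LFunction 1‖ := by
    rw [← Real.norm_eq_abs, ← Complex.norm_real, ← hP1, norm_mul, norm_mul]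
  have hLb : ∀ {θ : DirichletCharacter ℂ N}, θ ≠ 1 → ∀ s : ℂ, 1 / 2 ≤ s.re → s.re ≤ 4 →
      |s.im| ≤ 2 → ‖θ.LFunction s‖ ≤ 4 * C₁ * N := fun h1 s hs1 hs2 hs3 ↦ by
    have := hL N _ h1 s (by linarith) hs2
    rw [Real.rpow_one] at this
    nlinarith [mul_pos (by linarith : 0 < C₁) (by linarith : (0 : ℝ) < N)]
  have hPb : ∀ s : ℂ, 1 / 2 ≤ s.re → s.re ≤ 4 → |s.im| ≤ 2 →
      ‖χ.LFunction s * ψ.LFunction s * (χ * ψ).LFunction s‖ ≤ (4 * C₁) ^ 3 * N ^ 3 :=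
    fun s hs1 hs2 hs3 ↦ by
      rw [norm_mul, norm_mul]
      calc _ ≤ 4 * C₁ * N * (4 * C₁ * N) * (4 * C₁ * N) := by
            gcongr
            · exact hLb hχ1 s hs1 hs2 hs3
            · exact hLb hψ1 s hs1 hs2 hs3
            · exact hLb hχψ1 s hs1 hs2 hs3
        _ = _ := by ring
  have hCN : 1 ≤ (4 * C₁) ^ 3 * (N : ℝ) ^ 3 := by
    rw [← mul_pow]
    exact one_le_pow₀ (by nlinarith)
  have hlB : |lam| ≤ (4 * C₁) ^ 3 * N ^ 3 := by
    rw [hnlam, ← norm_mul, ← norm_mul]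
    exact hPb 1 (by norm_num) (by norm_num) (by norm_num)
  have hB : (4 * C₁) ^ 3 * (N : ℝ) ^ 3 ≤ 13 * C₂ * (4 * C₁) ^ 3 * N ^ 3 := by
    nlinarith
  have key := sub_le_mul_rpow_of_re_nonneg (B := 13 * C₂ * (4 * C₁) ^ 3 * N ^ 3)
    (((DirichletCharacter.differentiable_LFunction hχ1).mul
    (DirichletCharacter.differentiable_LFunction hψ1)).mul
    (DirichletCharacter.differentiable_LFunction hχψ1)) (biquadraticCoeff_nonneg hχ hψ)
    (isMultiplicative_biquadraticCoeff χ ψ).map_one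
    (fun s hs ↦ lseriesSummable_biquadraticCoeff χ ψ hs)
    (fun s hs ↦ lseries_biquadraticCoeff χ ψ hs) hP1 (hCN.trans hB) (hlB.trans hB) ?_ hβ hβ1 hre
  · refine key.trans ?_
    rw [← hnlam, show 4 * (13 * C₂ * (4 * C₁) ^ 3 * (N : ℝ) ^ 3) =
      4 * (13 * C₂ * (4 * C₁) ^ 3) * N ^ 3 by ring]
    gcongr
    exact le_abs_self _
  · intro s hs
    have hs' : ‖s - 2‖ = 3 / 2 := by simpa [dist_eq_norm] using hs
    have h1 := (Complex.abs_re_le_norm (s - 2)).trans_eq hs'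
    have h2 := (Complex.abs_im_le_norm (s - 2)).trans_eq hs'
    simp only [Complex.sub_re, Complex.re_ofNat, Complex.sub_im, Complex.im_ofNat, sub_zero] at h1 h2
    rw [abs_le] at h1
    have h3 : ‖s - 1‖ ≤ 5 / 2 := by
      calc ‖s - 1‖ = ‖(s - 2) + 1‖ := by ring_nf
        _ ≤ ‖s - 2‖ + ‖(1 : ℂ)‖ := norm_add_le _ _
        _ = _ := by rw [hs', norm_one]; norm_num
    have h4 := hZ s (by linarith [h1.1]) (by linarith [h1.2])
    rw [Real.rpow_one] at h4
    have h5 : ‖DirichletCharacter.LFunctionTrivChar₁ 1 s‖ ≤ 13 * C₂ := by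
      refine h4.trans ?_
      have : (‖s - 1‖ + 1) * (|s.im| + 2) ≤ (5 / 2 + 1) * (3 / 2 + 2) := by gcongr
      nlinarith
    rw [norm_mul, mul_assoc (13 * C₂)]
    simp only [Pi.mul_apply]
    exact mul_le_mul h5 (hPb s (by linarith [h1.1]) (by linarith [h1.2]) (by linarith))
      (norm_nonneg _) (by linarith)

lemma exists_norm_LFunction_changeLevel_one {ε : ℝ} (hε : 0 < ε) : ∃ c : ℝ, 0 < c ∧
    ∀ (M N : ℕ) [NeZero M] [NeZero N] (h : M ∣ N) (χ : DirichletCharacter ℂ M), χ ≠ 1 →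
      c * (N : ℝ) ^ (-ε) * ‖χ.LFunction 1‖ ≤
        ‖(DirichletCharacter.changeLevel h χ).LFunction 1‖ ∧
      c * (N : ℝ) ^ (-ε) * ‖(DirichletCharacter.changeLevel h χ).LFunction 1‖ ≤
        ‖χ.LFunction 1‖ := by
  obtain ⟨c, hc, hprod⟩ := exists_half_pow_mul_rpow_le_prod hε
  refine ⟨c, hc, fun M N _ _ h χ hχ ↦ ?_⟩
  rw [DirichletCharacter.LFunction_changeLevel h χ (Or.inl hχ), norm_mul, norm_prod]
  have h1 := hprod N (NeZero.ne N)
  have hb : ∀ p ∈ N.primeFactors, ‖χ p * (p : ℂ) ^ (-1 : ℂ)‖ ≤ (p : ℝ)⁻¹ := fun p _ ↦ by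
    rw [Complex.cpow_neg_one, norm_mul, norm_inv, Complex.norm_natCast]
    exact mul_le_of_le_one_left (by positivity) (DirichletCharacter.norm_le_one χ _)
  have hp : ∀ p ∈ N.primeFactors, 0 < (p : ℝ)⁻¹ ∧ (p : ℝ)⁻¹ ≤ 1 / 2 := fun p hp ↦ by
    have hp2 : (2 : ℝ) ≤ p := by exact_mod_cast (Nat.prime_of_mem_primeFactors hp).two_le
    refine ⟨by positivity, ?_⟩
    rw [one_div]
    gcongr
  constructor
  · rw [mul_comm]
    gcongr
    refine h1.trans (prod_le_prod (fun p hp' ↦ by linarith [hp p hp']) fun p hp' ↦ ?_)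
    have := norm_sub_norm_le 1 (χ p * (p : ℂ) ^ (-1 : ℂ))
    rw [norm_one] at this
    linarith [hb p hp']
  · have h2 : c * (N : ℝ) ^ (-ε) * ∏ p ∈ N.primeFactors, ‖1 - χ p * (p : ℂ) ^ (-1 : ℂ)‖ ≤ 1 := by
      refine (mul_le_mul_of_nonneg_right h1 (prod_nonneg fun _ _ ↦ norm_nonneg _)).trans ?_
      rw [← prod_mul_distrib]
      refine prod_le_one (fun p hp' ↦ mul_nonneg (by linarith [hp p hp']) (norm_nonneg _))
        fun p hp' ↦ ?_
      have := norm_sub_le 1 (χ p * (p : ℂ) ^ (-1 : ℂ))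
      rw [norm_one] at this
      have h3 := hp p hp'
      calc _ ≤ (1 - (p : ℝ)⁻¹) * (1 + (p : ℝ)⁻¹) := by
            gcongr
            · linarith
            · linarith [hb p hp']
        _ ≤ 1 := by nlinarith
    calc _ = (c * (N : ℝ) ^ (-ε) * ∏ p ∈ N.primeFactors, ‖1 - χ p * (p : ℂ) ^ (-1 : ℂ)‖) *
          ‖χ.LFunction 1‖ := by ring
      _ ≤ 1 * ‖χ.LFunction 1‖ := by gcongr
      _ = _ := one_mul _

/-- For `β` close to `1` there is one fixed quadratic character `χ₁` such that the biquadratic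
product formed with any further quadratic character is nonpositive at `β`. -/
lemma exists_quadratic_re_nonneg {η : ℝ} (hη : 0 < η) (hη8 : η ≤ 1 / 8)
    (hH : ∀ β : ℝ, 1 - η ≤ β → β < 1 → 0 ≤ (DirichletCharacter.LFunctionTrivChar₁ 1 β).re)
    (hex : ∃ (q : ℕ) (_ : NeZero q) (χ : DirichletCharacter ℂ q), χ ^ 2 = 1 ∧ χ ≠ 1) :
    ∃ (q : ℕ) (_ : NeZero q) (χ : DirichletCharacter ℂ q) (β : ℝ), χ ^ 2 = 1 ∧ χ ≠ 1 ∧ 1 - η ≤ β ∧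
      β < 1 ∧ ∀ (N : ℕ) [NeZero N] (h : q ∣ N) (ψ : DirichletCharacter ℂ N), ψ ^ 2 = 1 → ψ ≠ 1 →
        DirichletCharacter.changeLevel h χ * ψ ≠ 1 →
        0 ≤ (DirichletCharacter.LFunctionTrivChar₁ 1 β *
          ((DirichletCharacter.changeLevel h χ).LFunction β * ψ.LFunction β *
            (DirichletCharacter.changeLevel h χ * ψ).LFunction β)).re := by
  by_cases hA : ∃ (q : ℕ) (_ : NeZero q) (χ : DirichletCharacter ℂ q) (β : ℝ), χ ^ 2 = 1 ∧ χ ≠ 1 ∧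
      1 - η ≤ β ∧ β < 1 ∧ χ.LFunction β = 0
  · obtain ⟨q, hq, χ, β, hχ, hχ1, hβ, hβ1, hz⟩ := hA
    refine ⟨q, hq, χ, β, hχ, hχ1, hβ, hβ1, fun N _ h ψ _ _ _ ↦ ?_⟩
    rw [DirichletCharacter.LFunction_changeLevel h χ (Or.inl hχ1), hz]
    simp
  · push Not at hA
    obtain ⟨q, hq, χ, hχ, hχ1⟩ := hex
    refine ⟨q, hq, χ, 1 - η, hχ, hχ1, le_rfl, by linarith, fun N _ h ψ hψ hψ1 hχψ1 ↦ ?_⟩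
    set χ' := DirichletCharacter.changeLevel h χ with hχ'
    have hχ'2 : χ' ^ 2 = 1 := by rw [hχ', ← map_pow, hχ, map_one]
    have hχ'1 : χ' ≠ 1 := by
      rwa [hχ', Ne, DirichletCharacter.changeLevel_eq_one_iff]
    have hpos : ∀ {θ : DirichletCharacter ℂ N}, θ ≠ 1 → θ ^ 2 = 1 →
        ∃ x : ℝ, 0 < x ∧ θ.LFunction ((1 - η : ℝ) : ℂ) = x := fun h1 h2 ↦
      ⟨_, re_LFunction_pos h1 h2 (by linarith) (by linarith) fun σ hσ hσ1 ↦
        hA N inferInstance _ σ h2 h1 hσ hσ1,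
        Complex.ext rfl (by simpa using im_LFunction_ofReal_eq_zero h1 h2 (σ := 1 - η) (by linarith))⟩
    obtain ⟨x, hx, hx'⟩ := hpos hχ'1 hχ'2
    obtain ⟨y, hy, hy'⟩ := hpos hψ1 hψ
    obtain ⟨z, hz, hz'⟩ := hpos hχψ1 (by rw [mul_pow, hχ'2, hψ, one_mul])
    rw [hx', hy', hz', ← Complex.ofReal_mul, ← Complex.ofReal_mul, Complex.re_mul_ofReal]
    exact mul_nonneg (hH _ le_rfl (by linarith)) (by positivity)

/-- **Siegel's theorem**. -/
theorem siegel {ε : ℝ} (hε : 0 < ε) : ∃ c : ℝ, 0 < c ∧ ∀ (q : ℕ) [NeZero q]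
    (χ : DirichletCharacter ℂ q), χ ^ 2 = 1 → χ ≠ 1 → c * (q : ℝ) ^ (-ε) ≤ ‖χ.LFunction 1‖ := by
  by_cases hex : ∃ (q : ℕ) (_ : NeZero q) (χ : DirichletCharacter ℂ q), χ ^ 2 = 1 ∧ χ ≠ 1
  swap
  · push Not at hex
    exact ⟨1, one_pos, fun q _ χ h1 h2 ↦ absurd (hex q inferInstance χ h1) h2⟩
  set δ := min (ε / 4) 1 with hδ
  have hδ0 : 0 < δ := by positivity
  have hδ1 : δ ≤ 1 := min_le_right _ _
  have hδε : 4 * δ ≤ ε := by linarith [min_le_left (ε / 4) 1]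
  obtain ⟨η₀, hη₀, hH⟩ : ∃ η₀ > 0, ∀ β : ℝ, |β - 1| < η₀ →
      0 ≤ (DirichletCharacter.LFunctionTrivChar₁ 1 β).re := by
    have hcont : Continuous fun β : ℝ ↦ (DirichletCharacter.LFunctionTrivChar₁ 1 β).re :=
      Complex.continuous_re.comp ((DirichletCharacter.differentiable_LFunctionTrivChar₁
        1).continuous.comp Complex.continuous_ofReal)
    have h1 := (hcont.tendsto 1).eventually_const_lt (u := 0) (by simp)
    obtain ⟨η₀, h2, h3⟩ := Metric.eventually_nhds_iff.mp h1
    exact ⟨η₀, h2, fun β hβ ↦ (h3 (by rwa [Real.dist_eq])).le⟩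
  set η := min (η₀ / 2) (δ / 12) with hη
  have hη0 : 0 < η := by positivity
  have hη1 : η < η₀ := (min_le_left _ _).trans_lt (by linarith)
  have hη2 : 12 * η ≤ δ := by linarith [min_le_right (η₀ / 2) (δ / 12)]
  obtain ⟨q₁, hq₁, χ, β, hχ, hχ1, hβ, hβ1, hre⟩ := exists_quadratic_re_nonneg hη0 (by linarith)
    (fun β h1 h2 ↦ hH β (by rw [abs_lt]; constructor <;> linarith)) hex
  obtain ⟨c, hc, hlev⟩ := exists_norm_LFunction_changeLevel_one hδ0
  obtain ⟨C, hC, hest⟩ := exists_sub_le_mul_norm_LFunction_one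
  obtain ⟨D, hD, hup⟩ := norm_dirichlet_LFunction_le hδ0 hδ1
  have hL1 : 0 < ‖χ.LFunction 1‖ := norm_pos_iff.mpr
    (DirichletCharacter.LFunction_apply_one_ne_zero hχ1)
  set K := 12 * (2 * D) ^ 2 * C with hK
  have hK0 : 0 < K := by positivity
  have hq₁0 : (1 : ℝ) ≤ q₁ := by exact_mod_cast NeZero.one_le
  refine ⟨min (c * c * ‖χ.LFunction 1‖) (c * (1 - β) / K) * (q₁ : ℝ) ^ (-ε), by
    have : 0 < 1 - β := by linarith
    positivity, fun q₂ _ ψ hψ hψ1 ↦ ?_⟩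
  have hN : (1 : ℝ) ≤ (q₁ * q₂ : ℕ) := by exact_mod_cast NeZero.one_le
  set N := q₁ * q₂ with hNdef
  set χ' := DirichletCharacter.changeLevel (Dvd.intro q₂ rfl : q₁ ∣ N) χ with hχ'
  set ψ' := DirichletCharacter.changeLevel (Dvd.intro_left q₁ rfl : q₂ ∣ N) ψ with hψ'
  have hχ'2 : χ' ^ 2 = 1 := by rw [hχ', ← map_pow, hχ, map_one]
  have hψ'2 : ψ' ^ 2 = 1 := by rw [hψ', ← map_pow, hψ, map_one]
  have hχ'1 : χ' ≠ 1 := by rwa [hχ', Ne, DirichletCharacter.changeLevel_eq_one_iff]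
  have hψ'1 : ψ' ≠ 1 := by rwa [hψ', Ne, DirichletCharacter.changeLevel_eq_one_iff]
  have hNε : (N : ℝ) ^ (-ε) ≤ (N : ℝ) ^ (-(4 * δ)) := by gcongr
  have hpow : (q₁ : ℝ) ^ (-ε) * (q₂ : ℝ) ^ (-ε) = (N : ℝ) ^ (-ε) := by
    rw [← Real.mul_rpow (by positivity) (by positivity), hNdef]
    push_cast
    rfl
  rw [mul_assoc, hpow]
  refine (mul_le_mul_of_nonneg_left hNε
    (le_min (by positivity) (div_nonneg (mul_nonneg hc.le (by linarith)) hK0.le))).trans ?_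
  have hψlev := (hlev q₂ N (Dvd.intro_left q₁ rfl) ψ hψ1).2
  rw [← hψ'] at hψlev
  by_cases hprod : χ' * ψ' = 1
  · have heq : ψ' = χ' := by
      calc ψ' = χ' ^ 2 * ψ' := by rw [hχ'2, one_mul]
        _ = χ' * (χ' * ψ') := by rw [sq, mul_assoc]
        _ = χ' := by rw [hprod, mul_one]
    have hχlev := (hlev q₁ N (Dvd.intro q₂ rfl) χ hχ1).1
    rw [heq] at hψlev
    refine le_trans ?_ hψlev
    refine le_trans ?_ (mul_le_mul_of_nonneg_left hχlev (by positivity))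
    calc _ ≤ c * c * ‖χ.LFunction 1‖ * (N : ℝ) ^ (-(2 * δ)) := by
          gcongr
          · exact min_le_left _ _
          · norm_num
      _ = c * c * ‖χ.LFunction 1‖ * ((N : ℝ) ^ (-δ) * (N : ℝ) ^ (-δ)) := by
          rw [← Real.rpow_add (by linarith)]
          ring_nf
      _ = _ := by ring
  · have h1 := hest N χ' ψ' hχ'2 hψ'2 hχ'1 hψ'1 hprod β (by linarith) hβ1
      (hre N (Dvd.intro q₂ rfl) ψ' hψ'2 hψ'1 hprod)
    have hLb : ∀ {θ : DirichletCharacter ℂ N}, θ ≠ 1 → ‖θ.LFunction 1‖ ≤ 2 * D * (N : ℝ) ^ δ := by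
      intro θ hθ
      have h2 := hup N θ hθ 1 (by simp; linarith) (by norm_num)
      rw [Complex.one_im, abs_zero, zero_add, Real.mul_rpow (by linarith) (by norm_num)] at h2
      have h3 : (2 : ℝ) ^ δ ≤ 2 := by
        calc (2 : ℝ) ^ δ ≤ 2 ^ (1 : ℝ) := by gcongr; norm_num
          _ = 2 := Real.rpow_one 2
      calc _ ≤ D * ((N : ℝ) ^ δ * 2) := h2.trans (by gcongr)
        _ = _ := by ring
    have hCp : (C * (N : ℝ) ^ 3) ^ (4 * (1 - β)) ≤ C * (N : ℝ) ^ δ := by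
      rw [Real.mul_rpow (by linarith) (by positivity)]
      gcongr
      · calc C ^ (4 * (1 - β)) ≤ C ^ (1 : ℝ) := by gcongr <;> linarith
          _ = C := Real.rpow_one C
      · rw [← Real.rpow_natCast, ← Real.rpow_mul (by linarith)]
        gcongr
        push_cast; linarith
    have h4 : 1 - β ≤ K * (N : ℝ) ^ (3 * δ) * ‖ψ'.LFunction 1‖ := by
      refine h1.trans ?_
      calc _ ≤ 12 * (2 * D * (N : ℝ) ^ δ * ‖ψ'.LFunction 1‖ * (2 * D * (N : ℝ) ^ δ)) *
            (C * (N : ℝ) ^ δ) := by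
            gcongr
            · exact hLb hχ'1
            · exact hLb hprod
        _ = K * ((N : ℝ) ^ δ * (N : ℝ) ^ δ * (N : ℝ) ^ δ) * ‖ψ'.LFunction 1‖ := by rw [hK]; ring
        _ = _ := by
          rw [← Real.rpow_add (by linarith), ← Real.rpow_add (by linarith)]
          ring_nf
    have hNN : (N : ℝ) ^ (3 * δ) * (N : ℝ) ^ (-(4 * δ)) = (N : ℝ) ^ (-δ) := by
      rw [← Real.rpow_add (by linarith)]
      ring_nf
    refine le_trans ?_ hψlev
    calc _ ≤ c * (1 - β) / K * (N : ℝ) ^ (-(4 * δ)) := by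
          gcongr
          exact min_le_right _ _
      _ ≤ c * (K * (N : ℝ) ^ (3 * δ) * ‖ψ'.LFunction 1‖) / K * (N : ℝ) ^ (-(4 * δ)) := by gcongr
      _ = c * ((N : ℝ) ^ (3 * δ) * (N : ℝ) ^ (-(4 * δ))) * ‖ψ'.LFunction 1‖ := by field_simp
      _ = _ := by rw [hNN]

/-- The quantitative conclusion of the `3-4-1` argument. -/
lemma le_norm_of_three_four_one {f : ℝ → ℂ} {A U V : ℝ} (hA : 1 ≤ A) (hU : 1 ≤ U) (hV : 1 ≤ V)
    (h1 : ∀ σ, 1 < σ → σ ≤ 2 → 1 ≤ (A / (σ - 1)) ^ 3 * ‖f σ‖ ^ 4 * V)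
    (h2 : ∀ σ σ', 1 < σ → σ ≤ σ' → σ' ≤ 2 → ‖f σ' - f σ‖ ≤ U * (σ' - σ)) {σ : ℝ} (hσ : 1 < σ)
    (hσ2 : σ ≤ 2) : 1 / (16 * A ^ 3 * V * U ^ 3) ≤ ‖f σ‖ := by
  set θ := 1 / (16 * A ^ 3 * V * U ^ 4) with hθ
  have hθ0 : 0 < θ := by positivity
  have hθ1 : θ ≤ 1 := by
    rw [hθ, div_le_one (by positivity)]
    have : 1 ≤ A ^ 3 * V * U ^ 4 :=
      one_le_mul_of_one_le_of_one_le (one_le_mul_of_one_le_of_one_le (one_le_pow₀ hA) hV)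
        (one_le_pow₀ hU)
    nlinarith
  have hUθ : 1 / (16 * A ^ 3 * V * U ^ 3) = U * θ := by rw [hθ]; field_simp
  have key : ∀ σ', 1 + θ ≤ σ' → σ' ≤ 2 → 2 * (U * θ) ≤ ‖f σ'‖ := fun σ' hs hs2 ↦ by
    refine le_of_pow_le_pow_left₀ (n := 4) (by norm_num) (norm_nonneg _) ?_
    have h3 := h1 σ' (by linarith) hs2
    have h4 : (A / (σ' - 1)) ^ 3 ≤ (A / θ) ^ 3 := by
      have h40 : 0 ≤ A / (σ' - 1) := div_nonneg (by linarith) (by linarith)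
      have h41 : A / (σ' - 1) ≤ A / θ :=
        div_le_div_of_nonneg_left (by linarith) hθ0 (by linarith)
      exact pow_le_pow_left₀ h40 h41 3
    have h5 : 1 ≤ (A / θ) ^ 3 * ‖f σ'‖ ^ 4 * V := h3.trans (by gcongr)
    have h6 : (A / θ) ^ 3 * V * (2 * (U * θ)) ^ 4 = 1 := by
      have : A ^ 3 * V * U ^ 4 * 16 * θ = 1 := by rw [hθ]; field_simp
      calc _ = A ^ 3 * V * U ^ 4 * 16 * θ := by field_simp; norm_num
        _ = 1 := this
    have h7 : 0 < (A / θ) ^ 3 * V := by positivity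
    by_contra! hlt
    have := mul_lt_mul_of_pos_left hlt h7
    linarith
  rw [hUθ]
  rcases le_or_gt (1 + θ) σ with h | h
  · have := key σ h hσ2
    have : 0 < U * θ := by positivity
    linarith
  · have h8 := key (1 + θ) le_rfl (by linarith)
    have h9 := h2 σ (1 + θ) hσ h.le (by linarith)
    have h10 := norm_sub_norm_le (f (1 + θ)) (f σ)
    have : U * (1 + θ - σ) ≤ U * θ := by gcongr; linarith
    linarith

lemma norm_deriv_le_of_strip {f : ℂ → ℂ} (hf : Differentiable ℂ f) {ρ a B : ℝ} (hρ : 0 < ρ)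
    (hρ1 : ρ ≤ 1) (ha : 0 ≤ a) (ha2 : a ≤ 2)
    (hb : ∀ s : ℂ, 1 - ρ / 2 ≤ s.re → s.re ≤ 4 → ‖f s‖ ≤ B * (|s.im| + 2) ^ a) {s : ℂ}
    (hs : 1 - ρ / 4 ≤ s.re) (hs3 : s.re ≤ 3) : ‖deriv f s‖ ≤ 16 / ρ * B * (|s.im| + 2) ^ a := by
  have hB : 0 ≤ B := by
    have := (norm_nonneg _).trans (hb 2 (by simp; linarith) (by norm_num))
    exact nonneg_of_mul_nonneg_left this (by positivity)
  have := Complex.norm_deriv_le_of_forall_mem_sphere_norm_le (c := s) (R := ρ / 4)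
    (C := 4 * B * (|s.im| + 2) ^ a) (by positivity) hf.diffContOnCl fun z hz ↦ ?_
  · calc _ ≤ _ := this
      _ = _ := by field_simp; ring
  · have hz' : ‖z - s‖ = ρ / 4 := by simpa [dist_eq_norm] using hz
    have h1 := (Complex.abs_re_le_norm (z - s)).trans_eq hz'
    have h2 := (Complex.abs_im_le_norm (z - s)).trans_eq hz'
    simp only [Complex.sub_re, Complex.sub_im] at h1 h2
    rw [abs_le] at h1
    have h3 : |z.im| ≤ |s.im| + 1 := by
      have := abs_sub_abs_le_abs_sub z.im s.im
      linarith
    refine (hb z (by linarith [h1.1]) (by linarith [h1.2])).trans ?_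
    calc B * (|z.im| + 2) ^ a ≤ B * (2 * (|s.im| + 2)) ^ a := by
          gcongr
          linarith [abs_nonneg s.im]
      _ = B * (2 ^ a * (|s.im| + 2) ^ a) := by rw [Real.mul_rpow (by norm_num) (by positivity)]
      _ ≤ B * (4 * (|s.im| + 2) ^ a) := by
          gcongr
          calc (2 : ℝ) ^ a ≤ 2 ^ (2 : ℝ) := by gcongr; norm_num
            _ = 4 := by norm_num
      _ = _ := by ring

lemma norm_sub_le_of_deriv_strip {f : ℂ → ℂ} (hf : Differentiable ℂ f) {U : ℝ} {S : Set ℂ}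
    (hS : Convex ℝ S) (hb : ∀ s ∈ S, ‖deriv f s‖ ≤ U) {z w : ℂ} (hz : z ∈ S) (hw : w ∈ S) :
    ‖f w - f z‖ ≤ U * ‖w - z‖ :=
  hS.norm_image_sub_le_of_norm_deriv_le (fun x _ ↦ hf x) hb hz hw

lemma norm_LFunction_le_norm_zeta {q : ℕ} [NeZero q] (χ : DirichletCharacter ℂ q) {s : ℂ}
    (hs : 1 < s.re) : ‖χ.LFunction s‖ ≤ ‖riemannZeta s.re‖ := by
  rw [DirichletCharacter.LFunction_eq_LSeries χ hs, zeta_eq_tsum_one_div_nat_cpow (by simpa)]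
  have h0 : Summable fun n : ℕ ↦ 1 / (n : ℝ) ^ s.re := Real.summable_one_div_nat_rpow.mpr hs
  have h1 : ∑' n : ℕ, 1 / (n : ℂ) ^ (s.re : ℂ) = ((∑' n : ℕ, 1 / (n : ℝ) ^ s.re : ℝ) : ℂ) := by
    rw [Complex.ofReal_tsum]
    refine tsum_congr fun n ↦ ?_
    push_cast
    rw [Complex.ofReal_cpow (by positivity)]
    simp
  rw [h1, Complex.norm_real]
  refine le_trans ?_ (le_abs_self _)
  refine tsum_of_norm_bounded h0.hasSum fun n ↦ ?_
  rw [LSeries.norm_term_eq]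
  split_ifs
  · positivity
  · gcongr
    exact DirichletCharacter.norm_le_one χ _

lemma exists_norm_zeta_ofReal_le : ∃ A : ℝ, 1 ≤ A ∧ ∀ σ : ℝ, 1 < σ → σ ≤ 2 →
    ‖riemannZeta σ‖ ≤ A / (σ - 1) := by
  obtain ⟨C, hC, h⟩ := norm_zeta_le one_pos le_rfl
  refine ⟨4 * C, by linarith, fun σ h1 h2 ↦ ?_⟩
  have h3 := h σ (by simp; linarith) (by simp; linarith)
  have h4 : (σ : ℂ) - 1 = ((σ - 1 : ℝ) : ℂ) := by push_cast; rfl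
  rw [LFunctionTrivChar₁_one_eq (by exact_mod_cast h1.ne'), norm_mul, h4, Complex.norm_real,
    Real.norm_of_nonneg (by linarith), Complex.ofReal_im, abs_zero, zero_add, Real.rpow_one] at h3
  rw [le_div_iff₀ (by linarith), mul_comm]
  refine h3.trans ?_
  nlinarith

lemma one_le_three_four_one {A : ℝ} (hA : ∀ σ : ℝ, 1 < σ → σ ≤ 2 → ‖riemannZeta σ‖ ≤ A / (σ - 1))
    {q : ℕ} [NeZero q] (χ : DirichletCharacter ℂ q) {σ : ℝ} (t : ℝ) (hσ : 1 < σ) (hσ2 : σ ≤ 2) :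
    1 ≤ (A / (σ - 1)) ^ 3 * ‖χ.LFunction (σ + Complex.I * t)‖ ^ 4 *
      ‖(χ ^ 2).LFunction (σ + 2 * Complex.I * t)‖ := by
  have := DirichletCharacter.norm_LFunction_product_ge_one χ (x := σ - 1) (by linarith) t
  have e : (1 : ℂ) + ((σ - 1 : ℝ) : ℂ) = σ := by push_cast; ring
  rw [e, norm_mul, norm_mul, norm_pow, norm_pow] at this
  refine this.le.trans ?_
  gcongr
  exact (norm_LFunction_le_norm_zeta 1 (by simpa)).trans (by simpa using hA σ hσ hσ2)

lemma norm_trivial_LFunction_le {δ : ℝ} (hδ : 0 < δ) (hδ1 : δ ≤ 1) : ∃ C : ℝ, 1 ≤ C ∧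
    ∀ (q : ℕ) [NeZero q] (s : ℂ), 1 < s.re → s.re ≤ 4 →
      ‖(1 : DirichletCharacter ℂ q).LFunction s‖ ≤
        C * ((q : ℝ) * (|s.im| + 2)) ^ δ * (1 + 1 / ‖s - 1‖) := by
  obtain ⟨C, hC, hζ⟩ := norm_zeta_le hδ hδ1
  obtain ⟨c, hc, hprod⟩ := exists_half_pow_mul_rpow_le_prod hδ
  refine ⟨max 1 (C / c), le_max_left _ _, fun q _ s hs hs4 ↦ ?_⟩
  have hs1 : s ≠ 1 := fun h ↦ by simp [h] at hs
  have hs0 : 0 < ‖s - 1‖ := norm_pos_iff.mpr (sub_ne_zero.mpr hs1)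
  have h1 : ‖riemannZeta s‖ ≤ C * (1 + 1 / ‖s - 1‖) * (|s.im| + 2) ^ δ := by
    have := hζ s (by linarith) hs4
    rw [LFunctionTrivChar₁_one_eq hs1, norm_mul] at this
    refine le_of_mul_le_mul_left (this.trans_eq ?_) hs0
    field_simp
  have h2 : ‖∏ p ∈ q.primeFactors, (1 - (p : ℂ) ^ (-s))‖ ≤ c⁻¹ * (q : ℝ) ^ δ := by
    have hq : (0 : ℝ) < q := by exact_mod_cast NeZero.pos q
    have h3 := hprod q (NeZero.ne q)
    have h4 : ‖∏ p ∈ q.primeFactors, (1 - (p : ℂ) ^ (-s))‖ ≤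
        (∏ p ∈ q.primeFactors, (1 - (p : ℝ)⁻¹))⁻¹ := by
      rw [norm_prod, ← Finset.prod_inv_distrib]
      refine Finset.prod_le_prod (fun _ _ ↦ norm_nonneg _) fun p hp ↦ ?_
      have hp2 := (Nat.prime_of_mem_primeFactors hp).two_le
      have hp2' : (2 : ℝ) ≤ p := by exact_mod_cast hp2
      have h5 : ‖(p : ℂ) ^ (-s)‖ ≤ (p : ℝ)⁻¹ := by
        rw [Complex.norm_natCast_cpow_of_pos (by lia), ← Real.rpow_neg_one]
        exact Real.rpow_le_rpow_of_exponent_le (by linarith) (by simp; linarith)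
      have h6 : (p : ℝ)⁻¹ ≤ 2⁻¹ := by gcongr
      have h7 : 0 < (p : ℝ)⁻¹ := by positivity
      refine (norm_sub_le _ _).trans ?_
      rw [norm_one, ← one_div, le_div_iff₀ (by linarith)]
      nlinarith
    refine h4.trans ?_
    rw [Real.rpow_neg hq.le] at h3
    rw [← inv_inv ((q : ℝ) ^ δ), ← mul_inv]
    gcongr
  calc ‖(1 : DirichletCharacter ℂ q).LFunction s‖
      = ‖∏ p ∈ q.primeFactors, (1 - (p : ℂ) ^ (-s))‖ * ‖riemannZeta s‖ := by
        rw [← norm_mul, ← DirichletCharacter.LFunctionTrivChar_eq_mul_riemannZeta hs1]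
    _ ≤ (c⁻¹ * (q : ℝ) ^ δ) * (C * (1 + 1 / ‖s - 1‖) * (|s.im| + 2) ^ δ) := by gcongr
    _ = C / c * ((q : ℝ) * (|s.im| + 2)) ^ δ * (1 + 1 / ‖s - 1‖) := by
        rw [Real.mul_rpow (by positivity) (by positivity)]; ring
    _ ≤ _ := by gcongr; exact le_max_right _ _

lemma norm_deriv_LFunction_le {ρ : ℝ} (hρ : 0 < ρ) (hρ1 : ρ ≤ 1) : ∃ K, 1 ≤ K ∧
    ∀ (q : ℕ) [NeZero q] (χ : DirichletCharacter ℂ q), χ ≠ 1 → ∀ s : ℂ, 1 - ρ / 4 ≤ s.re →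
      s.re ≤ 3 → ‖deriv χ.LFunction s‖ ≤ K * ((q : ℝ) * (|s.im| + 2)) ^ ρ := by
  obtain ⟨C, hC, h⟩ := norm_dirichlet_LFunction_le hρ hρ1
  refine ⟨16 / ρ * C, ?_, fun q _ χ hχ s hs hs3 ↦ ?_⟩
  · have : 1 ≤ 16 / ρ := by rw [le_div_iff₀ hρ]; linarith
    exact one_le_mul_of_one_le_of_one_le this hC
  · have := norm_deriv_le_of_strip (DirichletCharacter.differentiable_LFunction hχ) hρ hρ1 hρ.le
      (by linarith) (B := C * (q : ℝ) ^ ρ) (fun s h1 h2 ↦ by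
        have := h q χ hχ s h1 h2
        rwa [Real.mul_rpow (by positivity) (by positivity), ← mul_assoc] at this) hs hs3
    rw [Real.mul_rpow (by positivity) (by positivity)]
    linarith

/-- The `3-4-1` lower bound, given a bound for the `L`-function of `χ ^ 2`. -/
lemma exists_le_norm_LFunction_of_sq_le {ρ : ℝ} (hρ : 0 < ρ) (hρ1 : ρ ≤ 1) {C : ℝ} (hC : 1 ≤ C) :
    ∃ c : ℝ, 0 < c ∧ ∀ (q : ℕ) [NeZero q] (χ : DirichletCharacter ℂ q), χ ≠ 1 → ∀ t : ℝ,
      (∀ σ : ℝ, 1 < σ → σ ≤ 2 → ‖(χ ^ 2).LFunction (σ + 2 * Complex.I * t)‖ ≤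
        C * ((q : ℝ) * (|t| + 2)) ^ (4 * ρ)) → ∀ σ : ℝ, 1 < σ → σ ≤ 2 →
      c * ((q : ℝ) * (|t| + 2)) ^ (-7 * ρ) ≤ ‖χ.LFunction (σ + Complex.I * t)‖ := by
  obtain ⟨A, hA, hζ⟩ := exists_norm_zeta_ofReal_le
  obtain ⟨K, hK, hd⟩ := norm_deriv_LFunction_le hρ hρ1
  refine ⟨1 / (16 * A ^ 3 * C * K ^ 3), by positivity, fun q _ χ hχ t hsq σ hσ hσ2 ↦ ?_⟩
  have hq : (1 : ℝ) ≤ q := by exact_mod_cast NeZero.one_le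
  set T := (q : ℝ) * (|t| + 2) with hT
  have hT1 : 1 ≤ T := one_le_mul_of_one_le_of_one_le hq (by linarith [abs_nonneg t])
  have hT0 : 0 < T := by linarith
  have := le_norm_of_three_four_one (f := fun σ ↦ χ.LFunction (σ + Complex.I * t)) (A := A)
    (U := K * T ^ ρ) (V := C * T ^ (4 * ρ)) hA
    (one_le_mul_of_one_le_of_one_le hK (Real.one_le_rpow hT1 hρ.le))
    (one_le_mul_of_one_le_of_one_le hC (Real.one_le_rpow hT1 (by linarith)))
    (fun σ h1 h2 ↦ (one_le_three_four_one hζ χ t h1 h2).trans (by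
      have : 0 ≤ A / (σ - 1) := div_nonneg (by linarith) (by linarith)
      exact mul_le_mul_of_nonneg_left (hsq σ h1 h2) (by positivity)))
    (fun σ σ' h1 h2 h3 ↦ ?_) hσ hσ2
  · refine le_trans (le_of_eq ?_) this
    have e1 : T ^ (-7 * ρ) = (T ^ (4 * ρ) * (T ^ ρ) ^ 3)⁻¹ := by
      rw [← Real.rpow_natCast, ← Real.rpow_mul hT0.le, ← Real.rpow_add hT0, ← Real.rpow_neg hT0.le]
      congr 1; push_cast; ring
    rw [e1]
    field_simp
  · have hconv : Convex ℝ {s : ℂ | (1 ≤ s.re ∧ s.re ≤ 3) ∧ s.im = t} := by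
      refine Convex.inter ((convex_halfSpace_re_ge 1).inter (convex_halfSpace_re_le 3)) ?_
      exact (convex_singleton t).is_linear_preimage Complex.imLm.isLinear
    have := norm_sub_le_of_deriv_strip (DirichletCharacter.differentiable_LFunction hχ)
      (U := K * T ^ ρ) hconv
      (fun s hs ↦ by
        have := hd q χ hχ s (by linarith [hs.1.1]) hs.1.2
        rwa [hs.2] at this)
      (z := σ + Complex.I * t) (w := σ' + Complex.I * t)
      (by simp; constructor <;> linarith) (by simp; constructor <;> linarith)
    refine this.trans_eq ?_
    have e : (σ' : ℂ) + Complex.I * t - (σ + Complex.I * t) = ((σ' - σ : ℝ) : ℂ) := by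
      push_cast; ring
    rw [e, Complex.norm_real, Real.norm_of_nonneg (by linarith)]

lemma sub_one_div_le_norm_LFunction {A : ℝ} (hA1 : 1 ≤ A)
    (hA : ∀ σ : ℝ, 1 < σ → σ ≤ 2 → ‖riemannZeta σ‖ ≤ A / (σ - 1))
    {q : ℕ} [NeZero q] (χ : DirichletCharacter ℂ q) {σ : ℝ} (t : ℝ) (hσ : 1 < σ) (hσ2 : σ ≤ 2) :
    (σ - 1) / A ≤ ‖χ.LFunction (σ + Complex.I * t)‖ := by
  have h1 := one_le_three_four_one hA χ t hσ hσ2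
  have h2 : ‖(χ ^ 2).LFunction (σ + 2 * Complex.I * t)‖ ≤ A / (σ - 1) := by
    refine (norm_LFunction_le_norm_zeta (χ ^ 2) (by simpa)).trans ?_
    simpa using hA σ hσ hσ2
  have h0 : 0 < A / (σ - 1) := div_pos (by linarith) (by linarith)
  have h3 : 1 ≤ (A / (σ - 1)) ^ 3 * ‖χ.LFunction (σ + Complex.I * t)‖ ^ 4 * (A / (σ - 1)) :=
    h1.trans (by gcongr)
  have h4 : 1 ≤ (A / (σ - 1) * ‖χ.LFunction (σ + Complex.I * t)‖) ^ 4 := by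
    refine h3.trans_eq (by ring)
  have h5 := (one_le_pow_iff_of_nonneg (by positivity) (by norm_num)).mp h4
  rw [← inv_div, inv_le_iff_one_le_mul₀' h0]
  exact h5

/-- Lower bound for the `L`-function of a quadratic character. -/
lemma exists_le_norm_LFunction_quadratic {ρ : ℝ} (hρ : 0 < ρ) (hρ1 : ρ ≤ 1) :
    ∃ c : ℝ, 0 < c ∧ ∀ (q : ℕ) [NeZero q] (χ : DirichletCharacter ℂ q), χ ≠ 1 → χ ^ 2 = 1 →
      ∀ t : ℝ, ∀ σ : ℝ, 1 < σ → σ ≤ 2 →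
      c * ((q : ℝ) * (|t| + 2)) ^ (-7 * ρ) ≤ ‖χ.LFunction (σ + Complex.I * t)‖ := by
  obtain ⟨A, hA, hζ⟩ := exists_norm_zeta_ofReal_le
  obtain ⟨K, hK, hd⟩ := norm_deriv_LFunction_le hρ hρ1
  obtain ⟨c₁, hc₁, hs⟩ := siegel hρ
  obtain ⟨C, hC, htriv⟩ := norm_trivial_LFunction_le hρ hρ1
  set κ := min 1 (c₁ / (12 * K)) with hκ
  have hκ0 : 0 < κ := by positivity
  have hκ1 : κ ≤ 1 := min_le_left _ _
  obtain ⟨c₂, hc₂, hlow⟩ := exists_le_norm_LFunction_of_sq_le hρ hρ1 (C := 4 * C / κ) (by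
    rw [le_div_iff₀ hκ0]; linarith)
  refine ⟨min c₂ (min (κ / A) (c₁ / 2)), by positivity, fun q _ χ hχ hχ2 t σ hσ hσ2 ↦ ?_⟩
  have hq : (1 : ℝ) ≤ q := by exact_mod_cast NeZero.one_le
  have hq0 : (0 : ℝ) < q := by linarith
  set T := (q : ℝ) * (|t| + 2) with hT
  have hqT : (q : ℝ) ≤ T := by rw [hT]; nlinarith [abs_nonneg t]
  have hT1 : 1 ≤ T := hq.trans hqT
  have hT0 : 0 < T := by linarith
  set τ := κ * (q : ℝ) ^ (-2 * ρ) with hτ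
  have hτ0 : 0 < τ := by positivity
  have hτ1 : τ ≤ 1 := mul_le_one₀ hκ1 (by positivity)
    (Real.rpow_le_one_of_one_le_of_nonpos hq (by linarith))
  have hmono : ∀ e : ℝ, 0 ≤ e → e ≤ 7 → T ^ (-7 * ρ) ≤ (q : ℝ) ^ (-e * ρ) := fun e he he' ↦ by
    calc T ^ (-7 * ρ) ≤ (q : ℝ) ^ (-7 * ρ) :=
          Real.rpow_le_rpow_of_nonpos hq0 hqT (by linarith)
      _ ≤ _ := Real.rpow_le_rpow_of_exponent_le hq (by nlinarith)
  rcases le_or_gt τ |t| with ht | ht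
  · refine le_trans ?_ (hlow q χ hχ t (fun σ h1 h2 ↦ ?_) σ hσ hσ2)
    · gcongr; exact min_le_left _ _
    · rw [hχ2]
      have h3 := htriv q (σ + 2 * Complex.I * t) (by simpa) (by simp; linarith)
      have h4 : |((σ : ℂ) + 2 * Complex.I * t).im| = 2 * |t| := by
        simp [abs_mul]
      have h5 : τ ≤ ‖(σ : ℂ) + 2 * Complex.I * t - 1‖ := by
        refine le_trans ?_ (Complex.abs_im_le_norm _)
        rw [Complex.sub_im, Complex.one_im, sub_zero, h4]; linarith
      rw [h4] at h3
      refine h3.trans ?_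
      have h6 : ((q : ℝ) * (2 * |t| + 2)) ^ ρ ≤ 2 * T ^ ρ := by
        calc _ ≤ (2 * T) ^ ρ := by
              refine Real.rpow_le_rpow (by positivity) ?_ hρ.le
              rw [hT]; nlinarith [abs_nonneg t]
          _ = 2 ^ ρ * T ^ ρ := by rw [Real.mul_rpow (by norm_num) hT0.le]
          _ ≤ 2 ^ (1 : ℝ) * T ^ ρ := by gcongr; norm_num
          _ = _ := by rw [Real.rpow_one]
      have h7 : 1 + 1 / ‖(σ : ℂ) + 2 * Complex.I * t - 1‖ ≤ 2 / κ * T ^ (2 * ρ) := by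
        have h8 : 1 / τ ≤ 1 / κ * T ^ (2 * ρ) := by
          have : 1 / τ = 1 / κ * (q : ℝ) ^ (2 * ρ) := by
            rw [hτ, neg_mul, Real.rpow_neg hq0.le]; field_simp
          rw [this]; gcongr
        have h9 : 1 / ‖(σ : ℂ) + 2 * Complex.I * t - 1‖ ≤ 1 / τ := by gcongr
        have h10 : 1 ≤ 1 / τ := by rw [le_div_iff₀ hτ0]; linarith
        have : 2 / κ * T ^ (2 * ρ) = 2 * (1 / κ * T ^ (2 * ρ)) := by ring
        linarith
      calc _ ≤ C * (2 * T ^ ρ) * (2 / κ * T ^ (2 * ρ)) := by gcongr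
        _ = 4 * C / κ * T ^ (3 * ρ) := by
            rw [show 3 * ρ = ρ + 2 * ρ by ring, Real.rpow_add hT0]; ring
        _ ≤ 4 * C / κ * T ^ (4 * ρ) := by gcongr; linarith
  · rcases le_or_gt τ (σ - 1) with hστ | hστ
    · refine le_trans ?_ (sub_one_div_le_norm_LFunction hA hζ χ t hσ hσ2)
      calc _ ≤ κ / A * (q : ℝ) ^ (-2 * ρ) := by
            gcongr
            · exact (min_le_right _ _).trans (min_le_left _ _)
            · exact hmono 2 (by norm_num) (by norm_num)
        _ = τ / A := by rw [hτ]; ring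
        _ ≤ _ := by gcongr
    · have hconv : Convex ℝ {s : ℂ | (1 ≤ s.re ∧ s.re ≤ 3) ∧ (-1 ≤ s.im ∧ s.im ≤ 1)} :=
        ((convex_halfSpace_re_ge 1).inter (convex_halfSpace_re_le 3)).inter
          ((convex_halfSpace_im_ge (-1)).inter (convex_halfSpace_im_le 1))
      have ht1 := abs_le.mp (ht.le.trans hτ1)
      have h1 := norm_sub_le_of_deriv_strip (DirichletCharacter.differentiable_LFunction hχ)
        (U := K * (3 * (q : ℝ) ^ ρ)) hconv
        (fun s hs ↦ by
          refine (hd q χ hχ s (by linarith [hs.1.1]) hs.1.2).trans ?_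
          have : |s.im| ≤ 1 := abs_le.mpr hs.2
          gcongr
          calc ((q : ℝ) * (|s.im| + 2)) ^ ρ ≤ (3 * (q : ℝ)) ^ ρ := by
                refine Real.rpow_le_rpow (by positivity) ?_ hρ.le
                nlinarith
            _ = 3 ^ ρ * (q : ℝ) ^ ρ := by rw [Real.mul_rpow (by norm_num) hq0.le]
            _ ≤ 3 ^ (1 : ℝ) * (q : ℝ) ^ ρ := by gcongr; norm_num
            _ = _ := by rw [Real.rpow_one])
        (z := 1) (w := σ + Complex.I * t)
        (by simp) (by simp [ht1]; constructor <;> linarith)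
      have h2 : ‖(σ : ℂ) + Complex.I * t - 1‖ ≤ 2 * τ := by
        have e : (σ : ℂ) + Complex.I * t - 1 = ((σ - 1 : ℝ) : ℂ) + Complex.I * t := by
          push_cast; ring
        rw [e]
        refine (norm_add_le _ _).trans ?_
        rw [Complex.norm_real, norm_mul, Complex.norm_I, one_mul, Complex.norm_real,
          Real.norm_of_nonneg (by linarith), Real.norm_eq_abs]
        linarith
      have h3 := hs q χ hχ2 hχ
      have h4 : K * (3 * (q : ℝ) ^ ρ) * (2 * τ) ≤ c₁ / 2 * (q : ℝ) ^ (-ρ) := by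
        have h5 : (q : ℝ) ^ ρ * (q : ℝ) ^ (-2 * ρ) = (q : ℝ) ^ (-ρ) := by
          rw [← Real.rpow_add hq0]; congr 1; ring
        have h6 : κ ≤ c₁ / (12 * K) := min_le_right _ _
        calc K * (3 * (q : ℝ) ^ ρ) * (2 * τ) =
              6 * K * κ * ((q : ℝ) ^ ρ * (q : ℝ) ^ (-2 * ρ)) := by rw [hτ]; ring
          _ = 6 * K * κ * (q : ℝ) ^ (-ρ) := by rw [h5]
          _ ≤ 6 * K * (c₁ / (12 * K)) * (q : ℝ) ^ (-ρ) := by gcongr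
          _ = _ := by field_simp; ring
      have h5 : K * (3 * (q : ℝ) ^ ρ) * ‖(σ : ℂ) + Complex.I * t - 1‖ ≤
          K * (3 * (q : ℝ) ^ ρ) * (2 * τ) := by gcongr
      have h6 : c₁ / 2 * (q : ℝ) ^ (-ρ) ≤ ‖χ.LFunction (σ + Complex.I * t)‖ := by
        have := norm_sub_norm_le (χ.LFunction 1) (χ.LFunction (σ + Complex.I * t))
        rw [norm_sub_rev] at this
        linarith
      refine le_trans ?_ h6
      gcongr
      · exact (min_le_right _ _).trans (min_le_right _ _)
      · simpa using hmono 1 (by norm_num) (by norm_num)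

theorem exists_le_norm_LFunction {δ : ℝ} (hδ : 0 < δ) (hδ1 : δ ≤ 1) :
    ∃ c : ℝ, 0 < c ∧ ∀ (q : ℕ) [NeZero q] (χ : DirichletCharacter ℂ q), χ ≠ 1 →
      ∀ s : ℂ, 1 < s.re → s.re ≤ 2 →
      c * ((q : ℝ) * (|s.im| + 2)) ^ (-δ) ≤ ‖χ.LFunction s‖ := by
  have hρ : 0 < δ / 7 := by positivity
  have hρ1 : δ / 7 ≤ 1 := by linarith
  obtain ⟨c₁, hc₁, h₁⟩ := exists_le_norm_LFunction_quadratic hρ hρ1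
  obtain ⟨C, hC, h⟩ := norm_dirichlet_LFunction_le hρ hρ1
  obtain ⟨c₂, hc₂, h₂⟩ := exists_le_norm_LFunction_of_sq_le hρ hρ1 (C := 2 * C) (by linarith)
  refine ⟨min c₁ c₂, by positivity, fun q _ χ hχ s hs hs2 ↦ ?_⟩
  have e : s = s.re + Complex.I * s.im := by rw [mul_comm]; exact (Complex.re_add_im s).symm
  have e2 : -δ = -7 * (δ / 7) := by ring
  have hq : (1 : ℝ) ≤ q := by exact_mod_cast NeZero.one_le
  rw [e2]
  by_cases hχ2 : χ ^ 2 = 1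
  · have := h₁ q χ hχ hχ2 s.im s.re hs hs2
    rw [← e] at this
    refine le_trans ?_ this
    gcongr
    exact min_le_left _ _
  · have := h₂ q χ hχ s.im (fun σ h1 h2 ↦ ?_) s.re hs hs2
    · rw [← e] at this
      refine le_trans ?_ this
      gcongr
      exact min_le_right _ _
    · refine (h q (χ ^ 2) hχ2 _ (by simp; linarith) (by simp; linarith)).trans ?_
      have h4 : |((σ : ℂ) + 2 * Complex.I * s.im).im| = 2 * |s.im| := by
        simp [abs_mul]
      rw [h4]
      set T := (q : ℝ) * (|s.im| + 2) with hT
      have hT1 : 1 ≤ T := one_le_mul_of_one_le_of_one_le hq (by linarith [abs_nonneg s.im])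
      have h6 : ((q : ℝ) * (2 * |s.im| + 2)) ^ (δ / 7) ≤ 2 * T ^ (4 * (δ / 7)) := by
        calc _ ≤ (2 * T) ^ (δ / 7) := by
              refine Real.rpow_le_rpow (by positivity) ?_ hρ.le
              rw [hT]; nlinarith [abs_nonneg s.im]
          _ = 2 ^ (δ / 7) * T ^ (δ / 7) := by rw [Real.mul_rpow (by norm_num) (by linarith)]
          _ ≤ 2 ^ (1 : ℝ) * T ^ (4 * (δ / 7)) := by gcongr <;> linarith
          _ = _ := by rw [Real.rpow_one]
      calc _ ≤ C * (2 * T ^ (4 * (δ / 7))) := by gcongr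
        _ = _ := by ring

open DirichletCharacter in
/-- The entire function `(s - 1) ζ(s)`. -/
noncomputable def zetaTimes (s : ℂ) : ℂ := LFunctionTrivChar₁ 1 s

lemma zetaTimes_eq {s : ℂ} (hs : s ≠ 1) : zetaTimes s = (s - 1) * riemannZeta s :=
  LFunctionTrivChar₁_one_eq hs

lemma differentiable_zetaTimes : Differentiable ℂ zetaTimes :=
  DirichletCharacter.differentiable_LFunctionTrivChar₁ 1

lemma zetaTimes_one_ne_zero : zetaTimes 1 ≠ 0 :=
  DirichletCharacter.LFunctionTrivChar₁_apply_one_ne_zero 1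

lemma zetaTimes_ne_zero {s : ℂ} (hs : 1 ≤ s.re) : zetaTimes s ≠ 0 := by
  by_cases h : s = 1
  · rw [h]; exact zetaTimes_one_ne_zero
  · rw [zetaTimes_eq h]
    exact mul_ne_zero (sub_ne_zero.mpr h) (riemannZeta_ne_zero_of_one_le_re hs)

lemma norm_zetaTimes_le {ρ : ℝ} (hρ : 0 < ρ) (hρ1 : ρ ≤ 1) : ∃ C : ℝ, 1 ≤ C ∧
    ∀ s : ℂ, 1 - ρ / 2 ≤ s.re → s.re ≤ 4 → ‖zetaTimes s‖ ≤ C * (|s.im| + 2) ^ (1 + ρ) := by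
  obtain ⟨C, hC, h⟩ := norm_zeta_le hρ hρ1
  refine ⟨2 * C, by linarith, fun s h1 h2 ↦ (h s h1 h2).trans ?_⟩
  have h3 : ‖s - 1‖ + 1 ≤ 2 * (|s.im| + 2) := by
    have := Complex.norm_le_abs_re_add_abs_im (s - 1)
    simp only [Complex.sub_re, Complex.sub_im, Complex.one_re, Complex.one_im, sub_zero] at this
    have h4 : |s.re - 1| ≤ 3 := abs_le.mpr ⟨by linarith, by linarith⟩
    linarith [abs_nonneg s.im]
  rw [Real.rpow_add (by positivity), Real.rpow_one]
  calc _ ≤ C * (2 * (|s.im| + 2) * (|s.im| + 2) ^ ρ) := by gcongr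
    _ = _ := by ring

lemma norm_deriv_zetaTimes_le {ρ : ℝ} (hρ : 0 < ρ) (hρ1 : ρ ≤ 1) : ∃ K : ℝ, 1 ≤ K ∧
    ∀ s : ℂ, 1 - ρ / 4 ≤ s.re → s.re ≤ 3 → ‖deriv zetaTimes s‖ ≤ K * (|s.im| + 2) ^ (1 + ρ) := by
  obtain ⟨C, hC, h⟩ := norm_zetaTimes_le hρ hρ1
  refine ⟨16 / ρ * C, ?_, fun s hs hs3 ↦ ?_⟩
  · have : 1 ≤ 16 / ρ := by rw [le_div_iff₀ hρ]; linarith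
    exact one_le_mul_of_one_le_of_one_le this hC
  · exact norm_deriv_le_of_strip differentiable_zetaTimes hρ hρ1 (by linarith) (by linarith) h hs hs3

theorem exists_le_norm_zetaTimes {δ : ℝ} (hδ : 0 < δ) (hδ1 : δ ≤ 1) :
    ∃ c : ℝ, 0 < c ∧ ∀ s : ℂ, 1 < s.re → s.re ≤ 2 →
      c * (|s.im| + 2) ^ (1 - δ) ≤ ‖zetaTimes s‖ := by
  set ρ := δ / 4 with hρδ
  have hρ : 0 < ρ := by positivity
  have hρ1 : ρ ≤ 1 := by linarith
  obtain ⟨A, hA, hζ⟩ := exists_norm_zeta_ofReal_le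
  obtain ⟨K, hK, hd⟩ := norm_deriv_zetaTimes_le hρ hρ1
  obtain ⟨C, hC, htriv⟩ := norm_trivial_LFunction_le hρ hρ1
  obtain ⟨m, hm, hcomp⟩ : ∃ m : ℝ, 0 < m ∧ ∀ s : ℂ, 1 ≤ s.re → s.re ≤ 2 → |s.im| ≤ 1 →
      m ≤ ‖zetaTimes s‖ := by
    have hS : IsCompact (Set.Icc (1 : ℝ) 2 ×ℂ Set.Icc (-1 : ℝ) 1) :=
      isCompact_Icc.reProdIm isCompact_Icc
    have hne : (Set.Icc (1 : ℝ) 2 ×ℂ Set.Icc (-1 : ℝ) 1).Nonempty :=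
      ⟨1, by simp [Complex.mem_reProdIm]⟩
    obtain ⟨z, hz, hmin⟩ := hS.exists_isMinOn hne
      (differentiable_zetaTimes.continuous.norm.continuousOn)
    rw [Complex.mem_reProdIm] at hz
    refine ⟨_, norm_pos_iff.mpr (zetaTimes_ne_zero hz.1.1), fun s h1 h2 h3 ↦ ?_⟩
    exact hmin (Complex.mem_reProdIm.mpr ⟨⟨h1, h2⟩, abs_le.mp h3⟩)
  set c₀ := 1 / (16 * A ^ 3 * (4 * C) * (3 * K) ^ 3) with hc₀
  have hc₀' : 0 < c₀ := by positivity
  refine ⟨min (m / 3) (c₀ / 3), by positivity, fun s hs hs2 ↦ ?_⟩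
  have hT0 : 0 < |s.im| + 2 := by positivity
  rcases le_or_gt |s.im| 1 with ht | ht
  · refine le_trans ?_ (hcomp s hs.le hs2 ht)
    calc _ ≤ m / 3 * (|s.im| + 2) ^ (1 : ℝ) := by
          gcongr
          · exact min_le_left _ _
          · linarith [abs_nonneg s.im]
          · linarith
      _ ≤ m / 3 * 3 := by rw [Real.rpow_one]; gcongr; linarith
      _ = m := by ring
  · obtain ⟨σ, t⟩ := s
    simp only at hs hs2 ht hT0 ⊢
    set T := |t| + 2 with hT
    have hT1 : 1 ≤ T := by linarith
    have ht0 : 0 < |t| := by linarith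
    have e : ∀ σ : ℝ, (⟨σ, t⟩ : ℂ) = σ + Complex.I * t := fun σ ↦ by
      apply Complex.ext <;> simp
    have key := le_norm_of_three_four_one (f := fun σ ↦ zetaTimes ⟨σ, t⟩ / t) (A := A)
      (U := (3 * K) * T ^ ρ) (V := (4 * C) * T ^ ρ) hA
      (one_le_mul_of_one_le_of_one_le (by linarith) (Real.one_le_rpow hT1 hρ.le))
      (one_le_mul_of_one_le_of_one_le (by linarith) (Real.one_le_rpow hT1 (by linarith)))
      (fun σ h1 h2 ↦ (one_le_three_four_one (q := 1) hζ 1 t h1 h2).trans ?_)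
      (fun σ σ' h1 h2 h3 ↦ ?_) hs hs2
    · have h1 : c₀ * T ^ (-δ) ≤ ‖zetaTimes ⟨σ, t⟩ / t‖ := by
        refine le_trans (le_of_eq ?_) key
        have e1 : T ^ (-δ) = (T ^ ρ * (T ^ ρ) ^ 3)⁻¹ := by
          rw [← Real.rpow_natCast, ← Real.rpow_mul hT0.le, ← Real.rpow_add hT0,
            ← Real.rpow_neg hT0.le]
          congr 1; rw [hρδ]; push_cast; ring
        rw [e1, hc₀]
        field_simp
      rw [norm_div, Complex.norm_real, Real.norm_eq_abs, le_div_iff₀ ht0] at h1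
      refine le_trans ?_ h1
      rw [sub_eq_add_neg, Real.rpow_add hT0, Real.rpow_one]
      calc _ ≤ c₀ / 3 * (3 * |t| * T ^ (-δ)) := by
            gcongr
            · exact min_le_right _ _
            · rw [hT]; linarith
        _ = _ := by ring
    · have h3 := htriv 1 (σ + 2 * Complex.I * t) (by simpa) (by simp; linarith)
      have h4 : |((σ : ℂ) + 2 * Complex.I * t).im| = 2 * |t| := by
        simp [abs_mul]
      have h5 : 1 ≤ ‖(σ : ℂ) + 2 * Complex.I * t - 1‖ := by
        refine le_trans ?_ (Complex.abs_im_le_norm _)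
        rw [Complex.sub_im, Complex.one_im, sub_zero, h4]; linarith
      rw [h4] at h3
      have h6 : (((1 : ℕ) : ℝ) * (2 * |t| + 2)) ^ ρ ≤ 2 * T ^ ρ := by
        calc _ ≤ (2 * T) ^ ρ := by
              refine Real.rpow_le_rpow (by positivity) ?_ hρ.le
              rw [hT]; push_cast; linarith
          _ = 2 ^ ρ * T ^ ρ := by rw [Real.mul_rpow (by norm_num) hT0.le]
          _ ≤ 2 ^ (1 : ℝ) * T ^ ρ := by gcongr; norm_num
          _ = _ := by rw [Real.rpow_one]
      have h7 : ‖((1 : DirichletCharacter ℂ 1) ^ 2).LFunction (σ + 2 * Complex.I * t)‖ ≤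
          4 * C * T ^ ρ := by
        rw [one_pow]
        calc _ ≤ _ := h3
          _ ≤ C * (2 * T ^ ρ) * 2 := by
            gcongr
            have : 1 / ‖(σ : ℂ) + 2 * Complex.I * t - 1‖ ≤ 1 := by
              rw [div_le_one (by linarith)]; exact h5
            linarith
          _ = _ := by ring
      have h8 : ‖(1 : DirichletCharacter ℂ 1).LFunction (σ + Complex.I * t)‖ ≤
          ‖zetaTimes ⟨σ, t⟩ / t‖ := by
        have hne : (σ : ℂ) + Complex.I * t ≠ 1 := fun h ↦ by
          have := congrArg Complex.re h
          simp at this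
          linarith
        rw [DirichletCharacter.LFunction_modOne_eq, e, zetaTimes_eq hne, norm_div, norm_mul,
          Complex.norm_real, Real.norm_eq_abs, le_div_iff₀ ht0, mul_comm]
        gcongr
        refine le_trans ?_ (Complex.abs_im_le_norm _)
        simp
      have h9 : 0 ≤ A / (σ - 1) := div_nonneg (by linarith) (by linarith)
      gcongr
    · have hconv : Convex ℝ {s : ℂ | (1 ≤ s.re ∧ s.re ≤ 3) ∧ s.im = t} := by
        refine Convex.inter ((convex_halfSpace_re_ge 1).inter (convex_halfSpace_re_le 3)) ?_
        exact (convex_singleton t).is_linear_preimage Complex.imLm.isLinear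
      have := norm_sub_le_of_deriv_strip differentiable_zetaTimes
        (U := K * T ^ (1 + ρ)) hconv
        (fun s hs ↦ by
          have := hd s (by linarith [hs.1.1]) hs.1.2
          rwa [hs.2] at this)
        (z := ⟨σ, t⟩) (w := ⟨σ', t⟩)
        (by simp; constructor <;> linarith) (by simp; constructor <;> linarith)
      have e2 : (⟨σ', t⟩ : ℂ) - ⟨σ, t⟩ = ((σ' - σ : ℝ) : ℂ) := by
        apply Complex.ext <;> simp
      rw [e2, Complex.norm_real, Real.norm_of_nonneg (by linarith)] at this
      rw [← sub_div, norm_div, Complex.norm_real, Real.norm_eq_abs, div_le_iff₀ ht0]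
      refine this.trans ?_
      rw [Real.rpow_add hT0, Real.rpow_one]
      have h9 : 0 ≤ K * T ^ ρ * (σ' - σ) := mul_nonneg (by positivity) (by linarith)
      calc _ = K * T ^ ρ * (σ' - σ) * T := by ring
        _ ≤ K * T ^ ρ * (σ' - σ) * (3 * |t|) := by
          gcongr; rw [hT]; linarith
        _ = _ := by ring

/-- Cauchy estimates for a logarithmic derivative, perturbed by an analytic function. -/
lemma norm_iteratedDeriv_logDeriv_add_le {f G : ℂ → ℂ} (hf : Differentiable ℂ f)
    (hG : Differentiable ℂ G) {s : ℂ} {R u X d : ℝ} (hR : 0 < R) (hR1 : R ≤ 1) (hu : 1 ≤ u)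
    (hX : 1 ≤ X) (hs : f s ≠ 0)
    (hU : ∀ z ∈ Metric.closedBall s R, ‖deriv f z‖ ≤ u * X * ‖f s‖)
    (hD : ∀ z ∈ Metric.closedBall s R, ‖G z‖ ≤ d * X) (k : ℕ) :
    ‖iteratedDeriv k (fun z ↦ deriv f z / f z + G z) s‖ ≤
      k.factorial * (2 * u + d) * (2 * u / R) ^ k * X ^ (k + 1) := by
  have hm : 0 < ‖f s‖ := norm_pos_iff.mpr hs
  set r := R / (2 * u * X) with hr
  have hr0 : 0 < r := by positivity
  have huX : 1 ≤ u * X := one_le_mul_of_one_le_of_one_le hu hX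
  have hrR : r ≤ R := by
    rw [hr, div_le_iff₀ (by positivity)]
    nlinarith
  have hlow : ∀ z ∈ Metric.closedBall s r, ‖f s‖ / 2 ≤ ‖f z‖ := fun z hz ↦ by
    have h1 := norm_sub_le_of_deriv_strip hf (convex_closedBall s R) hU
      (Metric.mem_closedBall_self hR.le) (Metric.closedBall_subset_closedBall hrR hz)
    have h2 : u * X * ‖f s‖ * ‖z - s‖ ≤ u * X * ‖f s‖ * r := by
      gcongr
      simpa [dist_eq_norm] using hz
    have h3 : u * X * ‖f s‖ * r = ‖f s‖ / 2 * R := by rw [hr]; field_simp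
    have h4 := norm_sub_norm_le (f s) (f z)
    rw [norm_sub_rev] at h4
    have h5 : ‖f s‖ / 2 * R ≤ ‖f s‖ / 2 := mul_le_of_le_one_right (by linarith) hR1
    linarith
  have hne : ∀ z ∈ Metric.closedBall s r, f z ≠ 0 := fun z hz h ↦ by
    have := hlow z hz
    rw [h, norm_zero] at this
    linarith
  have hd : DifferentiableOn ℂ (fun z ↦ deriv f z / f z + G z) (Metric.closedBall s r) :=
    fun z hz ↦ (((hf.deriv z).div (hf z) (hne z hz)).add (hG z)).differentiableWithinAt
  have := Complex.norm_iteratedDeriv_le_of_forall_mem_sphere_norm_le (C := (2 * u + d) * X) k hr0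
    (hd.diffContOnCl_ball subset_rfl) fun z hz ↦ ?_
  · have h1 : (2 * u / R) ^ k * X ^ k * r ^ k = 1 := by
      rw [← mul_pow, ← mul_pow, hr]
      rw [show 2 * u / R * X * (R / (2 * u * X)) = 1 by field_simp, one_pow]
    refine this.trans_eq ?_
    rw [div_eq_iff (by positivity)]
    linear_combination (-(k.factorial : ℝ) * (2 * u + d) * X) * h1
  have hz' := Metric.sphere_subset_closedBall hz
  have hzR := Metric.closedBall_subset_closedBall hrR hz'
  rw [add_mul]
  refine (norm_add_le _ _).trans (add_le_add ?_ (hD z hzR))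
  have h2 := hlow z hz'
  rw [norm_div, div_le_iff₀ (by linarith)]
  refine (hU z hzR).trans ?_
  calc u * X * ‖f s‖ = 2 * u * X * (‖f s‖ / 2) := by ring
    _ ≤ _ := by gcongr

lemma abs_im_add_two_le {z s : ℂ} {R : ℝ} (hR : R ≤ 1) (hz : z ∈ Metric.closedBall s R) :
    |z.im| + 2 ≤ 2 * (|s.im| + 2) := by
  have hz' : ‖z - s‖ ≤ R := by simpa [dist_eq_norm] using hz
  have h2 := (Complex.abs_im_le_norm (z - s)).trans hz'
  rw [Complex.sub_im] at h2
  have := abs_sub_abs_le_abs_sub z.im s.im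
  linarith [abs_nonneg s.im]

lemma re_mem_of_mem_closedBall {z s : ℂ} {R : ℝ} (hz : z ∈ Metric.closedBall s R) :
    s.re - R ≤ z.re ∧ z.re ≤ s.re + R := by
  have hz' : ‖z - s‖ ≤ R := by simpa [dist_eq_norm] using hz
  have h2 := abs_le.mp ((Complex.abs_re_le_norm (z - s)).trans hz')
  rw [Complex.sub_re] at h2
  constructor <;> linarith [h2.1, h2.2]

lemma norm_iterate_logMul_LSeries {f : ℕ → ℂ} {F : ℂ → ℂ}
    (hf : ∀ s : ℂ, 1 < s.re → LSeriesSummable f s) (hF : ∀ s : ℂ, 1 < s.re → LSeries f s = F s)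
    {s : ℂ} (hs : 1 < s.re) (k : ℕ) :
    ‖LSeries (LSeries.logMul^[k] f) s‖ = ‖iteratedDeriv k F s‖ := by
  have h1 : LSeries.abscissaOfAbsConv f < s.re := by
    refine (LSeries.abscissaOfAbsConv_le_of_forall_lt_LSeriesSummable (x := 1)
      fun y hy ↦ hf y (by simpa)).trans_lt ?_
    exact_mod_cast hs
  have h2 : LSeries f =ᶠ[𝓝 s] F := by
    filter_upwards [(isOpen_lt continuous_const Complex.continuous_re).mem_nhds hs] with z hz
    exact hF z hz
  have h3 := LSeries_iteratedDeriv k h1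
  rw [h2.iteratedDeriv_eq] at h3
  rw [h3]
  simp

theorem exists_norm_LSeries_logMul_twist_le (k : ℕ) : ∃ C : ℝ, 0 < C ∧
    ∀ (q : ℕ) [NeZero q] (χ : DirichletCharacter ℂ q), χ ≠ 1 → ∀ s : ℂ, 1 < s.re → s.re ≤ 2 →
      ‖LSeries (LSeries.logMul^[k] (fun n ↦ χ n * (ArithmeticFunction.vonMangoldt n : ℂ))) s‖ ≤
        C * ((q : ℝ) * (|s.im| + 2)) ^ (1 / 2 : ℝ) := by
  set ρ : ℝ := 1 / (4 * (k + 1)) with hρ'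
  have hρ : 0 < ρ := by positivity
  have hρ1 : ρ ≤ 1 := by
    rw [hρ', div_le_one (by positivity)]
    have : (0 : ℝ) ≤ k := by positivity
    linarith
  obtain ⟨K, hK, hd⟩ := norm_deriv_LFunction_le hρ hρ1
  obtain ⟨c, hc, hlow⟩ := exists_le_norm_LFunction hρ hρ1
  set u := max 1 (2 * K / c) with hu
  refine ⟨k.factorial * (2 * u + 0) * (2 * u / (ρ / 4)) ^ k, by positivity,
    fun q _ χ hχ s hs hs2 ↦ ?_⟩
  have hq : (1 : ℝ) ≤ q := by exact_mod_cast NeZero.one_le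
  set T := (q : ℝ) * (|s.im| + 2) with hT
  have hT1 : 1 ≤ T := one_le_mul_of_one_le_of_one_le hq (by linarith [abs_nonneg s.im])
  have hT0 : 0 < T := by linarith
  rw [norm_iterate_logMul_LSeries (F := fun s ↦ -deriv χ.LFunction s / χ.LFunction s)
    (f := fun n ↦ χ n * (ArithmeticFunction.vonMangoldt n : ℂ))
    (fun s hs ↦ DirichletCharacter.LSeriesSummable_twist_vonMangoldt χ hs) (fun s hs ↦ ?_) hs]
  · have h1 := norm_iteratedDeriv_logDeriv_add_le (f := χ.LFunction) (G := fun _ ↦ 0) (s := s)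
      (R := ρ / 4) (u := u) (X := T ^ (2 * ρ)) (d := 0)
      (DirichletCharacter.differentiable_LFunction hχ) (differentiable_const _)
      (by positivity) (by linarith) (le_max_left _ _) (Real.one_le_rpow hT1 (by positivity))
      (DirichletCharacter.LFunction_ne_zero_of_one_le_re χ (.inl hχ) hs.le)
      (fun z hz ↦ ?_) (by simp) k
    · have e1 : (fun s ↦ -deriv χ.LFunction s / χ.LFunction s) =
          -(fun z ↦ deriv χ.LFunction z / χ.LFunction z + 0) := by
        ext z; simp [neg_div]
      rw [e1, iteratedDeriv_neg, norm_neg]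
      refine h1.trans_eq ?_
      rw [← Real.rpow_natCast (T ^ (2 * ρ)), ← Real.rpow_mul hT0.le]
      congr 2
      rw [hρ']; push_cast; field_simp; norm_num
    · have h2 := re_mem_of_mem_closedBall hz
      have h3 := abs_im_add_two_le (by linarith) hz
      calc _ ≤ K * ((q : ℝ) * (|z.im| + 2)) ^ ρ := hd q χ hχ z (by linarith) (by linarith)
        _ ≤ K * (2 * T) ^ ρ := by
            refine mul_le_mul_of_nonneg_left (Real.rpow_le_rpow (by positivity) ?_ hρ.le)
              (by linarith)
            rw [hT]; nlinarith
        _ = K * (2 ^ ρ * T ^ ρ) := by rw [Real.mul_rpow (by norm_num) hT0.le]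
        _ ≤ K * (2 ^ (1 : ℝ) * T ^ ρ) := by gcongr; norm_num
        _ = 2 * K / c * T ^ (2 * ρ) * (c * T ^ (-ρ)) := by
            have : T ^ (2 * ρ) * T ^ (-ρ) = T ^ ρ := by
              rw [← Real.rpow_add hT0]; congr 1; ring
            rw [Real.rpow_one]
            calc _ = 2 * K * T ^ ρ := by ring
              _ = 2 * K * (T ^ (2 * ρ) * T ^ (-ρ)) := by rw [this]
              _ = _ := by field_simp
        _ ≤ u * T ^ (2 * ρ) * ‖χ.LFunction s‖ := by
            have := hlow q χ hχ s hs hs2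
            have := le_max_right 1 (2 * K / c)
            gcongr
  · rw [DirichletCharacter.deriv_LFunction_eq_deriv_LSeries χ hs,
      DirichletCharacter.LFunction_eq_LSeries χ hs,
      ← DirichletCharacter.LSeries_twist_vonMangoldt_eq χ hs]
    rfl

lemma zetaTimes_one : zetaTimes 1 = 1 := by
  simp [zetaTimes, DirichletCharacter.LFunctionTrivChar₁]

lemma differentiable_dslope_zetaTimes : Differentiable ℂ (dslope zetaTimes 1) :=
  differentiableOn_univ.mp ((Complex.differentiableOn_dslope univ_mem).mpr
    differentiable_zetaTimes.differentiableOn)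

lemma norm_dslope_zetaTimes_le {ρ : ℝ} (hρ : 0 < ρ) (hρ1 : ρ ≤ 1) : ∃ C : ℝ, 1 ≤ C ∧
    ∀ s : ℂ, 1 - ρ / 2 ≤ s.re → s.re ≤ 4 → ‖dslope zetaTimes 1 s‖ ≤ C * (|s.im| + 2) ^ ρ := by
  obtain ⟨C, hC, h⟩ := norm_zetaTimes_le hρ hρ1
  obtain ⟨M, hM⟩ := (isCompact_closedBall (1 : ℂ) 1).exists_bound_of_continuousOn
    (differentiable_dslope_zetaTimes.continuous.continuousOn)
  refine ⟨max M (6 * C), by rw [le_max_iff]; right; linarith, fun s h1 h2 ↦ ?_⟩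
  have hT1 : 1 ≤ |s.im| + 2 := by linarith [abs_nonneg s.im]
  have hT0 : 0 < |s.im| + 2 := by linarith
  have hTρ : 1 ≤ (|s.im| + 2) ^ ρ := Real.one_le_rpow hT1 hρ.le
  rcases le_or_gt ‖s - 1‖ 1 with hs | hs
  · have hM' := hM s (by simpa [dist_eq_norm] using hs)
    calc _ ≤ M := hM'
      _ ≤ max M (6 * C) := le_max_left _ _
      _ ≤ _ := le_mul_of_one_le_right (by positivity) hTρ
  · have hne : s ≠ 1 := fun h ↦ by simp [h] at hs; linarith
    have h3 : |s.im| + 2 ≤ 3 * ‖s - 1‖ := by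
      have := Complex.abs_im_le_norm (s - 1)
      simp only [Complex.sub_im, Complex.one_im, sub_zero] at this
      linarith
    rw [dslope_of_ne _ hne, slope_def_field, zetaTimes_one, norm_div,
      div_le_iff₀ (by linarith)]
    have h4 : (1 : ℝ) ≤ C * (|s.im| + 2) ^ (1 + ρ) :=
      one_le_mul_of_one_le_of_one_le hC (Real.one_le_rpow hT1 (by linarith))
    calc _ ≤ ‖zetaTimes s‖ + ‖(1 : ℂ)‖ := norm_sub_le _ _
      _ ≤ 2 * (C * (|s.im| + 2) ^ (1 + ρ)) := by rw [norm_one]; linarith [h s h1 h2]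
      _ = 2 * C * (|s.im| + 2) ^ ρ * (|s.im| + 2) := by
          rw [Real.rpow_add hT0, Real.rpow_one]; ring
      _ ≤ 2 * C * (|s.im| + 2) ^ ρ * (3 * ‖s - 1‖) := by gcongr
      _ = 6 * C * (|s.im| + 2) ^ ρ * ‖s - 1‖ := by ring
      _ ≤ _ := by gcongr; exact le_max_right _ _

theorem exists_norm_LSeries_logMul_vonMangoldt_sub_one_le (k : ℕ) : ∃ C : ℝ, 0 < C ∧
    ∀ s : ℂ, 1 < s.re → s.re ≤ 2 →
      ‖LSeries (LSeries.logMul^[k] (fun n ↦ (ArithmeticFunction.vonMangoldt n : ℂ) - 1)) s‖ ≤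
        C * (|s.im| + 2) ^ (1 / 2 : ℝ) := by
  set ρ : ℝ := 1 / (4 * (k + 1)) with hρ'
  have hρ : 0 < ρ := by positivity
  have hρ1 : ρ ≤ 1 := by
    rw [hρ', div_le_one (by positivity)]
    have : (0 : ℝ) ≤ k := by positivity
    linarith
  obtain ⟨K, hK, hd⟩ := norm_deriv_zetaTimes_le hρ hρ1
  obtain ⟨c, hc, hlow⟩ := exists_le_norm_zetaTimes hρ hρ1
  obtain ⟨D, hD, hds⟩ := norm_dslope_zetaTimes_le hρ hρ1
  set u := max 1 (4 * K / c) with hu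
  refine ⟨k.factorial * (2 * u + 2 * D) * (2 * u / (ρ / 4)) ^ k, by positivity,
    fun s hs hs2 ↦ ?_⟩
  set T := |s.im| + 2 with hT
  have hT1 : 1 ≤ T := by linarith [abs_nonneg s.im]
  have hT0 : 0 < T := by linarith
  have h2T : ∀ e : ℝ, 0 ≤ e → e ≤ 2 → ∀ z ∈ Metric.closedBall s (ρ / 4),
      (|z.im| + 2) ^ e ≤ 2 ^ e * T ^ e := fun e he he2 z hz ↦ by
    rw [← Real.mul_rpow (by norm_num) hT0.le]
    exact Real.rpow_le_rpow (by positivity) (abs_im_add_two_le (by linarith) hz) he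
  rw [norm_iterate_logMul_LSeries
    (F := fun z ↦ -(deriv zetaTimes z / zetaTimes z + dslope zetaTimes 1 z))
    (fun s hs ↦ ?_) (fun s hs ↦ ?_) hs]
  · have h1 := norm_iteratedDeriv_logDeriv_add_le (f := zetaTimes) (G := dslope zetaTimes 1)
      (s := s) (R := ρ / 4) (u := u) (X := T ^ (2 * ρ)) (d := 2 * D)
      differentiable_zetaTimes differentiable_dslope_zetaTimes
      (by positivity) (by linarith) (le_max_left _ _) (Real.one_le_rpow hT1 (by positivity))
      (zetaTimes_ne_zero hs.le) (fun z hz ↦ ?_) (fun z hz ↦ ?_) k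
    · have e1 : (fun z ↦ -(deriv zetaTimes z / zetaTimes z + dslope zetaTimes 1 z)) =
          -(fun z ↦ deriv zetaTimes z / zetaTimes z + dslope zetaTimes 1 z) := rfl
      rw [e1, iteratedDeriv_neg, norm_neg]
      refine h1.trans_eq ?_
      rw [← Real.rpow_natCast (T ^ (2 * ρ)), ← Real.rpow_mul hT0.le]
      congr 2
      rw [hρ']; push_cast; field_simp; norm_num
    · have h2 := re_mem_of_mem_closedBall hz
      calc _ ≤ K * (|z.im| + 2) ^ (1 + ρ) := hd z (by linarith) (by linarith)
        _ ≤ K * (2 ^ (1 + ρ) * T ^ (1 + ρ)) := by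
            gcongr
            exact h2T (1 + ρ) (by linarith) (by linarith) z hz
        _ ≤ K * (2 ^ (2 : ℝ) * T ^ (1 + ρ)) := by gcongr <;> linarith
        _ = 4 * K / c * T ^ (2 * ρ) * (c * T ^ (1 - ρ)) := by
            have : T ^ (2 * ρ) * T ^ (1 - ρ) = T ^ (1 + ρ) := by
              rw [← Real.rpow_add hT0]; congr 1; ring
            rw [← this]; field_simp; norm_num
        _ ≤ u * T ^ (2 * ρ) * ‖zetaTimes s‖ := by
            have := hlow s hs hs2
            have := le_max_right 1 (4 * K / c)
            gcongr
    · have h2 := re_mem_of_mem_closedBall hz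
      calc _ ≤ D * (|z.im| + 2) ^ ρ := hds z (by linarith) (by linarith)
        _ ≤ D * (2 ^ ρ * T ^ ρ) := by
            gcongr
            exact h2T ρ (by linarith) (by linarith) z hz
        _ ≤ D * (2 ^ (1 : ℝ) * T ^ (2 * ρ)) := by gcongr <;> linarith
        _ = _ := by rw [Real.rpow_one]; ring
  · exact (ArithmeticFunction.LSeriesSummable_vonMangoldt hs).sub
      (LSeriesSummable_one_iff.mpr hs)
  · have hne : s ≠ 1 := fun h ↦ by simp [h] at hs
    have e1 : LSeries (fun n ↦ (ArithmeticFunction.vonMangoldt n : ℂ) - 1) s =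
        - deriv riemannZeta s / riemannZeta s - riemannZeta s := by
      rw [← ArithmeticFunction.LSeries_vonMangoldt_eq_deriv_riemannZeta_div hs,
        ← LSeries_one_eq_riemannZeta hs,
        ← LSeries_sub (ArithmeticFunction.LSeriesSummable_vonMangoldt hs)
          (LSeriesSummable_one_iff.mpr hs)]
      rfl
    have hζ : riemannZeta s ≠ 0 := riemannZeta_ne_zero_of_one_le_re hs.le
    have hd : deriv zetaTimes s = riemannZeta s + (s - 1) * deriv riemannZeta s := by
      have h2 : zetaTimes =ᶠ[𝓝 s] fun z ↦ (z - 1) * riemannZeta z := by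
        filter_upwards [isOpen_ne.mem_nhds hne] with z hz
        exact zetaTimes_eq hz
      rw [h2.deriv_eq]
      have h3 := ((hasDerivAt_id s).sub_const 1).mul
        (differentiableAt_riemannZeta hne).hasDerivAt
      refine (h3.congr_deriv ?_).deriv
      simp
    have hs1 : s - 1 ≠ 0 := sub_ne_zero.mpr hne
    rw [e1, dslope_of_ne _ hne, slope_def_field, zetaTimes_one, hd, zetaTimes_eq hne]
    field_simp
    ring

/-- The kernel `1 / (s (s + 1))` on the vertical line of abscissa `c`. -/
noncomputable def perronKernel (c t : ℝ) : ℂ :=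
  1 / ((c : ℂ) + t * Complex.I) - 1 / ((c : ℂ) + t * Complex.I + 1)

lemma norm_perronKernel_le {c : ℝ} (hc : 1 ≤ c) (t : ℝ) : ‖perronKernel c t‖ ≤ (1 + t ^ 2)⁻¹ := by
  have h1 : (c : ℂ) + t * Complex.I ≠ 0 := fun h ↦ by
    have := congrArg Complex.re h
    simp at this
    linarith
  have h2 : (c : ℂ) + t * Complex.I + 1 ≠ 0 := fun h ↦ by
    have := congrArg Complex.re h
    simp at this
    linarith
  have e : perronKernel c t = (((c : ℂ) + t * Complex.I) * ((c : ℂ) + t * Complex.I + 1))⁻¹ := by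
    rw [perronKernel]; field_simp; ring
  have hn : ∀ z : ℂ, 1 ≤ z.re → z.im = t → √(1 + t ^ 2) ≤ ‖z‖ := fun z hz hz' ↦ by
    rw [Complex.norm_def, Complex.normSq_apply, hz']
    exact Real.sqrt_le_sqrt (by nlinarith)
  rw [e, norm_inv, norm_mul]
  have h3 : 1 + t ^ 2 = √(1 + t ^ 2) * √(1 + t ^ 2) := (Real.mul_self_sqrt (by positivity)).symm
  rw [h3]
  gcongr
  · exact hn _ (by simpa) (by simp)
  · exact hn _ (by simp; linarith) (by simp)

lemma continuous_perronKernel {c : ℝ} (hc : 1 ≤ c) : Continuous (perronKernel c) := by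
  unfold perronKernel
  refine Continuous.sub ?_ ?_
  · refine Continuous.div continuous_const (by fun_prop) fun t h ↦ ?_
    have := congrArg Complex.re h
    simp at this
    linarith
  · refine Continuous.div continuous_const (by fun_prop) fun t h ↦ ?_
    have := congrArg Complex.re h
    simp at this
    linarith

lemma integrable_perronKernel {c : ℝ} (hc : 1 ≤ c) : Integrable (perronKernel c) :=
  integrable_inv_one_add_sq.mono' (continuous_perronKernel hc).aestronglyMeasurable
    (ae_of_all _ (norm_perronKernel_le hc))

lemma integral_cpow_mul_perronKernel {c y : ℝ} (hc : 1 ≤ c) (hy : 0 < y) :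
    ∫ t : ℝ, (y : ℂ) ^ (-((c : ℂ) + t * Complex.I)) * perronKernel c t =
      2 * Real.pi * ((max (1 - y) 0 : ℝ) : ℂ) := by
  set f : ℝ → ℂ := fun t ↦ Set.indicator (Set.Ioc 0 1) (fun _ ↦ 1 : ℝ → ℂ) t -
    Set.indicator (Set.Ioc 0 1) (fun t ↦ (t : ℂ) ^ (1 : ℂ) : ℝ → ℂ) t with hf
  have hmel : ∀ s : ℂ, 0 < s.re → HasMellin f s (1 / s - 1 / (s + 1)) := fun s hs ↦ by
    have h1 := hasMellin_one_Ioc hs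
    have h2 := hasMellin_cpow_Ioc 1 (s := s) (by simp; linarith)
    have := hasMellin_sub h1.1 h2.1
    rwa [h1.2, h2.2] at this
  have hfy : ∀ z : ℝ, 0 < z → f z = ((max (1 - z) 0 : ℝ) : ℂ) := fun z hz ↦ by
    simp only [hf, Set.indicator, Set.mem_Ioc, hz, true_and, Complex.cpow_one]
    split_ifs with h
    · rw [max_eq_left (by linarith)]; push_cast; rfl
    · rw [max_eq_right (by linarith)]; simp
  have hline : ∀ t : ℝ, 0 < ((c : ℂ) + t * Complex.I).re := fun t ↦ by simp; linarith
  have hinv := mellinInv_mellin_eq c f hy (hmel c (by simp; linarith)).1 ?_ ?_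
  · rw [mellinInv, hfy y hy] at hinv
    have e : ∀ t : ℝ, mellin f ((c : ℂ) + t * Complex.I) = perronKernel c t := fun t ↦
      (hmel _ (hline t)).2
    simp only [e, smul_eq_mul] at hinv
    rw [← hinv, Complex.real_smul]
    push_cast
    rw [← mul_assoc, mul_one_div_cancel (by simp), one_mul]
  · have : (fun t : ℝ ↦ mellin f ((c : ℂ) + t * Complex.I)) = perronKernel c := by
      ext t; exact (hmel _ (hline t)).2
    rw [Complex.VerticalIntegrable, this]
    exact integrable_perronKernel hc
  · have : f =ᶠ[𝓝 y] fun z ↦ ((max (1 - z) 0 : ℝ) : ℂ) := by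
      filter_upwards [lt_mem_nhds hy] with z hz using hfy z hz
    refine ContinuousAt.congr ?_ this.symm
    fun_prop

lemma integrable_rpow_mul_inv_one_add_sq :
    Integrable fun t : ℝ ↦ (|t| + 2) ^ (1 / 2 : ℝ) * (1 + t ^ 2)⁻¹ := by
  have h := (integrable_rpow_neg_one_add_norm_sq (E := ℝ) (μ := volume) (r := 3 / 2)
    (by simp; norm_num)).const_mul 3
  refine h.mono' (Continuous.aestronglyMeasurable ?_) (ae_of_all _ fun t ↦ ?_)
  · exact (Continuous.rpow_const (by fun_prop) (fun x ↦ .inr (by norm_num))).mul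
      (Continuous.inv₀ (by fun_prop) fun x ↦ by positivity)
  · have h0 : 0 < 1 + t ^ 2 := by positivity
    have h1 : (|t| + 2) ^ (1 / 2 : ℝ) ≤ 3 * (1 + t ^ 2) ^ (1 / 4 : ℝ) := by
      have h2 : |t| + 2 ≤ 9 * (1 + t ^ 2) ^ (1 / 2 : ℝ) := by
        rw [← Real.sqrt_eq_rpow]
        have h3 : |t| ≤ √(1 + t ^ 2) := Real.abs_le_sqrt (by linarith)
        have h4 : 1 ≤ √(1 + t ^ 2) := Real.one_le_sqrt.mpr (by nlinarith)
        linarith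
      calc _ ≤ (9 * (1 + t ^ 2) ^ (1 / 2 : ℝ)) ^ (1 / 2 : ℝ) :=
            Real.rpow_le_rpow (by positivity) h2 (by norm_num)
        _ = 3 * (1 + t ^ 2) ^ (1 / 4 : ℝ) := by
            rw [Real.mul_rpow (by norm_num) (by positivity), ← Real.rpow_mul h0.le,
              show (9 : ℝ) = 3 ^ (2 : ℝ) by norm_num, ← Real.rpow_mul (by norm_num)]
            norm_num
    rw [Real.norm_of_nonneg (by positivity), Real.norm_eq_abs, sq_abs]
    calc _ ≤ 3 * (1 + t ^ 2) ^ (1 / 4 : ℝ) * (1 + t ^ 2)⁻¹ := by gcongr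
      _ = _ := by
        rw [← Real.rpow_neg_one, mul_assoc, ← Real.rpow_add h0]; norm_num

theorem exists_norm_sum_mul_sub_le : ∃ C : ℝ, 0 < C ∧ ∀ (a : ℕ → ℂ) (B : ℝ) (N : ℕ), 3 ≤ N →
    (∀ s : ℂ, 1 < s.re → LSeriesSummable a s) →
    (∀ s : ℂ, 1 < s.re → s.re ≤ 2 → ‖LSeries a s‖ ≤ B * (|s.im| + 2) ^ (1 / 2 : ℝ)) →
    ‖∑ n ∈ Icc 1 N, a n * ((N : ℂ) - n)‖ ≤ C * B * (N : ℝ) ^ 2 := by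
  set J := ∫ t : ℝ, (|t| + 2) ^ (1 / 2 : ℝ) * (1 + t ^ 2)⁻¹ with hJ
  have hJ0 : 0 ≤ J := integral_nonneg fun t ↦ by positivity
  refine ⟨Real.exp 1 * J + 1, by positivity, fun a B N hN hsum hB ↦ ?_⟩
  have hN3 : (3 : ℝ) ≤ N := by exact_mod_cast hN
  have hN0 : (0 : ℝ) < N := by linarith
  have hNC : (N : ℂ) ≠ 0 := by exact_mod_cast hN0.ne'
  have hlog : 1 ≤ Real.log N := by
    rw [Real.le_log_iff_exp_le hN0]
    linarith [Real.exp_one_lt_d9]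
  set c := 1 + 1 / Real.log N with hc
  have hc1 : 1 < c := by
    have : 0 < 1 / Real.log N := by positivity
    linarith
  have hc2 : c ≤ 2 := by
    have : 1 / Real.log N ≤ 1 := by rw [div_le_one (by linarith)]; exact hlog
    linarith
  have hNc : (N : ℝ) ^ c = Real.exp 1 * N := by
    rw [hc, Real.rpow_add hN0, Real.rpow_one, Real.rpow_def_of_pos hN0]
    rw [mul_one_div_cancel (by linarith)]; ring
  set s : ℝ → ℂ := fun t ↦ (c : ℂ) + t * Complex.I with hs
  have hsre : ∀ t, (s t).re = c := fun t ↦ by simp [hs]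
  have hsim : ∀ t, (s t).im = t := fun t ↦ by simp [hs]
  have hB0 : 0 ≤ B := by
    have := (norm_nonneg _).trans (hB (s 0) (by rw [hsre]; exact hc1) (by rw [hsre]; exact hc2))
    exact nonneg_of_mul_nonneg_left this (by positivity)
  set F : ℕ → ℝ → ℂ := fun n t ↦ LSeries.term a (s t) n * (N : ℂ) ^ (s t) * perronKernel c t with hF
  have hF0 : ∀ t, F 0 t = 0 := fun t ↦ by simp [hF]
  have hFn : ∀ n t, n ≠ 0 → F n t =
      a n * ((((n : ℝ) / N : ℝ) : ℂ) ^ (-(s t)) * perronKernel c t) := fun n t hn ↦ by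
    have hn0 : (n : ℂ) ≠ 0 := by exact_mod_cast hn
    have e : (((n : ℝ) / N : ℝ) : ℂ) ^ (-(s t)) = (N : ℂ) ^ (s t) / (n : ℂ) ^ (s t) := by
      have e1 : (n : ℂ) ^ (s t) = (((n : ℝ) / N : ℝ) : ℂ) ^ (s t) * (N : ℂ) ^ (s t) := by
        have h := Complex.mul_cpow_ofReal_nonneg (a := (n : ℝ) / N) (b := N) (by positivity)
          (by positivity) (s t)
        rw [← Complex.ofReal_mul, div_mul_cancel₀ _ hN0.ne', Complex.ofReal_natCast,
          Complex.ofReal_natCast] at h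
        exact h
      have h1 : (N : ℂ) ^ (s t) ≠ 0 := by simp [Complex.cpow_eq_zero_iff, hNC]
      have h2 : (((n : ℝ) / N : ℝ) : ℂ) ^ (s t) ≠ 0 := by
        have : (((n : ℝ) / N : ℝ) : ℂ) ≠ 0 := by
          have : (n : ℝ) / N ≠ 0 := by positivity
          exact_mod_cast this
        simp only [ne_eq, Complex.cpow_eq_zero_iff, this, false_and, not_false_eq_true]
      rw [e1, Complex.cpow_neg]
      field_simp
    simp only [hF]
    rw [LSeries.term_of_ne_zero hn, e]
    ring
  have hFnorm : ∀ n t, ‖F n t‖ = ‖LSeries.term a c n‖ * (N : ℝ) ^ c * ‖perronKernel c t‖ :=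
    fun n t ↦ by
    simp only [hF]
    rw [norm_mul, norm_mul, LSeries.norm_term_eq, LSeries.norm_term_eq, hsre,
      Complex.norm_natCast_cpow_of_pos (by lia), hsre, Complex.ofReal_re]
  have hscont : Continuous s := by fun_prop
  have hFint : ∀ n, Integrable (F n) := fun n ↦ by
    rcases eq_or_ne n 0 with rfl | hn
    · rw [show F 0 = fun _ ↦ 0 from funext hF0]
      exact integrable_zero _ _ _
    · refine ((integrable_perronKernel hc1.le).norm.const_mul
        (‖LSeries.term a c n‖ * (N : ℝ) ^ c)).mono' (Continuous.aestronglyMeasurable ?_)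
        (ae_of_all _ fun t ↦ (hFnorm n t).le)
      rw [show F n = fun t ↦ a n * ((((n : ℝ) / N : ℝ) : ℂ) ^ (-(s t)) * perronKernel c t) from
        funext fun t ↦ hFn n t hn]
      refine continuous_const.mul (Continuous.mul ?_ (continuous_perronKernel hc1.le))
      refine Continuous.const_cpow (by fun_prop) (.inl ?_)
      have : (n : ℝ) / N ≠ 0 := by positivity
      exact_mod_cast this
  have key := hasSum_integral_of_summable_integral_norm hFint (by
    simp only [hFnorm, integral_const_mul]
    exact ((hsum c (by simpa)).norm.mul_right _).mul_right _)
  have hval : ∀ n, ∫ t, F n t =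
      if n ∈ Icc 1 N then 2 * Real.pi / N * (a n * ((N : ℂ) - n)) else 0 := fun n ↦ by
    rcases eq_or_ne n 0 with rfl | hn
    · simp [hF0]
    · simp only [hFn n _ hn]
      rw [integral_const_mul, integral_cpow_mul_perronKernel hc1.le (by positivity)]
      split_ifs with h
      · have h1 : (n : ℝ) / N ≤ 1 := by
          rw [div_le_one hN0]; exact_mod_cast (mem_Icc.mp h).2
        rw [max_eq_left (by linarith)]
        push_cast
        field_simp
      · have h1 : 1 ≤ (n : ℝ) / N := by
          rw [one_le_div hN0]
          have : N ≤ n := by rw [mem_Icc] at h; lia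
          exact_mod_cast this
        rw [max_eq_right (by linarith)]
        simp
  have key2 : ∑ n ∈ Icc 1 N, 2 * Real.pi / N * (a n * ((N : ℂ) - n)) =
      ∫ t, LSeries a (s t) * (N : ℂ) ^ (s t) * perronKernel c t := by
    have e : (fun t ↦ ∑' n, F n t) =
        fun t ↦ LSeries a (s t) * (N : ℂ) ^ (s t) * perronKernel c t := by
      ext t
      simp only [hF, tsum_mul_right, LSeries]
    rw [← e]
    refine HasSum.unique ?_ key
    simp only [hval]
    rw [← Finset.sum_congr rfl fun n hn ↦ if_pos hn]
    exact hasSum_sum_of_ne_finset_zero fun n hn ↦ if_neg hn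
  have hbound : ‖∫ t, LSeries a (s t) * (N : ℂ) ^ (s t) * perronKernel c t‖ ≤
      B * (Real.exp 1 * N) * J := by
    rw [hJ, ← integral_const_mul]
    refine norm_integral_le_of_norm_le (integrable_rpow_mul_inv_one_add_sq.const_mul _)
      (ae_of_all _ fun t ↦ ?_)
    rw [norm_mul, norm_mul, Complex.norm_natCast_cpow_of_pos (by lia), hsre, hNc]
    have h1 := hB (s t) (by rw [hsre]; exact hc1) (by rw [hsre]; exact hc2)
    rw [hsim] at h1
    calc _ ≤ (B * (|t| + 2) ^ (1 / 2 : ℝ)) * (Real.exp 1 * N) * (1 + t ^ 2)⁻¹ := by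
          gcongr
          exact norm_perronKernel_le hc1.le t
      _ = _ := by ring
  rw [← key2, ← Finset.mul_sum, norm_mul] at hbound
  have h2 : ‖(2 * Real.pi / N : ℂ)‖ = 2 * Real.pi / N := by
    rw [norm_div, norm_mul]
    simp [abs_of_pos Real.pi_pos]
  rw [h2] at hbound
  have hpi := Real.pi_gt_three
  have h3 : (1 : ℝ) / N * ‖∑ n ∈ Icc 1 N, a n * ((N : ℂ) - n)‖ ≤ B * (Real.exp 1 * N) * J := by
    refine le_trans ?_ hbound
    gcongr
    linarith
  rw [one_div, inv_mul_le_iff₀ hN0] at h3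
  refine h3.trans ?_
  have : 0 ≤ B * (N : ℝ) ^ 2 := by positivity
  nlinarith

/-- Partial summation in norm. -/
lemma norm_sum_mul_le_of_forall_norm_sum_le {f w : ℕ → ℂ} {m N : ℕ} {D : ℝ} (hmN : m < N)
    (hD : ∀ y, m < y → y ≤ N → ‖∑ n ∈ Ioc m y, f n‖ ≤ D) :
    ‖∑ n ∈ Ioc m N, f n * w n‖ ≤
      D * (‖w N‖ + ∑ n ∈ Ico (m + 1) N, ‖w n - w (n + 1)‖) := by
  have key : ∀ M, m + 1 ≤ M → M ≤ N →
      ‖∑ n ∈ Ioc m M, f n * w n - (∑ n ∈ Ioc m M, f n) * w M‖ ≤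
        D * ∑ n ∈ Ico (m + 1) M, ‖w n - w (n + 1)‖ := by
    intro M hM
    induction M, hM using Nat.le_induction with
    | base => intro _; simp
    | succ M hM ih =>
      intro hMN
      have hD0 := (norm_nonneg _).trans (hD M (by lia) (by lia))
      rw [← Finset.insert_Ioc_right_eq_Ioc_add_one (by lia : m ≤ M), sum_insert (by simp),
        sum_insert (by simp), sum_Ico_succ_top hM]
      calc _ = ‖(∑ n ∈ Ioc m M, f n * w n - (∑ n ∈ Ioc m M, f n) * w M) +
            (∑ n ∈ Ioc m M, f n) * (w M - w (M + 1))‖ := by congr 1; ring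
        _ ≤ _ := by
          refine (norm_add_le _ _).trans ?_
          rw [norm_mul, mul_add]
          gcongr
          · exact ih (by lia)
          · exact hD M (by lia) (by lia)
  have h1 := key N hmN le_rfl
  have h2 := hD N hmN le_rfl
  calc _ = ‖(∑ n ∈ Ioc m N, f n * w n - (∑ n ∈ Ioc m N, f n) * w N) +
        (∑ n ∈ Ioc m N, f n) * w N‖ := by congr 1; ring
    _ ≤ D * ∑ n ∈ Ico (m + 1) N, ‖w n - w (n + 1)‖ + D * ‖w N‖ := by
      refine (norm_add_le _ _).trans ?_
      rw [norm_mul]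
      gcongr
    _ = _ := by ring

lemma norm_sum_mul_ofReal_le_of_antitone {f : ℕ → ℂ} {w : ℕ → ℝ} {m N : ℕ} {D : ℝ} (hmN : m < N)
    (hw : ∀ n, m < n → w (n + 1) ≤ w n) (hw0 : 0 ≤ w N)
    (hD : ∀ y, m < y → y ≤ N → ‖∑ n ∈ Ioc m y, f n‖ ≤ D) :
    ‖∑ n ∈ Ioc m N, f n * (w n : ℂ)‖ ≤ D * w (m + 1) := by
  refine (norm_sum_mul_le_of_forall_norm_sum_le hmN hD).trans (le_of_eq ?_)
  have h : ∀ M, m + 1 ≤ M →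
      ∑ n ∈ Ico (m + 1) M, ‖(w n : ℂ) - w (n + 1 : ℕ)‖ = w (m + 1) - w M := by
    intro M hM
    induction M, hM using Nat.le_induction with
    | base => simp
    | succ M hM ih =>
      rw [sum_Ico_succ_top hM, ih, ← Complex.ofReal_sub, Complex.norm_real,
        Real.norm_of_nonneg (by linarith [hw M (by lia)])]
      ring
  rw [h N hmN, Complex.norm_real, Real.norm_of_nonneg hw0]
  ring

/-- Recovering a bound for unweighted sums from one for sums with linear weights. -/
lemma norm_sum_le_of_norm_sum_mul_sub_le {a : ℕ → ℂ} {y h : ℕ} {D M : ℝ} (hh : 0 < h)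
    (h1 : ‖∑ n ∈ Icc 1 y, a n * ((y : ℂ) - n)‖ ≤ D)
    (h2 : ‖∑ n ∈ Icc 1 (y + h), a n * (((y + h : ℕ) : ℂ) - n)‖ ≤ D)
    (hM : ∀ n, 0 < n → n ≤ y + h → ‖a n‖ ≤ M) :
    ‖∑ n ∈ Icc 1 y, a n‖ ≤ 2 * D / h + M * h := by
  have hh' : (0 : ℝ) < h := by exact_mod_cast hh
  have hM0 : 0 ≤ M := (norm_nonneg _).trans (hM (y + h) (by lia) le_rfl)
  have e : ∑ n ∈ Icc 1 (y + h), a n * (((y + h : ℕ) : ℂ) - n) =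
      ∑ n ∈ Icc 1 y, a n * ((y : ℂ) - n) + h * ∑ n ∈ Icc 1 y, a n +
        ∑ n ∈ Ioc y (y + h), a n * (((y + h : ℕ) : ℂ) - n) := by
    rw [mul_sum, ← sum_add_distrib]
    have : Icc 1 (y + h) = Icc 1 y ∪ Ioc y (y + h) := by ext n; simp; lia
    rw [this, sum_union (by rw [disjoint_left]; intro n; simp; lia)]
    congr 1
    refine sum_congr rfl fun n _ ↦ ?_
    push_cast; ring
  have h3 : ‖∑ n ∈ Ioc y (y + h), a n * (((y + h : ℕ) : ℂ) - n)‖ ≤ h * (M * h) := by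
    refine (norm_sum_le _ _).trans ((sum_le_card_nsmul _ _ (M * h) fun n hn ↦ ?_).trans ?_)
    swap
    · simp
    rw [mem_Ioc] at hn
    rw [norm_mul]
    gcongr
    · exact hM n (by lia) hn.2
    · rw [← Nat.cast_sub hn.2, Complex.norm_natCast]
      exact_mod_cast (by lia)
  have h4 : (h : ℝ) * ‖∑ n ∈ Icc 1 y, a n‖ ≤ 2 * D + h * (M * h) := by
    calc (h : ℝ) * ‖∑ n ∈ Icc 1 y, a n‖ = ‖(h : ℂ) * ∑ n ∈ Icc 1 y, a n‖ := by
          rw [norm_mul, Complex.norm_natCast]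
      _ = ‖∑ n ∈ Icc 1 (y + h), a n * (((y + h : ℕ) : ℂ) - n) -
          ∑ n ∈ Icc 1 y, a n * ((y : ℂ) - n) -
          ∑ n ∈ Ioc y (y + h), a n * (((y + h : ℕ) : ℂ) - n)‖ := by rw [e]; congr 1; ring
      _ ≤ D + D + h * (M * h) :=
        (norm_sub_le _ _).trans (add_le_add ((norm_sub_le _ _).trans (add_le_add h2 h1)) h3)
      _ = _ := by ring
  rw [div_add' _ _ _ hh'.ne', le_div_iff₀ hh']
  linarith

lemma log_pow_le (m : ℕ) {x : ℝ} (hx : 1 ≤ x) : Real.log x ^ m ≤ (m : ℝ) ^ m * x := by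
  rcases Nat.eq_zero_or_pos m with rfl | hm
  · simpa
  have hm' : (0 : ℝ) < m := by exact_mod_cast hm
  have h := Real.log_le_rpow_div (zero_le_one.trans hx) (ε := 1 / m) (by positivity)
  calc Real.log x ^ m ≤ (x ^ (1 / m : ℝ) / (1 / m)) ^ m := by
        have := Real.log_nonneg hx
        gcongr
    _ = _ := by
      rw [div_pow, ← Real.rpow_natCast (x ^ (1 / m : ℝ)), ← Real.rpow_mul (by linarith),
        one_div_mul_cancel hm'.ne', Real.rpow_one, one_div, inv_pow]
      field_simp

lemma iterate_logMul_apply (k : ℕ) (b : ℕ → ℂ) (n : ℕ) :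
    LSeries.logMul^[k] b n = (Real.log n : ℂ) ^ k * b n := by
  induction k generalizing b with
  | zero => simp
  | succ k ih =>
    rw [Function.iterate_succ_apply, ih, LSeries.logMul, pow_succ, mul_assoc,
      ← Complex.natCast_log]

lemma lseriesSummable_iterate_logMul {b : ℕ → ℂ} (hb : ∀ n, ‖b n‖ ≤ Real.log n + 1) (k : ℕ)
    {s : ℂ} (hs : 1 < s.re) : LSeriesSummable (LSeries.logMul^[k] b) s := by
  have h : LSeries.abscissaOfAbsConv b ≤ 1 := by
    refine EReal.le_of_forall_lt_iff_le.mp fun z hz ↦ ?_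
    have hz1 : 1 < z := by exact_mod_cast hz
    have := LSeries.abscissaOfAbsConv_le_of_le_const_mul_rpow (f := b) (x := z - 1)
      ⟨1 / (z - 1) + 1, fun n hn ↦ ?_⟩
    · refine this.trans (le_of_eq ?_)
      norm_cast
      ring
    · have hn1 : (1 : ℝ) ≤ n := by exact_mod_cast Nat.one_le_iff_ne_zero.mpr hn
      have h1 := Real.log_le_rpow_div (x := n) (by positivity) (sub_pos.mpr hz1)
      have h2 := Real.one_le_rpow hn1 (sub_pos.mpr hz1).le
      calc _ ≤ _ := hb n
        _ ≤ (n : ℝ) ^ (z - 1) / (z - 1) + (n : ℝ) ^ (z - 1) := by gcongr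
        _ = _ := by ring
  refine LSeriesSummable_of_abscissaOfAbsConv_lt_re ?_
  rw [LSeries.absicssaOfAbsConv_logPowMul]
  exact h.trans_lt (by exact_mod_cast hs)

/-- Bounds for the `L`-series of `log ^ k * b` near the line `re s = 1` give savings of powers of
`log N` for the partial sums of `b`. -/
theorem exists_norm_sum_le_of_LSeries_logMul (J : ℕ) : ∃ C : ℝ, 0 < C ∧ ∀ (b : ℕ → ℂ) (B : ℝ),
    (∀ n, ‖b n‖ ≤ Real.log n + 1) → 0 ≤ B →
    (∀ s : ℂ, 1 < s.re → s.re ≤ 2 →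
      ‖LSeries (LSeries.logMul^[2 * J + 1] b) s‖ ≤ B * (|s.im| + 2) ^ (1 / 2 : ℝ)) →
    ∀ N : ℕ, 2 ≤ N → ‖∑ n ∈ Icc 1 N, b n‖ ≤ C * (B + 1) * (N / Real.log N ^ J) := by
  obtain ⟨C₀, hC₀, hper⟩ := exists_norm_sum_mul_sub_le
  set k := 2 * J + 1 with hk
  set j := J + 1 with hj
  set C₁ : ℝ := 8 * C₀ + 3 ^ (k + 1) * (1 + (j : ℝ) ^ j) with hC₁
  set C₂ : ℝ := 2 ^ (j + 1) * (j : ℝ) ^ j with hC₂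
  have hC₁0 : 0 ≤ C₁ := by positivity
  have hC₂0 : 0 ≤ C₂ := by positivity
  refine ⟨17 * 16 ^ J + 2 ^ (k + 1) * C₁ + C₂, by positivity, fun b B hb hB hL N hN ↦ ?_⟩
  have hN0 : (0 : ℝ) < N := by exact_mod_cast (by lia : 0 < N)
  have hN1 : (1 : ℝ) < N := by exact_mod_cast (by lia : 1 < N)
  set L := Real.log N with hLdef
  have hL0 : 0 < L := Real.log_pos hN1
  have htriv : ∀ m, m ≤ N → ‖∑ n ∈ Icc 1 m, b n‖ ≤ m * (L + 1) := fun m hm ↦ by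
    refine (norm_sum_le _ _).trans ((sum_le_card_nsmul _ _ (L + 1) fun n hn ↦ ?_).trans ?_)
    swap
    · simp [mul_add]
    rw [mem_Icc] at hn
    have := Real.log_le_log (by exact_mod_cast hn.1) (by exact_mod_cast hn.2.trans hm :
      (n : ℝ) ≤ N)
    linarith [hb n]
  have hsplit : 17 * 16 ^ J * (N / L ^ J) + (2 ^ (k + 1) * C₁ + C₂) * (B + 1) * (N / L ^ J) ≤
      (17 * 16 ^ J + 2 ^ (k + 1) * C₁ + C₂) * (B + 1) * (N / L ^ J) := by
    have h1 : 0 ≤ 17 * 16 ^ J * (N / L ^ J) * B := by positivity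
    linarith
  refine le_trans ?_ hsplit
  rcases lt_or_ge N 16 with h16 | h16
  · have h1 : (N : ℝ) ≤ 16 := by exact_mod_cast h16.le
    have h2 : L ≤ 16 := (Real.log_le_sub_one_of_pos hN0).trans (by linarith)
    have h3 : 0 ≤ (2 ^ (k + 1) * C₁ + C₂) * (B + 1) * (N / L ^ J) := by positivity
    refine (htriv N le_rfl).trans ?_
    have h4 : N * (L + 1) ≤ 17 * 16 ^ J * (N / L ^ J) := by
      rw [← mul_div_assoc, le_div_iff₀ (by positivity)]
      calc N * (L + 1) * L ^ J ≤ N * (16 + 1) * 16 ^ J := by gcongr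
        _ = _ := by ring
    linarith
  have hN16 : (16 : ℝ) ≤ N := by exact_mod_cast h16
  have hL1 : 1 ≤ L := by
    rw [hLdef, Real.le_log_iff_exp_le hN0]
    linarith [Real.exp_one_lt_d9]
  set m := Nat.sqrt N with hm
  have hm4 : 4 ≤ m := by rw [hm, Nat.le_sqrt]; lia
  have hmm : m * m ≤ N := Nat.sqrt_le N
  have hmN : m < N := by nlinarith
  have hm' : N < (m + 1) * (m + 1) := Nat.lt_succ_sqrt N
  have hlogm : L / 2 ≤ Real.log (m + 1 : ℕ) := by
    have h1 : (N : ℝ) ≤ ((m + 1 : ℕ) : ℝ) * ((m + 1 : ℕ) : ℝ) := by exact_mod_cast hm'.le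
    have h2 := Real.log_le_log hN0 h1
    rw [Real.log_mul (by positivity) (by positivity)] at h2
    linarith
  have hLj : 1 ≤ L ^ j := one_le_pow₀ hL1
  have hlogj : L ^ j ≤ (j : ℝ) ^ j * N := log_pow_le j hN1.le
  set h := ⌈N / L ^ j⌉₊ with hh
  have hh0 : 0 < h := Nat.ceil_pos.mpr (by positivity)
  have hh1 : N / L ^ j ≤ h := Nat.le_ceil _
  have hh2 : (h : ℝ) ≤ N / L ^ j + 1 := (Nat.ceil_lt_add_one (by positivity)).le
  have hhN : h ≤ N := Nat.ceil_le.mpr (div_le_self hN0.le hLj)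
  set a := LSeries.logMul^[k] b with ha
  have han : ∀ n, a n = (Real.log n : ℂ) ^ k * b n := iterate_logMul_apply k b
  have haM : ∀ n, 0 < n → n ≤ 2 * N → ‖a n‖ ≤ (3 * L) ^ (k + 1) := fun n hn hn' ↦ by
    have hn1 : (1 : ℝ) ≤ n := by exact_mod_cast hn
    have h1 : Real.log n ≤ 2 * L := by
      have : Real.log n ≤ Real.log (2 * N) := by
        gcongr
        exact_mod_cast hn'
      rw [Real.log_mul (by norm_num) hN0.ne'] at this
      linarith [Real.log_two_lt_d9]
    have h0 := Real.log_nonneg hn1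
    rw [han, norm_mul, norm_pow, Complex.norm_real, Real.norm_of_nonneg h0,
      pow_succ (3 * L) k]
    exact mul_le_mul (pow_le_pow_left₀ h0 (by linarith) _) ((hb n).trans (by linarith))
      (norm_nonneg _) (by positivity)
  have hA : ∀ y, m ≤ y → y ≤ N → ‖∑ n ∈ Icc 1 y, a n‖ ≤ C₁ * (B + 1) * (N * L ^ j) := by
    intro y hy hyN
    have hS : ∀ z, 3 ≤ z → z ≤ 2 * N → ‖∑ n ∈ Icc 1 z, a n * ((z : ℂ) - n)‖ ≤
        C₀ * B * (2 * N) ^ 2 := fun z hz hz' ↦ by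
      refine (hper a B z hz (fun s hs ↦ lseriesSummable_iterate_logMul hb k hs) hL).trans ?_
      gcongr
      exact_mod_cast hz'
    refine (norm_sum_le_of_norm_sum_mul_sub_le hh0 (hS y (by lia) (by lia))
      (hS (y + h) (by lia) (by lia)) fun n hn hn' ↦ haM n hn (by lia)).trans ?_
    have h1 : 2 * (C₀ * B * (2 * N) ^ 2) / h ≤ 8 * C₀ * B * (N * L ^ j) := by
      calc _ ≤ 2 * (C₀ * B * (2 * N) ^ 2) / (N / L ^ j) := by gcongr
        _ = _ := by field_simp; ring
    have h2 : (3 * L) ^ (k + 1) * h ≤ 3 ^ (k + 1) * (1 + (j : ℝ) ^ j) * (N * L ^ j) := by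
      have e : (3 * L) ^ (k + 1) = 3 ^ (k + 1) * (L ^ j * L ^ j) := by
        rw [mul_pow, ← pow_add, show k + 1 = j + j by lia]
      calc _ ≤ 3 ^ (k + 1) * (L ^ j * L ^ j) * (N / L ^ j + 1) := by rw [e]; gcongr
        _ = 3 ^ (k + 1) * (L ^ j * N + L ^ j * L ^ j) := by field_simp
        _ ≤ 3 ^ (k + 1) * (L ^ j * N + L ^ j * ((j : ℝ) ^ j * N)) := by gcongr
        _ = _ := by ring
    have h3 : 0 ≤ 8 * C₀ * (N * L ^ j) := by positivity
    have h4 : 0 ≤ B * (3 ^ (k + 1) * (1 + (j : ℝ) ^ j) * (N * L ^ j)) := by positivity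
    rw [hC₁]
    linarith
  have hI : ∀ (c : ℕ → ℂ) y, m ≤ y → ∑ n ∈ Icc 1 y, c n = ∑ n ∈ Icc 1 m, c n + ∑ n ∈ Ioc m y, c n :=
    fun c y hy ↦ by
    rw [← sum_union (by rw [disjoint_left]; intro n; simp; lia)]
    congr 1
    ext n; simp; lia
  have hb1 : ‖∑ n ∈ Ioc m N, b n‖ ≤ 2 ^ (k + 1) * C₁ * (B + 1) * (N / L ^ J) := by
    have hpos : ∀ n : ℕ, m < n → 0 < Real.log n := fun n hn ↦
      Real.log_pos (by exact_mod_cast (by lia : 1 < n))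
    have e : ∑ n ∈ Ioc m N, b n = ∑ n ∈ Ioc m N, a n * (((Real.log n ^ k)⁻¹ : ℝ) : ℂ) := by
      refine sum_congr rfl fun n hn ↦ ?_
      have := (hpos n (mem_Ioc.mp hn).1).ne'
      have h' : (Real.log n : ℂ) ^ k ≠ 0 := pow_ne_zero _ (by exact_mod_cast this)
      rw [han, Complex.ofReal_inv, Complex.ofReal_pow, mul_right_comm, mul_inv_cancel₀ h', one_mul]
    rw [e]
    refine (norm_sum_mul_ofReal_le_of_antitone (D := 2 * (C₁ * (B + 1) * (N * L ^ j)))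
      (w := fun n ↦ (Real.log n ^ k)⁻¹) hmN
      (fun n hn ↦ ?_) (by have := hpos N hmN; positivity) fun y hy hyN ↦ ?_).trans ?_
    · have := hpos n hn
      gcongr
      · exact_mod_cast (by lia : 0 < n)
      · lia
    · have h1 : ∑ n ∈ Ioc m y, a n = ∑ n ∈ Icc 1 y, a n - ∑ n ∈ Icc 1 m, a n := by
        rw [hI a y hy.le]; ring
      rw [h1]
      refine (norm_sub_le _ _).trans ?_
      linarith [hA y hy.le hyN, hA m le_rfl hmN.le]
    · calc _ ≤ 2 * (C₁ * (B + 1) * (N * L ^ j)) * ((L / 2) ^ k)⁻¹ := by gcongr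
        _ = _ := by
          rw [show k = J + j by lia, div_pow, pow_add L]
          field_simp
          ring
  have hb2 : ‖∑ n ∈ Icc 1 m, b n‖ ≤ C₂ * (B + 1) * (N / L ^ J) := by
    have hs : (m : ℝ) ≤ √N := Real.le_sqrt_of_sq_le (by rw [sq]; exact_mod_cast hmm)
    have hs1 : 1 ≤ √N := Real.one_le_sqrt.mpr hN1.le
    have h1 := log_pow_le j hs1
    have h2 : Real.log √N = L / 2 := Real.log_sqrt hN0.le
    rw [h2] at h1
    have h3 : m * (L + 1) ≤ C₂ * (N / L ^ J) := by
      rw [← mul_div_assoc, le_div_iff₀ (by positivity)]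
      calc m * (L + 1) * L ^ J ≤ √N * (L + L) * L ^ J := by gcongr
        _ = 2 ^ (j + 1) * √N * (L / 2) ^ j := by rw [hj, div_pow]; field_simp; ring
        _ ≤ 2 ^ (j + 1) * √N * ((j : ℝ) ^ j * √N) := by gcongr
        _ = C₂ * (√N * √N) := by rw [hC₂]; ring
        _ = C₂ * N := by rw [Real.mul_self_sqrt hN0.le]
    have h4 : 0 ≤ C₂ * (N / L ^ J) * B := by positivity
    refine (htriv m hmN.le).trans ?_
    linarith
  rw [hI b N hmN.le]
  have h5 : 0 ≤ 17 * 16 ^ J * (N / L ^ J) := by positivity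
  refine (norm_add_le _ _).trans ?_
  linarith

/-- A bound for a partial sum that saves powers of `log` holds uniformly for shorter sums. -/
lemma norm_sum_le_of_forall_norm_sum_le {b : ℕ → ℂ} {K : ℝ} {J : ℕ}
    (hb : ∀ n, ‖b n‖ ≤ Real.log n + 1) (hK : 0 ≤ K)
    (h : ∀ N : ℕ, 2 ≤ N → ‖∑ n ∈ Icc 1 N, b n‖ ≤ K * (N / Real.log N ^ J))
    {y N : ℕ} (hN : 2 ≤ N) (hy : y ≤ N) :
    ‖∑ n ∈ Icc 1 y, b n‖ ≤
      (2 ^ J * K + 3 * 2 ^ (J + 1) * ((J + 1 : ℕ) : ℝ) ^ (J + 1)) * (N / Real.log N ^ J) := by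
  have hN0 : (0 : ℝ) < N := by exact_mod_cast (by lia : 0 < N)
  have hN1 : (1 : ℝ) < N := by exact_mod_cast (by lia : 1 < N)
  have hN2 : (2 : ℝ) ≤ N := by exact_mod_cast hN
  set L := Real.log N with hLdef
  have hL0 : 1 / 2 ≤ L := by
    have := Real.log_le_log (by norm_num) hN2
    linarith [Real.log_two_gt_d9]
  rw [add_mul]
  rcases le_or_gt (y : ℝ) (√N) with hyN | hyN
  · have h0 : 0 ≤ 2 ^ J * K * (N / L ^ J) := by positivity
    refine le_trans ?_ (le_add_of_nonneg_left h0)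
    have h1 : ‖∑ n ∈ Icc 1 y, b n‖ ≤ y * (L + 1) := by
      refine (norm_sum_le _ _).trans ((sum_le_card_nsmul _ _ (L + 1) fun n hn ↦ ?_).trans ?_)
      swap
      · simp [mul_add]
      rw [mem_Icc] at hn
      have := Real.log_le_log (by exact_mod_cast hn.1) (by exact_mod_cast hn.2.trans hy :
        (n : ℝ) ≤ N)
      linarith [hb n]
    have h2 := log_pow_le (J + 1) (Real.one_le_sqrt.mpr hN1.le)
    rw [Real.log_sqrt hN0.le, ← hLdef] at h2
    refine h1.trans ?_
    rw [← mul_div_assoc, le_div_iff₀ (by positivity)]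
    calc y * (L + 1) * L ^ J ≤ √N * (3 * L) * L ^ J := by
          have : L + 1 ≤ 3 * L := by linarith
          gcongr
      _ = 3 * 2 ^ (J + 1) * √N * (L / 2) ^ (J + 1) := by rw [div_pow]; field_simp; ring
      _ ≤ 3 * 2 ^ (J + 1) * √N * (((J + 1 : ℕ) : ℝ) ^ (J + 1) * √N) := by gcongr
      _ = 3 * 2 ^ (J + 1) * ((J + 1 : ℕ) : ℝ) ^ (J + 1) * (√N * √N) := by ring
      _ = _ := by rw [Real.mul_self_sqrt hN0.le]
  · have h0 : 0 ≤ 3 * 2 ^ (J + 1) * ((J + 1 : ℕ) : ℝ) ^ (J + 1) * (N / L ^ J) := by positivity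
    refine le_trans ?_ (le_add_of_nonneg_right h0)
    have hs1 := (Real.lt_sqrt zero_le_one).mpr (by linarith : (1 : ℝ) ^ 2 < N)
    have hy2 : 2 ≤ y := by
      have : (1 : ℝ) < y := hs1.trans hyN
      exact_mod_cast this
    have hly : L / 2 ≤ Real.log y := by
      rw [hLdef, ← Real.log_sqrt hN0.le]
      exact Real.log_le_log (by linarith) hyN.le
    have hyN' : (y : ℝ) ≤ N := by exact_mod_cast hy
    calc _ ≤ K * (y / Real.log y ^ J) := h y hy2
      _ ≤ K * (N / (L / 2) ^ J) := by gcongr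
      _ = _ := by rw [div_pow]; field_simp

/-- **Siegel–Walfisz** for nontrivial characters. -/
theorem exists_norm_sum_twist_le (A : ℕ) : ∃ C : ℝ, 0 < C ∧ ∀ N : ℕ, 2 ≤ N → ∀ (q : ℕ) [NeZero q],
    (q : ℝ) ≤ Real.log N ^ A → ∀ χ : DirichletCharacter ℂ q, χ ≠ 1 → ∀ y ≤ N,
      ‖∑ n ∈ Icc 1 y, χ n * (ArithmeticFunction.vonMangoldt n : ℂ)‖ ≤
        C * (N / Real.log N ^ A) := by
  obtain ⟨C₁, hC₁, h₁⟩ := exists_norm_sum_le_of_LSeries_logMul (2 * A)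
  obtain ⟨C₂, hC₂, h₂⟩ := exists_norm_LSeries_logMul_twist_le (2 * (2 * A) + 1)
  refine ⟨2 ^ (2 * A) * (C₁ * (C₂ + 1)) + 3 * 2 ^ (2 * A + 1) * ((2 * A + 1 : ℕ) : ℝ) ^ (2 * A + 1),
    by positivity, fun N hN q _ hq χ hχ y hy ↦ ?_⟩
  have hq1 : (1 : ℝ) ≤ q := by exact_mod_cast NeZero.one_le
  have hN1 : (1 : ℝ) < N := by exact_mod_cast (by lia : 1 < N)
  have hL := Real.log_pos hN1
  have hb : ∀ n : ℕ, ‖χ n * (ArithmeticFunction.vonMangoldt n : ℂ)‖ ≤ Real.log n + 1 := fun n ↦ by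
    rw [norm_mul, Complex.norm_real, Real.norm_of_nonneg ArithmeticFunction.vonMangoldt_nonneg]
    have h1 := χ.norm_le_one n
    have h2 := ArithmeticFunction.vonMangoldt_le_log (n := n)
    have h3 : 0 ≤ ArithmeticFunction.vonMangoldt n := ArithmeticFunction.vonMangoldt_nonneg
    nlinarith
  have hLS := h₁ (fun n ↦ χ n * (ArithmeticFunction.vonMangoldt n : ℂ)) (C₂ * (q : ℝ) ^ (1 / 2 : ℝ))
    hb (by positivity) fun s hs hs' ↦ (h₂ q χ hχ s hs hs').trans (le_of_eq ?_)
  swap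
  · rw [Real.mul_rpow (by positivity) (by positivity), mul_assoc]
  have hmain := norm_sum_le_of_forall_norm_sum_le hb (by positivity) hLS hN hy
  refine hmain.trans ?_
  have hqr : (q : ℝ) ^ (1 / 2 : ℝ) ≤ q := by
    calc (q : ℝ) ^ (1 / 2 : ℝ) ≤ (q : ℝ) ^ (1 : ℝ) :=
          Real.rpow_le_rpow_of_exponent_le hq1 (by norm_num)
      _ = q := Real.rpow_one _
  calc _ ≤ (2 ^ (2 * A) * (C₁ * (C₂ + 1)) +
        3 * 2 ^ (2 * A + 1) * ((2 * A + 1 : ℕ) : ℝ) ^ (2 * A + 1)) * q *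
          (N / Real.log N ^ (2 * A)) := by
        refine mul_le_mul_of_nonneg_right ?_ (by positivity)
        rw [add_mul]
        refine add_le_add ?_ (le_mul_of_one_le_right (by positivity) hq1)
        rw [mul_assoc, mul_assoc C₁]
        refine mul_le_mul_of_nonneg_left (mul_le_mul_of_nonneg_left ?_ hC₁.le) (by positivity)
        nlinarith
    _ ≤ (2 ^ (2 * A) * (C₁ * (C₂ + 1)) +
        3 * 2 ^ (2 * A + 1) * ((2 * A + 1 : ℕ) : ℝ) ^ (2 * A + 1)) * Real.log N ^ A *
          (N / Real.log N ^ (2 * A)) := by gcongr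
    _ = _ := by
      rw [two_mul A, pow_add (Real.log N)]
      field_simp

/-- The prime number theorem with a saving of an arbitrary power of `log`. -/
theorem exists_norm_sum_vonMangoldt_sub_one_le (A : ℕ) : ∃ C : ℝ, 0 < C ∧ ∀ N : ℕ, 2 ≤ N →
    ∀ y ≤ N, ‖∑ n ∈ Icc 1 y, ((ArithmeticFunction.vonMangoldt n : ℂ) - 1)‖ ≤
      C * (N / Real.log N ^ A) := by
  obtain ⟨C₁, hC₁, h₁⟩ := exists_norm_sum_le_of_LSeries_logMul A
  obtain ⟨C₂, hC₂, h₂⟩ := exists_norm_LSeries_logMul_vonMangoldt_sub_one_le (2 * A + 1)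
  refine ⟨2 ^ A * (C₁ * (C₂ + 1)) + 3 * 2 ^ (A + 1) * ((A + 1 : ℕ) : ℝ) ^ (A + 1),
    by positivity, fun N hN y hy ↦ ?_⟩
  have hb : ∀ n : ℕ, ‖(ArithmeticFunction.vonMangoldt n : ℂ) - 1‖ ≤ Real.log n + 1 := fun n ↦ by
    refine (norm_sub_le _ _).trans ?_
    rw [Complex.norm_real, Real.norm_of_nonneg ArithmeticFunction.vonMangoldt_nonneg, norm_one]
    linarith [ArithmeticFunction.vonMangoldt_le_log (n := n)]
  exact norm_sum_le_of_forall_norm_sum_le hb (by positivity) (h₁ _ C₂ hb hC₂.le h₂) hN hy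

lemma sum_vonMangoldt_not_coprime_le {N q : ℕ} (hN : 2 ≤ N) (hq : 1 ≤ q) :
    ∑ n ∈ Icc 1 N with ¬ n.Coprime q, ArithmeticFunction.vonMangoldt n ≤
      8 * q * Real.log N ^ 2 := by
  have hN0 : (0 : ℝ) < N := by exact_mod_cast (by lia : 0 < N)
  have hN2 : (2 : ℝ) ≤ N := by exact_mod_cast hN
  have hq1 : (1 : ℝ) ≤ q := by exact_mod_cast hq
  have hL0 : 1 / 2 ≤ Real.log N := by
    have := Real.log_le_log (by norm_num) hN2
    linarith [Real.log_two_gt_d9]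
  set T := (range (q + 1) ×ˢ range (Nat.log 2 N + 1)).image fun x ↦ x.1 ^ x.2 with hT
  have hcard : (#T : ℝ) ≤ 8 * q * Real.log N := by
    have h1 : #T ≤ (q + 1) * (Nat.log 2 N + 1) := by
      refine card_image_le.trans (le_of_eq ?_)
      rw [card_product, card_range, card_range]
    have h2 : (Nat.log 2 N : ℝ) ≤ 2 * Real.log N := by
      have := Real.natLog_le_logb N 2
      rw [Real.logb] at this
      refine this.trans ?_
      push_cast
      rw [div_le_iff₀ (Real.log_pos (by norm_num))]
      nlinarith [Real.log_two_gt_d9]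
    calc (#T : ℝ) ≤ (q + 1) * (Nat.log 2 N + 1) := by exact_mod_cast h1
      _ ≤ (q + q) * (2 * Real.log N + 2 * Real.log N) := by gcongr; linarith
      _ = _ := by ring
  have hsub : ∑ n ∈ Icc 1 N with ¬ n.Coprime q, ArithmeticFunction.vonMangoldt n ≤
      ∑ n ∈ T, Real.log N := by
    rw [← sum_filter_ne_zero]
    refine (sum_le_sum fun n hn ↦ ?_).trans
      (sum_le_sum_of_subset_of_nonneg (fun n hn ↦ ?_) fun _ _ _ ↦ by linarith)
    · simp only [mem_filter, mem_Icc] at hn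
      exact ArithmeticFunction.vonMangoldt_le_log.trans
        (Real.log_le_log (by exact_mod_cast hn.1.1.1) (by exact_mod_cast hn.1.1.2))
    · simp only [mem_filter, mem_Icc, ArithmeticFunction.vonMangoldt_ne_zero_iff] at hn
      obtain ⟨⟨⟨hn1, hnN⟩, hnq⟩, hpp⟩ := hn
      obtain ⟨p, k, hp, hk, rfl⟩ := (isPrimePow_nat_iff n).mp hpp
      rw [Nat.coprime_pow_left_iff hk, Nat.Prime.coprime_iff_not_dvd hp, not_not] at hnq
      simp only [hT, mem_image, mem_product, mem_range, Prod.exists]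
      refine ⟨p, k, ⟨by have := Nat.le_of_dvd hq hnq; lia, ?_⟩, rfl⟩
      rw [Nat.lt_succ_iff]
      refine Nat.le_log_of_pow_le (by norm_num) (le_trans ?_ hnN)
      exact Nat.pow_le_pow_left hp.two_le k
  refine hsub.trans ?_
  rw [sum_const, nsmul_eq_mul, sq, ← mul_assoc]
  gcongr

/-- **Siegel–Walfisz** for primes in arithmetic progressions. -/
theorem exists_norm_sum_vonMangoldt_residue_sub_le (A : ℕ) : ∃ C : ℝ, 0 < C ∧ ∀ N : ℕ, 2 ≤ N →
    ∀ q : ℕ, 1 ≤ q → (q : ℝ) ≤ Real.log N ^ A → ∀ b : ℕ, b.Coprime q → ∀ y ≤ N,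
      ‖∑ n ∈ Icc 1 y with n % q = b % q, (ArithmeticFunction.vonMangoldt n : ℂ) -
        y / q.totient‖ ≤ C * (N / Real.log N ^ A) := by
  obtain ⟨C₁, hC₁, h₁⟩ := exists_norm_sum_twist_le A
  obtain ⟨C₂, hC₂, h₂⟩ := exists_norm_sum_vonMangoldt_sub_one_le A
  refine ⟨C₁ + C₂ + 8 * ((2 * A + 2 : ℕ) : ℝ) ^ (2 * A + 2), by positivity,
    fun N hN q hq hqA b hb y hy ↦ ?_⟩
  have : NeZero q := ⟨by lia⟩
  have hN1 : (1 : ℝ) < N := by exact_mod_cast (by lia : 1 < N)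
  have hL := Real.log_pos hN1
  have hφ : (1 : ℝ) ≤ q.totient := by exact_mod_cast Nat.totient_pos.mpr hq
  have hbu : IsUnit (b : ZMod q) := (ZMod.isUnit_iff_coprime b q).mpr hb
  have horth : (q.totient : ℂ) *
      ∑ n ∈ Icc 1 y with n % q = b % q, (ArithmeticFunction.vonMangoldt n : ℂ) =
        ∑ χ : DirichletCharacter ℂ q, χ (b : ZMod q)⁻¹ *
          ∑ n ∈ Icc 1 y, χ n * (ArithmeticFunction.vonMangoldt n : ℂ) := by
    simp_rw [mul_sum, ← mul_assoc]
    rw [sum_comm, sum_filter]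
    refine sum_congr rfl fun n _ ↦ ?_
    rw [← sum_mul, DirichletCharacter.sum_char_inv_mul_char_eq ℂ hbu]
    have : (b : ZMod q) = n ↔ n % q = b % q := by
      rw [ZMod.natCast_eq_natCast_iff, Nat.ModEq, eq_comm]
    simp only [this]
    split_ifs <;> simp
  have hone : ∑ n ∈ Icc 1 y, (1 : DirichletCharacter ℂ q) n *
      (ArithmeticFunction.vonMangoldt n : ℂ) = y +
        ∑ n ∈ Icc 1 y, ((ArithmeticFunction.vonMangoldt n : ℂ) - 1) -
        (∑ n ∈ Icc 1 y with ¬ n.Coprime q, ArithmeticFunction.vonMangoldt n : ℝ) := by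
    have e : ∑ n ∈ Icc 1 y, (1 : DirichletCharacter ℂ q) n *
        (ArithmeticFunction.vonMangoldt n : ℂ) =
        ∑ n ∈ Icc 1 y with n.Coprime q, (ArithmeticFunction.vonMangoldt n : ℂ) := by
      rw [sum_filter]
      refine sum_congr rfl fun n _ ↦ ?_
      split_ifs with h
      · rw [MulChar.one_apply ((ZMod.isUnit_iff_coprime n q).mpr h), one_mul]
      · rw [MulChar.map_nonunit _ (mt (ZMod.isUnit_iff_coprime n q).mp h), zero_mul]
    rw [e, sum_sub_distrib, ← sum_filter_add_sum_filter_not (Icc 1 y) (fun n ↦ n.Coprime q)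
      fun n ↦ (ArithmeticFunction.vonMangoldt n : ℂ)]
    push_cast
    simp
  have hnc : ‖((∑ n ∈ Icc 1 y with ¬ n.Coprime q, ArithmeticFunction.vonMangoldt n : ℝ) : ℂ)‖ ≤
      8 * ((2 * A + 2 : ℕ) : ℝ) ^ (2 * A + 2) * (N / Real.log N ^ A) := by
    have hpos : ∀ n : ℕ, 0 ≤ ArithmeticFunction.vonMangoldt n := fun n ↦
      ArithmeticFunction.vonMangoldt_nonneg
    rw [Complex.norm_real, Real.norm_of_nonneg (sum_nonneg fun n _ ↦ hpos n)]
    calc _ ≤ ∑ n ∈ Icc 1 N with ¬ n.Coprime q, ArithmeticFunction.vonMangoldt n :=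
          sum_le_sum_of_subset_of_nonneg
            (filter_subset_filter _ (Icc_subset_Icc_right hy)) fun _ _ _ ↦ hpos _
      _ ≤ 8 * q * Real.log N ^ 2 := sum_vonMangoldt_not_coprime_le hN hq
      _ ≤ 8 * Real.log N ^ A * Real.log N ^ 2 := by gcongr
      _ = 8 * Real.log N ^ (2 * A + 2) / Real.log N ^ A := by
        rw [pow_add, two_mul, pow_add]; field_simp
      _ ≤ 8 * (((2 * A + 2 : ℕ) : ℝ) ^ (2 * A + 2) * N) / Real.log N ^ A := by
        gcongr
        exact log_pow_le _ hN1.le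
      _ = _ := by ring
  have hnorm : ∀ χ : DirichletCharacter ℂ q, ‖χ (b : ZMod q)⁻¹‖ ≤ 1 := fun χ ↦ χ.norm_le_one _
  have hoth : ‖∑ χ ∈ (univ : Finset (DirichletCharacter ℂ q)).erase 1, χ (b : ZMod q)⁻¹ *
      ∑ n ∈ Icc 1 y, χ n * (ArithmeticFunction.vonMangoldt n : ℂ)‖ ≤
      q.totient * (C₁ * (N / Real.log N ^ A)) := by
    refine (norm_sum_le _ _).trans ((sum_le_card_nsmul _ _ (C₁ * (N / Real.log N ^ A))
      fun χ hχ ↦ ?_).trans ?_)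
    · rw [norm_mul]
      refine (mul_le_of_le_one_left (norm_nonneg _) (hnorm χ)).trans ?_
      exact h₁ N hN q hqA χ (ne_of_mem_erase hχ) y hy
    · rw [nsmul_eq_mul]
      gcongr
      rw [← DirichletCharacter.card_eq_totient_of_hasEnoughRootsOfUnity ℂ q,
        Nat.card_eq_fintype_card]
      exact card_le_card (erase_subset _ _)
  have hbinv : (1 : DirichletCharacter ℂ q) (b : ZMod q)⁻¹ = 1 := by
    refine MulChar.one_apply ?_
    exact IsUnit.of_mul_eq_one (b : ZMod q) (ZMod.inv_mul_of_unit _ hbu)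
  rw [← add_sum_erase _ _ (mem_univ (1 : DirichletCharacter ℂ q)), hbinv, one_mul, hone] at horth
  have hfin : (q.totient : ℝ) * ‖∑ n ∈ Icc 1 y with n % q = b % q,
      (ArithmeticFunction.vonMangoldt n : ℂ) - y / q.totient‖ ≤
      q.totient * ((C₁ + C₂ + 8 * ((2 * A + 2 : ℕ) : ℝ) ^ (2 * A + 2)) *
        (N / Real.log N ^ A)) := by
    have hφ0 : (q.totient : ℂ) ≠ 0 := by
      exact_mod_cast (Nat.totient_pos.mpr hq).ne'
    calc _ = ‖(q.totient : ℂ) * (∑ n ∈ Icc 1 y with n % q = b % q,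
          (ArithmeticFunction.vonMangoldt n : ℂ) - y / q.totient)‖ := by
          rw [norm_mul, Complex.norm_natCast]
      _ = ‖∑ n ∈ Icc 1 y, ((ArithmeticFunction.vonMangoldt n : ℂ) - 1) -
        (∑ n ∈ Icc 1 y with ¬ n.Coprime q, ArithmeticFunction.vonMangoldt n : ℝ) +
        ∑ χ ∈ (univ : Finset (DirichletCharacter ℂ q)).erase 1, χ (b : ZMod q)⁻¹ *
          ∑ n ∈ Icc 1 y, χ n * (ArithmeticFunction.vonMangoldt n : ℂ)‖ := by
        rw [mul_sub, horth, mul_div_cancel₀ _ hφ0]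
        congr 1
        ring
      _ ≤ C₂ * (N / Real.log N ^ A) +
          8 * ((2 * A + 2 : ℕ) : ℝ) ^ (2 * A + 2) * (N / Real.log N ^ A) +
          q.totient * (C₁ * (N / Real.log N ^ A)) :=
        (norm_add_le _ _).trans (add_le_add ((norm_sub_le _ _).trans
          (add_le_add (h₂ N hN y hy) hnc)) hoth)
      _ ≤ _ := by
        have h5 : 0 ≤ C₂ * (N / Real.log N ^ A) := by positivity
        have h6 : 0 ≤ 8 * ((2 * A + 2 : ℕ) : ℝ) ^ (2 * A + 2) * (N / Real.log N ^ A) := by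
          positivity
        nlinarith
  exact le_of_mul_le_mul_left hfin (by linarith)

/-- The additive character `x ↦ exp (2 π i x)`. -/
noncomputable def e (x : ℝ) : ℂ := Complex.exp (Complex.I * (2 * Real.pi * x : ℝ))

lemma e_zero : e 0 = 1 := by simp [e]

lemma e_add (x y : ℝ) : e (x + y) = e x * e y := by
  rw [e, e, e, ← Complex.exp_add]; push_cast; congr 1; ring

lemma norm_e (x : ℝ) : ‖e x‖ = 1 := Complex.norm_exp_I_mul_ofReal _

lemma e_intCast (n : ℤ) : e n = 1 := by
  rw [e, ← Complex.exp_int_mul_two_pi_mul_I n]; push_cast; congr 1; ring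

lemma e_natCast (n : ℕ) : e n = 1 := by exact_mod_cast e_intCast n

lemma e_nat_mul (n : ℕ) (x : ℝ) : e (n * x) = e x ^ n := by
  rw [e, e, ← Complex.exp_nat_mul]; push_cast; congr 1; ring

lemma e_add_intCast (x : ℝ) (n : ℤ) : e (x + n) = e x := by rw [e_add, e_intCast, mul_one]

lemma conj_e (x : ℝ) : (starRingEnd ℂ) (e x) = e (-x) := by
  rw [e, e, ← Complex.exp_conj, map_mul, Complex.conj_I, Complex.conj_ofReal]
  congr 1
  push_cast
  ring

lemma norm_e_sub_one_le (x : ℝ) : ‖e x - 1‖ ≤ 2 * Real.pi * |x| := by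
  refine Real.norm_exp_I_mul_ofReal_sub_one_le.trans (le_of_eq ?_)
  rw [Real.norm_eq_abs, abs_mul, abs_of_pos Real.two_pi_pos]

/-- The distance to the nearest integer. -/
noncomputable def distInt (x : ℝ) : ℝ := |x - round x|

lemma distInt_nonneg (x : ℝ) : 0 ≤ distInt x := abs_nonneg _

lemma distInt_le_half (x : ℝ) : distInt x ≤ 1 / 2 := abs_sub_round x

lemma distInt_le (x : ℝ) (n : ℤ) : distInt x ≤ |x - n| := round_le x n

lemma distInt_neg (x : ℝ) : distInt (-x) = distInt x := by
  have h : ∀ y, distInt (-y) ≤ distInt y := fun y ↦ by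
    refine (distInt_le (-y) (-round y)).trans (le_of_eq ?_)
    rw [distInt, ← abs_neg (y - round y)]; push_cast; congr 1; ring
  exact le_antisymm (h x) (by simpa using h (-x))

lemma distInt_add_le (x y : ℝ) : distInt (x + y) ≤ distInt x + distInt y := by
  refine (distInt_le (x + y) (round x + round y)).trans ?_
  rw [distInt, distInt]
  refine le_trans (le_of_eq ?_) (abs_add_le _ _)
  push_cast; congr 1; ring

lemma four_mul_distInt_le (x : ℝ) : 4 * distInt x ≤ ‖e x - 1‖ := by
  have h1 : e x = e (x - round x) := by
    rw [← e_add_intCast (x - round x) (round x), sub_add_cancel]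
  have h2 := distInt_le_half x
  have hpi := Real.pi_pos
  rw [distInt] at h2 ⊢
  rw [h1, e, Complex.norm_exp_I_mul_ofReal_sub_one, norm_mul, Real.norm_two, Real.norm_eq_abs]
  have h3 := Real.mul_abs_le_abs_sin (x := 2 * Real.pi * (x - round x) / 2) (by
    rw [mul_assoc, mul_div_cancel_left₀ _ two_ne_zero, abs_mul, abs_of_pos hpi]
    nlinarith)
  refine le_trans (le_of_eq ?_) (mul_le_mul_of_nonneg_left h3 zero_le_two)
  rw [mul_assoc, mul_div_cancel_left₀ _ two_ne_zero, abs_mul, abs_of_pos hpi]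
  field_simp
  ring

lemma norm_sum_e_mul_distInt_le (a b : ℕ) (x : ℝ) :
    ‖∑ n ∈ Ico a b, e (n * x)‖ * distInt x ≤ 1 / 2 := by
  have h : (∑ n ∈ Ico a b, e (n * x)) * (e x - 1) = e (a * x) * (e ((b - a : ℕ) * x) - 1) := by
    rw [sum_Ico_eq_sum_range]
    simp only [Nat.cast_add, add_mul, e_add, ← mul_sum]
    rw [mul_assoc]
    simp only [e_nat_mul]
    rw [geom_sum_mul]
  have h2 : ‖∑ n ∈ Ico a b, e (n * x)‖ * ‖e x - 1‖ ≤ 2 := by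
    rw [← norm_mul, h, norm_mul, norm_e, one_mul]
    refine (norm_sub_le _ _).trans ?_
    rw [norm_e, norm_one]
    norm_num
  have h3 := mul_le_mul_of_nonneg_left (four_mul_distInt_le x)
    (norm_nonneg (∑ n ∈ Ico a b, e (n * x)))
  linarith

/-- The majorant `min (X, 1 / ‖x‖)` in smoothed form. -/
noncomputable def geomMaj (X x : ℝ) : ℝ := 2 * X / (1 + X * distInt x)

lemma norm_sum_e_le_geomMaj {a b : ℕ} {X : ℝ} (hX : 0 ≤ X) (hab : ((b - a : ℕ) : ℝ) ≤ X) (x : ℝ) :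
    ‖∑ n ∈ Ico a b, e (n * x)‖ ≤ geomMaj X x := by
  have h1 := norm_sum_e_mul_distInt_le a b x
  have h2 : ‖∑ n ∈ Ico a b, e (n * x)‖ ≤ X := by
    refine (norm_sum_le _ _).trans ?_
    simpa [norm_e] using hab
  have h3 := distInt_nonneg x
  rw [geomMaj, le_div_iff₀ (by positivity)]
  nlinarith

lemma sum_range_e_mul_div {m : ℕ} (hm : 0 < m) (n : ℕ) :
    ∑ b ∈ range m, e (b * (n / m)) = if m ∣ n then (m : ℂ) else 0 := by
  have hm0 : (m : ℝ) ≠ 0 := by positivity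
  split_ifs with h
  · obtain ⟨k, rfl⟩ := h
    have : ∀ b ∈ range m, e (b * ((m * k : ℕ) / m)) = 1 := fun b _ ↦ by
      rw [Nat.cast_mul, mul_div_cancel_left₀ _ hm0, ← Nat.cast_mul, e_natCast]
    rw [sum_congr rfl this]
    simp
  · have h1 : e (n / m) ≠ 1 := fun h1 ↦ by
      have h2 := four_mul_distInt_le (n / m)
      rw [h1, sub_self, norm_zero] at h2
      have h3 : distInt (n / m) = 0 := le_antisymm (by linarith) (distInt_nonneg _)
      rw [distInt, abs_eq_zero, sub_eq_zero, div_eq_iff hm0] at h3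
      have h4 : (n : ℤ) = round ((n : ℝ) / m) * m := by exact_mod_cast h3
      exact h (Int.natCast_dvd_natCast.mp ⟨_, h4.trans (mul_comm _ _)⟩)
    have h2 := geom_sum_mul (e (n / m)) m
    simp only [← e_nat_mul] at h2
    rw [mul_div_cancel₀ _ hm0, e_natCast, sub_self] at h2
    exact (mul_eq_zero.mp h2).resolve_right (sub_ne_zero.mpr h1)

/-- Ramanujan's sum. -/
noncomputable def ramanujanSum (q n : ℕ) : ℂ := ∑ b ∈ range q with b.Coprime q, e (b * (n / q))

theorem ramanujanSum_eq_sum_divisors {q : ℕ} (hq : 0 < q) (n : ℕ) : ramanujanSum q n =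
    ∑ d ∈ q.divisors, (ArithmeticFunction.moebius d : ℂ) * if q / d ∣ n then ((q / d : ℕ) : ℂ) else 0 := by
  have hmu : ∀ b : ℕ, (if b.Coprime q then (1 : ℂ) else 0) =
      ∑ d ∈ q.divisors, if d ∣ b then (ArithmeticFunction.moebius d : ℂ) else 0 := fun b ↦ by
    have h1 := congrArg (fun f : ArithmeticFunction ℤ ↦ (f (b.gcd q) : ℂ))
      ArithmeticFunction.moebius_mul_coe_zeta
    simp only [ArithmeticFunction.coe_mul_zeta_apply, ArithmeticFunction.one_apply] at h1
    push_cast at h1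
    rw [← sum_filter]
    have h2 : (b.gcd q).divisors = {d ∈ q.divisors | d ∣ b} := by
      ext d
      simp only [Nat.mem_divisors, mem_filter, Nat.dvd_gcd_iff]
      have : b.gcd q ≠ 0 := (Nat.gcd_pos_of_pos_right b hq).ne'
      have := hq.ne'
      tauto
    rw [← h2, h1]
  rw [ramanujanSum, sum_filter]
  have h3 : ∀ b ∈ range q, (if b.Coprime q then e (b * (n / q)) else 0) =
      ∑ d ∈ q.divisors, if d ∣ b then (ArithmeticFunction.moebius d : ℂ) * e (b * (n / q)) else 0 := by
    intro b _
    have := congrArg (· * e (b * (n / q))) (hmu b)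
    simpa only [sum_mul, ite_mul, zero_mul, one_mul] using this
  rw [sum_congr rfl h3, sum_comm]
  refine sum_congr rfl fun d hd ↦ ?_
  obtain ⟨m, rfl⟩ := (Nat.mem_divisors.mp hd).1
  have hd0 : 0 < d := Nat.pos_of_mul_pos_right hq
  have hm0 : 0 < m := Nat.pos_of_mul_pos_left hq
  rw [Nat.mul_div_cancel_left m hd0, ← sum_range_e_mul_div hm0 n, ← sum_filter, mul_sum]
  symm
  refine sum_bij (fun b _ ↦ d * b) (fun b hb ↦ ?_) (fun _ _ _ _ h ↦ Nat.eq_of_mul_eq_mul_left hd0 h)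
    (fun b hb ↦ ?_) fun b hb ↦ ?_
  · rw [mem_range] at hb
    simp only [mem_filter, mem_range, dvd_mul_right, and_true]
    gcongr
  · simp only [mem_filter, mem_range] at hb
    obtain ⟨hb1, c, rfl⟩ := hb
    exact ⟨c, mem_range.mpr (Nat.lt_of_mul_lt_mul_left hb1), rfl⟩
  · congr 2
    push_cast
    field_simp

lemma ramanujanSum_of_coprime {q n : ℕ} (hq : 0 < q) (h : n.Coprime q) :
    ramanujanSum q n = ArithmeticFunction.moebius q := by
  rw [ramanujanSum_eq_sum_divisors hq, sum_eq_single q]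
  · simp [Nat.div_self hq]
  · intro d hd hdq
    obtain ⟨m, rfl⟩ := (Nat.mem_divisors.mp hd).1
    have hd0 : 0 < d := Nat.pos_of_mul_pos_right hq
    rw [Nat.mul_div_cancel_left m hd0, if_neg, mul_zero]
    intro hmn
    have h1 : m ∣ 1 := by
      rw [← h]
      exact Nat.dvd_gcd hmn (dvd_mul_left _ _)
    rw [Nat.dvd_one.mp h1, mul_one] at hdq
    exact hdq rfl
  · intro h1
    exact absurd (Nat.mem_divisors_self q hq.ne') h1

lemma e_mod_mul_div {q : ℕ} (hq : 0 < q) (n a : ℕ) :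
    e ((n % q : ℕ) * (a / q)) = e (n * (a / q)) := by
  have hq0 : (q : ℝ) ≠ 0 := by positivity
  have h : (n : ℝ) * (a / q) = (n % q : ℕ) * (a / q) + ((n / q * a : ℕ) : ℝ) := by
    have h1 : (n : ℝ) = (n % q : ℕ) + (q : ℝ) * (n / q : ℕ) := by
      exact_mod_cast (Nat.mod_add_div n q).symm
    rw [Nat.cast_mul]
    conv_lhs => rw [h1]
    field_simp
  rw [h, e_add, e_natCast, mul_one]

/-- Exponential sums over primes at rational points with small denominator. -/
theorem exists_norm_sum_vonMangoldt_e_div_sub_le (A : ℕ) : ∃ C : ℝ, 0 < C ∧ ∀ N : ℕ, 2 ≤ N →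
    ∀ q : ℕ, 1 ≤ q → (q : ℝ) ≤ Real.log N ^ A → ∀ a : ℕ, a.Coprime q → ∀ y ≤ N,
      ‖∑ n ∈ Icc 1 y, (ArithmeticFunction.vonMangoldt n : ℂ) * e (n * (a / q)) -
        (ArithmeticFunction.moebius q : ℂ) / q.totient * y‖ ≤ C * q * (N / Real.log N ^ A) := by
  obtain ⟨C, hC, h⟩ := exists_norm_sum_vonMangoldt_residue_sub_le A
  refine ⟨C + 8 * ((A + 2 : ℕ) : ℝ) ^ (A + 2), by positivity, fun N hN q hq hqA a ha y hy ↦ ?_⟩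
  have hN1 : (1 : ℝ) < N := by exact_mod_cast (by lia : 1 < N)
  have hL := Real.log_pos hN1
  have hpos : ∀ n : ℕ, 0 ≤ ArithmeticFunction.vonMangoldt n := fun n ↦
    ArithmeticFunction.vonMangoldt_nonneg
  have hnc : ‖∑ n ∈ Icc 1 y with ¬ n.Coprime q,
      (ArithmeticFunction.vonMangoldt n : ℂ) * e (n * (a / q))‖ ≤
      8 * ((A + 2 : ℕ) : ℝ) ^ (A + 2) * q * (N / Real.log N ^ A) := by
    calc _ ≤ ∑ n ∈ Icc 1 y with ¬ n.Coprime q, ArithmeticFunction.vonMangoldt n := by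
          refine norm_sum_le_of_le _ fun n _ ↦ ?_
          rw [norm_mul, norm_e, mul_one, Complex.norm_real, Real.norm_of_nonneg (hpos n)]
      _ ≤ ∑ n ∈ Icc 1 N with ¬ n.Coprime q, ArithmeticFunction.vonMangoldt n :=
          sum_le_sum_of_subset_of_nonneg
            (filter_subset_filter _ (Icc_subset_Icc_right hy)) fun _ _ _ ↦ hpos _
      _ ≤ 8 * q * Real.log N ^ 2 := sum_vonMangoldt_not_coprime_le hN hq
      _ = 8 * q * Real.log N ^ (A + 2) / Real.log N ^ A := by rw [pow_add]; field_simp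
      _ ≤ 8 * q * (((A + 2 : ℕ) : ℝ) ^ (A + 2) * N) / Real.log N ^ A := by
        gcongr
        exact log_pow_le _ hN1.le
      _ = _ := by ring
  have hco : ∑ n ∈ Icc 1 y with n.Coprime q,
      (ArithmeticFunction.vonMangoldt n : ℂ) * e (n * (a / q)) =
      ∑ b ∈ range q with b.Coprime q, e (b * (a / q)) *
        ∑ n ∈ Icc 1 y with n % q = b % q, (ArithmeticFunction.vonMangoldt n : ℂ) := by
    rw [← sum_fiberwise_of_maps_to (s := {n ∈ Icc 1 y | n.Coprime q})
      (t := {b ∈ range q | b.Coprime q}) (g := fun n ↦ n % q) fun n hn ↦ ?_]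
    · refine sum_congr rfl fun b hb ↦ ?_
      simp only [mem_filter, mem_range] at hb
      rw [mul_sum, filter_filter, Nat.mod_eq_of_lt hb.1]
      refine sum_congr ?_ fun n hn ↦ ?_
      · refine filter_congr fun n _ ↦ ⟨fun h ↦ h.2, fun h ↦ ⟨?_, h⟩⟩
        rw [Nat.Coprime, Nat.gcd_comm, Nat.gcd_rec, h]
        exact hb.2
      · rw [← (mem_filter.mp hn).2, e_mod_mul_div (by lia), mul_comm]
    · simp only [mem_filter, mem_range] at hn ⊢
      refine ⟨Nat.mod_lt _ (by lia), ?_⟩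
      rw [Nat.Coprime, ← Nat.gcd_rec, Nat.gcd_comm]
      exact hn.2
  have hram : (ArithmeticFunction.moebius q : ℂ) / q.totient * y =
      ∑ b ∈ range q with b.Coprime q, e (b * (a / q)) * (y / q.totient) := by
    rw [← sum_mul, ← ramanujanSum, ramanujanSum_of_coprime (by lia) ha]
    ring
  rw [← sum_filter_add_sum_filter_not (Icc 1 y) (fun n ↦ n.Coprime q), hco, hram, add_sub_right_comm,
    ← sum_sub_distrib]
  refine (norm_add_le _ _).trans ?_
  rw [add_mul, add_mul]
  refine add_le_add ?_ hnc
  refine (norm_sum_le _ _).trans ((sum_le_card_nsmul _ _ (C * (N / Real.log N ^ A))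
    fun b hb ↦ ?_).trans ?_)
  · rw [← mul_sub, norm_mul, norm_e, one_mul]
    exact h N hN q hq hqA b (mem_filter.mp hb).2 y hy
  · rw [nsmul_eq_mul, mul_comm C q, mul_assoc (q : ℝ)]
    have hcard := (card_filter_le (range q) fun b ↦ b.Coprime q).trans (card_range q).le
    exact mul_le_mul_of_nonneg_right (Nat.cast_le.mpr hcard) (by positivity)

/-- Exponential sums over primes on the major arcs. -/
theorem exists_norm_sum_vonMangoldt_e_sub_le (A : ℕ) : ∃ C : ℝ, 0 < C ∧ ∀ N : ℕ, 2 ≤ N →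
    ∀ q : ℕ, 1 ≤ q → (q : ℝ) ≤ Real.log N ^ A → ∀ a : ℕ, a.Coprime q → ∀ β : ℝ,
      ‖∑ n ∈ Icc 1 N, (ArithmeticFunction.vonMangoldt n : ℂ) * e (n * (a / q + β)) -
        (ArithmeticFunction.moebius q : ℂ) / q.totient * ∑ n ∈ Icc 1 N, e (n * β)‖ ≤
          C * q * (N / Real.log N ^ A) * (1 + 7 * (N * |β|)) := by
  obtain ⟨C, hC, h⟩ := exists_norm_sum_vonMangoldt_e_div_sub_le A
  refine ⟨C, hC, fun N hN q hq hqA a ha β ↦ ?_⟩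
  have hI : ∀ y, Ioc 0 y = Icc 1 y := fun y ↦ by ext; simp; lia
  have hN1 : (1 : ℝ) < N := by exact_mod_cast (by lia : 1 < N)
  have hL := Real.log_pos hN1
  have key := norm_sum_mul_le_of_forall_norm_sum_le (m := 0) (N := N)
    (f := fun n ↦ (ArithmeticFunction.vonMangoldt n : ℂ) * e (n * (a / q)) -
      (ArithmeticFunction.moebius q : ℂ) / q.totient) (w := fun n ↦ e (n * β))
    (D := C * q * (N / Real.log N ^ A)) (by lia) fun y _ hy ↦ by
      have := h N hN q hq hqA a ha y hy
      rw [hI, sum_sub_distrib]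
      simpa [mul_comm] using this
  rw [hI] at key
  have e1 : ∑ n ∈ Icc 1 N, (ArithmeticFunction.vonMangoldt n : ℂ) * e (n * (a / q + β)) -
        (ArithmeticFunction.moebius q : ℂ) / q.totient * ∑ n ∈ Icc 1 N, e (n * β) =
      ∑ n ∈ Icc 1 N, ((ArithmeticFunction.vonMangoldt n : ℂ) * e (n * (a / q)) -
      (ArithmeticFunction.moebius q : ℂ) / q.totient) * e (n * β) := by
    rw [mul_sum, ← sum_sub_distrib]
    refine sum_congr rfl fun n _ ↦ ?_
    rw [mul_add, e_add]
    ring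
  rw [e1]
  refine key.trans ?_
  gcongr ?_ * (?_ + ?_)
  · exact (norm_e _).le
  · refine (sum_le_card_nsmul _ _ (7 * |β|) fun n _ ↦ ?_).trans ?_
    · rw [Nat.cast_add, Nat.cast_one, add_mul, one_mul, e_add, ← mul_one_sub, norm_mul, norm_e,
        one_mul, norm_sub_rev]
      refine (norm_e_sub_one_le β).trans ?_
      gcongr
      linarith [Real.pi_lt_d2]
    · rw [nsmul_eq_mul, Nat.card_Ico]
      have : ((N - (0 + 1) : ℕ) : ℝ) ≤ N := by exact_mod_cast Nat.sub_le _ _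
      nlinarith [abs_nonneg β]

lemma inv_two_mul_le_distInt {q : ℕ} {a : ℤ} (ha : IsCoprime a q) {α : ℝ}
    (hα : |α - a / q| ≤ 1 / (q : ℝ) ^ 2) {h : ℕ} (h0 : 0 < h) (hq : 2 * h ≤ q) :
    1 / (2 * q : ℝ) ≤ distInt (h * α) := by
  have hq0 : (0 : ℝ) < q := by exact_mod_cast (by lia : 0 < q)
  set n := round (h * α)
  have hne : (h : ℤ) * a - q * n ≠ 0 := by
    intro h1
    have h2 : (q : ℤ) ∣ h := ha.symm.dvd_of_dvd_mul_right ⟨n, by lia⟩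
    have := Nat.le_of_dvd h0 (Int.natCast_dvd_natCast.mp h2)
    lia
  have h1 : (1 : ℝ) ≤ |(h : ℝ) * a - q * n| := by exact_mod_cast Int.one_le_abs hne
  have h2 : (h : ℝ) * a - q * n = q * (h * α - n) - q * h * (α - a / q) := by field_simp; ring
  have h3 : |(h : ℝ) * a - q * n| ≤ q * |h * α - n| + q * h * |α - a / q| := by
    rw [h2]
    refine (abs_sub _ _).trans (le_of_eq ?_)
    rw [abs_mul, abs_mul, abs_mul, abs_of_pos hq0, Nat.abs_cast]
  have h4 : (q : ℝ) * h * |α - a / q| ≤ 1 / 2 := by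
    calc (q : ℝ) * h * |α - a / q| ≤ q * (q / 2) * (1 / (q : ℝ) ^ 2) := by
          gcongr
          rw [le_div_iff₀ two_pos]
          exact_mod_cast (by lia : h * 2 ≤ q)
      _ = 1 / 2 := by field_simp
  rw [distInt, div_le_iff₀ (by positivity)]
  linarith

lemma sum_le_of_pairwise {ι : Type*} (s : Finset ι) (y : ι → ℝ) (hy0 : ∀ i ∈ s, 0 ≤ y i)
    (hy1 : ∀ i ∈ s, y i ≤ 1 / 2) {q : ℕ} (hq : 0 < q)
    (hy : ∀ i ∈ s, ∀ j ∈ s, i ≠ j → 1 / (2 * q : ℝ) ≤ |y i - y j|) {X : ℝ} (hX : 0 ≤ X) :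
    ∑ i ∈ s, 2 * X / (1 + X * y i) ≤ 2 * X + 4 * q * (1 + Real.log q) := by
  have hq0 : (0 : ℝ) < q := by exact_mod_cast hq
  have hinj : Set.InjOn (fun i ↦ ⌊2 * q * y i⌋₊) s := by
    intro i hi j hj hij
    by_contra hne
    have h1 := hy i hi j hj hne
    have hi0 := hy0 i hi
    have hj0 := hy0 j hj
    have e1 := Nat.floor_le (a := 2 * q * y i) (by positivity)
    have e2 := Nat.floor_le (a := 2 * q * y j) (by positivity)
    have e3 := Nat.lt_floor_add_one (2 * q * y i)
    have e4 := Nat.lt_floor_add_one (2 * q * y j)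
    simp only at hij
    rw [hij] at e1 e3
    have : |2 * q * y i - 2 * q * y j| < 1 := by rw [abs_lt]; constructor <;> linarith
    rw [← mul_sub, abs_mul, abs_of_pos (by positivity)] at this
    rw [div_le_iff₀ (by positivity)] at h1
    linarith
  calc ∑ i ∈ s, 2 * X / (1 + X * y i)
      ≤ ∑ i ∈ s, 2 * X / (1 + X * (⌊2 * q * y i⌋₊ / (2 * q))) := by
        refine sum_le_sum fun i hi ↦ ?_
        have hi0 := hy0 i hi
        gcongr
        rw [div_le_iff₀ (by positivity), mul_comm (y i)]
        exact Nat.floor_le (by positivity)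
    _ = ∑ b ∈ s.image fun i ↦ ⌊2 * q * y i⌋₊, 2 * X / (1 + X * (b / (2 * q))) :=
        (sum_image (f := fun b : ℕ ↦ 2 * X / (1 + X * (b / (2 * q)))) hinj).symm
    _ ≤ ∑ b ∈ range (q + 1), 2 * X / (1 + X * (b / (2 * q))) := by
        refine sum_le_sum_of_subset_of_nonneg (image_subset_iff.mpr fun i hi ↦ ?_)
          fun b _ _ ↦ by positivity
        have h1 := hy1 i hi
        rw [mem_range, Nat.lt_succ_iff]
        refine Nat.floor_le_of_le ?_
        nlinarith
    _ ≤ ∑ b ∈ range q, 4 * q * ((b + 1 : ℕ) : ℝ)⁻¹ + 2 * X := by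
        rw [sum_range_succ']
        refine add_le_add (sum_le_sum fun b _ ↦ ?_) (by simp)
        rw [← div_eq_mul_inv, div_le_div_iff₀ (by positivity) (by positivity)]
        push_cast
        have : 4 * q * (1 + X * ((b + 1) / (2 * q))) = 4 * q + 2 * X * ((b : ℝ) + 1) := by
          field_simp; ring
        rw [this]
        linarith
    _ ≤ _ := by
        rw [← mul_sum, add_comm]
        have h := harmonic_le_one_add_log q
        rw [harmonic] at h
        push_cast at h ⊢
        gcongr

/-- One block of the sum of geometric majorants along `n * α + θ`. -/
lemma sum_geomMaj_block_le {q : ℕ} {a : ℤ} (hq : 0 < q) (ha : IsCoprime a q) {α : ℝ}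
    (hα : |α - a / q| ≤ 1 / (q : ℝ) ^ 2) (θ : ℝ) {X : ℝ} (hX : 0 ≤ X) (c : ℕ) :
    ∑ n ∈ Ico c (c + (q / 2 + 1)), geomMaj X (n * α + θ) ≤
      2 * (2 * X + 4 * q * (1 + Real.log q)) := by
  have hsep : ∀ i ∈ Ico c (c + (q / 2 + 1)), ∀ j ∈ Ico c (c + (q / 2 + 1)), i ≠ j →
      1 / (2 * q : ℝ) ≤ distInt ((i * α + θ) - (j * α + θ)) := by
    intro i hi j hj hne
    rw [mem_Ico] at hi hj
    have e : (i * α + θ) - (j * α + θ) = (i - j : ℝ) * α := by ring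
    rw [e]
    rcases lt_or_gt_of_ne hne with h | h
    · rw [← distInt_neg, ← neg_mul, neg_sub, ← Nat.cast_sub h.le]
      exact inv_two_mul_le_distInt ha hα (by lia) (by lia)
    · rw [← Nat.cast_sub h.le]
      exact inv_two_mul_le_distInt ha hα (by lia) (by lia)
  rw [← sum_filter_add_sum_filter_not _ fun n : ℕ ↦ (round (n * α + θ) : ℝ) ≤ n * α + θ, two_mul]
  simp only [geomMaj]
  refine add_le_add ?_ ?_
  · refine sum_le_of_pairwise _
      (fun n : ℕ ↦ distInt (n * α + θ)) (fun _ _ ↦ distInt_nonneg _) (fun _ _ ↦ distInt_le_half _)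
      hq (fun i hi j hj hne ↦ ?_) hX
    · rw [mem_filter] at hi hj
      refine (hsep i hi.1 j hj.1 hne).trans ?_
      rw [distInt.eq_1 (i * α + θ), distInt.eq_1 (j * α + θ), abs_of_nonneg (sub_nonneg.mpr hi.2),
        abs_of_nonneg (sub_nonneg.mpr hj.2)]
      refine (distInt_le _ (round (i * α + θ) - round (j * α + θ))).trans (le_of_eq ?_)
      push_cast
      ring_nf
  · refine sum_le_of_pairwise _
      (fun n : ℕ ↦ distInt (n * α + θ)) (fun _ _ ↦ distInt_nonneg _) (fun _ _ ↦ distInt_le_half _)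
      hq (fun i hi j hj hne ↦ ?_) hX
    · rw [mem_filter, not_le] at hi hj
      refine (hsep i hi.1 j hj.1 hne).trans ?_
      rw [distInt.eq_1 (i * α + θ), distInt.eq_1 (j * α + θ), abs_of_neg (sub_neg.mpr hi.2),
        abs_of_neg (sub_neg.mpr hj.2)]
      refine (distInt_le _ (round (i * α + θ) - round (j * α + θ))).trans (le_of_eq ?_)
      rw [← abs_neg]
      push_cast
      ring_nf

lemma sum_range_mul_le {f : ℕ → ℝ} {H : ℕ} {B : ℝ}
    (h : ∀ c, ∑ n ∈ Ico c (c + H), f n ≤ B) (k : ℕ) : ∑ n ∈ range (k * H), f n ≤ k * B := by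
  induction k with
  | zero => simp
  | succ k ih =>
    rw [add_mul, one_mul, range_eq_Ico,
      ← sum_Ico_consecutive _ (Nat.zero_le _) (Nat.le_add_right (k * H) H), ← range_eq_Ico]
    have := h (k * H)
    push_cast
    linarith

lemma geomMaj_nonneg {X : ℝ} (hX : 0 ≤ X) (x : ℝ) : 0 ≤ geomMaj X x := by
  have := distInt_nonneg x
  rw [geomMaj]
  positivity

/-- The sum of geometric majorants along an arithmetic progression whose step has a rational
approximation with denominator `q`. -/
lemma sum_geomMaj_le {q : ℕ} {a : ℤ} (hq : 0 < q) (ha : IsCoprime a q) {α : ℝ}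
    (hα : |α - a / q| ≤ 1 / (q : ℝ) ^ 2) (θ : ℝ) {X : ℝ} (hX : 0 ≤ X) (J : ℕ) :
    ∑ n ∈ range J, geomMaj X (n * α + θ) ≤
      (2 * J / q + 1) * (2 * (2 * X + 4 * q * (1 + Real.log q))) := by
  have hq0 : (0 : ℝ) < q := by exact_mod_cast hq
  have hlog : 0 ≤ Real.log q := Real.log_natCast_nonneg q
  have hsub : range J ⊆ range ((J / (q / 2 + 1) + 1) * (q / 2 + 1)) := by
    refine range_subset_range.mpr ?_
    rw [add_mul, one_mul]
    have := Nat.mod_add_div J (q / 2 + 1)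
    have h2 := Nat.mod_lt J (Nat.succ_pos (q / 2))
    rw [mul_comm] at this
    lia
  refine (sum_le_sum_of_subset_of_nonneg hsub fun _ _ _ ↦ geomMaj_nonneg hX _).trans ?_
  refine (sum_range_mul_le (fun c ↦ sum_geomMaj_block_le hq ha hα θ hX c) _).trans ?_
  refine mul_le_mul_of_nonneg_right ?_ (by positivity)
  push_cast
  gcongr
  refine (Nat.cast_div_le).trans ?_
  rw [div_le_div_iff₀ (by positivity) hq0]
  have : (q : ℝ) ≤ 2 * ((q / 2 + 1 : ℕ) : ℝ) := by exact_mod_cast (by lia : q ≤ 2 * (q / 2 + 1))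
  nlinarith [Nat.cast_nonneg (α := ℝ) J]

/-- A sum of geometric majorants of varying lengths. -/
lemma sum_geomMaj_div_le {q : ℕ} {a : ℤ} (hq : 0 < q) (ha : IsCoprime a q) {α : ℝ}
    (hα : |α - a / q| ≤ 1 / (q : ℝ) ^ 2) {N : ℝ} (hN : 0 ≤ N) {D : ℕ} (hD : D ≤ q) :
    ∑ d ∈ Icc 1 D, geomMaj (N / d) (d * α) ≤ 200 * (N / q + q * (1 + Real.log q)) := by
  have hq0 : (0 : ℝ) < q := by exact_mod_cast hq
  have hlog : 0 ≤ Real.log q := Real.log_natCast_nonneg q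
  have hlt : ∀ d : ℕ, 0 < d → 2 * d ≤ q → geomMaj (N / d) (d * α) ≤ 2 * geomMaj (2 * q) (d * α) := by
    intro d hd hdq
    have h1 := inv_two_mul_le_distInt ha hα hd hdq
    have h0 := distInt_nonneg (d * α)
    have hNd : 0 ≤ N / d := by positivity
    have h2 : 1 ≤ 2 * q * distInt (d * α) := by
      rw [div_le_iff₀ (by positivity)] at h1; linarith
    rw [geomMaj, geomMaj, ← mul_div_assoc 2 (2 * (2 * q : ℝ)), div_le_div_iff₀ (by positivity) (by positivity)]
    nlinarith [mul_nonneg hNd (sub_nonneg.mpr h2)]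
  have hgt : ∀ d : ℕ, q ≤ 2 * d → geomMaj (N / d) (d * α) ≤ geomMaj (2 * N / q) (d * α) := by
    intro d hdq
    have h0 := distInt_nonneg (d * α)
    have hd : (q : ℝ) ≤ 2 * d := by exact_mod_cast hdq
    have hd0 : (0 : ℝ) < d := by linarith
    have hle : N / d ≤ 2 * N / q := by
      rw [div_le_div_iff₀ hd0 hq0]; nlinarith
    have hNd : 0 ≤ N / d := by positivity
    have hNq : 0 ≤ 2 * N / q := by positivity
    rw [geomMaj, geomMaj, div_le_div_iff₀ (by positivity) (by positivity)]
    nlinarith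
  have hsub : Icc 1 D ⊆ range (q + 1) := fun d hd ↦ by simp at hd ⊢; lia
  calc _ ≤ ∑ d ∈ Icc 1 D, (2 * geomMaj (2 * q) (d * α) + geomMaj (2 * N / q) (d * α)) := by
        refine sum_le_sum fun d hd ↦ ?_
        rw [mem_Icc] at hd
        have h1 := geomMaj_nonneg (X := 2 * q) (by positivity) (d * α)
        have h2 := geomMaj_nonneg (X := 2 * N / q) (by positivity) (d * α)
        rcases le_total (2 * d) q with h | h
        · linarith [hlt d hd.1 h]
        · linarith [hgt d h]
    _ ≤ ∑ d ∈ range (q + 1), (2 * geomMaj (2 * q) (d * α + 0) +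
          geomMaj (2 * N / q) (d * α + 0)) := by
        simp only [add_zero]
        refine sum_le_sum_of_subset_of_nonneg hsub fun d _ _ ↦ ?_
        have h1 := geomMaj_nonneg (X := 2 * q) (by positivity) (d * α)
        have h2 := geomMaj_nonneg (X := 2 * N / q) (by positivity) (d * α)
        positivity
    _ ≤ 200 * (N / q + q * (1 + Real.log q)) := by
        rw [sum_add_distrib, ← mul_sum]
        have h1 := sum_geomMaj_le hq ha hα 0 (X := 2 * q) (by positivity) (q + 1)
        have h2 := sum_geomMaj_le hq ha hα 0 (X := 2 * N / q) (by positivity) (q + 1)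
        have h3 : 2 * ((q + 1 : ℕ) : ℝ) / q + 1 ≤ 5 := by
          rw [← le_sub_iff_add_le, div_le_iff₀ hq0]
          have : (1 : ℝ) ≤ q := by exact_mod_cast hq
          push_cast
          linarith
        have h4 := h1.trans (mul_le_mul_of_nonneg_right h3 (by positivity))
        have h5 := h2.trans (mul_le_mul_of_nonneg_right h3 (by positivity))
        have h6 : 0 ≤ q * Real.log q := by positivity
        have h7 : 0 ≤ N / q := by positivity
        rw [mul_div_assoc] at h5 h2
        rw [mul_div_assoc]
        nlinarith

/-- The bilinear (type II) estimate. -/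
lemma sq_norm_sum_bilinear_le {q : ℕ} {a : ℤ} (hq : 0 < q) (ha : IsCoprime a q) {α : ℝ}
    (hα : |α - a / q| ≤ 1 / (q : ℝ) ^ 2) {f g : ℕ → ℂ} {M K : ℕ} (N : ℕ) {L : ℝ} (hL : 0 ≤ L)
    (hf : ∀ m, ‖f m‖ ≤ 1) (hg : ∀ k ∈ Icc 1 K, ‖g k‖ ≤ L) :
    ‖∑ m ∈ Ioc M (2 * M), ∑ k ∈ Icc 1 K with m * k ≤ N, f m * g k * e ((m * k : ℕ) * α)‖ ^ 2 ≤
      M * (L ^ 2 * (K * ((2 * (K + 1 : ℕ) / q + 1) *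
        (2 * (2 * M + 4 * q * (1 + Real.log q)))))) := by
  have hcard : ((Ioc M (2 * M)).card : ℝ) = M := by rw [Nat.card_Ioc]; congr 1; lia
  set G : ℕ → ℂ := fun m ↦ ∑ k ∈ Icc 1 K, if m * k ≤ N then g k * e (m * (k * α)) else 0 with hG
  have h1 : ∀ m, ‖∑ k ∈ Icc 1 K with m * k ≤ N, f m * g k * e ((m * k : ℕ) * α)‖ ≤ ‖G m‖ := by
    intro m
    have : ∑ k ∈ Icc 1 K with m * k ≤ N, f m * g k * e ((m * k : ℕ) * α) = f m * G m := by
      rw [hG, sum_filter, mul_sum]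
      refine sum_congr rfl fun k _ ↦ ?_
      split_ifs
      · rw [Nat.cast_mul, mul_assoc, mul_assoc (m : ℝ)]
      · simp
    rw [this, norm_mul]
    exact mul_le_of_le_one_left (norm_nonneg _) (hf m)
  have h2 : ((∑ m ∈ Ioc M (2 * M), ‖G m‖ ^ 2 : ℝ) : ℂ) = ∑ k ∈ Icc 1 K, ∑ l ∈ Icc 1 K,
      g l * (starRingEnd ℂ) (g k) * ∑ m ∈ Ioc M (2 * M) with m * k ≤ N ∧ m * l ≤ N,
        e (m * (l * α + -(k * α))) := by
    have h : ∀ m, (‖G m‖ : ℂ) ^ 2 = ∑ k ∈ Icc 1 K, ∑ l ∈ Icc 1 K, if m * k ≤ N ∧ m * l ≤ N then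
        g l * (starRingEnd ℂ) (g k) * e (m * (l * α + -(k * α))) else 0 := by
      intro m
      rw [← Complex.conj_mul', hG, map_sum, sum_mul_sum]
      refine sum_congr rfl fun k _ ↦ sum_congr rfl fun l _ ↦ ?_
      split_ifs with h1 h2 h3 h4 h5 <;> try tauto
      · rw [map_mul, conj_e, mul_add, e_add, mul_neg]
        ring
      all_goals simp
    rw [Complex.ofReal_sum, sum_congr rfl fun m _ ↦ (by push_cast; exact h m), sum_comm]
    refine sum_congr rfl fun k _ ↦ ?_
    rw [sum_comm]
    refine sum_congr rfl fun l _ ↦ ?_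
    rw [mul_sum, sum_filter]
  have h3 : ∀ k ∈ Icc 1 K, ∀ l ∈ Icc 1 K, ‖g l * (starRingEnd ℂ) (g k) *
      ∑ m ∈ Ioc M (2 * M) with m * k ≤ N ∧ m * l ≤ N, e (m * (l * α + -(k * α)))‖ ≤
        L ^ 2 * geomMaj M (l * α + -(k * α)) := by
    intro k hk l hl
    rw [norm_mul, norm_mul, RCLike.norm_conj, sq]
    have hset : {m ∈ Ioc M (2 * M) | m * k ≤ N ∧ m * l ≤ N} =
        Ico (M + 1) (min (2 * M) (min (N / k) (N / l)) + 1) := by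
      ext m
      rw [mem_Icc] at hk hl
      simp only [mem_filter, mem_Ioc, mem_Ico, Nat.lt_succ_iff, le_min_iff,
        Nat.le_div_iff_mul_le hk.1, Nat.le_div_iff_mul_le hl.1, Nat.succ_le_iff]
      tauto
    rw [hset]
    refine mul_le_mul (mul_le_mul (hg l hl) (hg k hk) (norm_nonneg _) hL)
      (norm_sum_e_le_geomMaj (Nat.cast_nonneg _) ?_ _) (norm_nonneg _) (by positivity)
    exact_mod_cast (by lia)
  have h4 : ∑ m ∈ Ioc M (2 * M), ‖G m‖ ^ 2 ≤ L ^ 2 * (K * ((2 * (K + 1 : ℕ) / q + 1) *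
      (2 * (2 * M + 4 * q * (1 + Real.log q))))) := by
    have : ∑ m ∈ Ioc M (2 * M), ‖G m‖ ^ 2 = ‖((∑ m ∈ Ioc M (2 * M), ‖G m‖ ^ 2 : ℝ) : ℂ)‖ := by
      rw [Complex.norm_real, Real.norm_of_nonneg (by positivity)]
    rw [this, h2]
    calc _ ≤ ∑ k ∈ Icc 1 K, ∑ l ∈ Icc 1 K, L ^ 2 * geomMaj M (l * α + -(k * α)) :=
          norm_sum_le_of_le _ fun k hk ↦ norm_sum_le_of_le _ fun l hl ↦ h3 k hk l hl
      _ ≤ ∑ k ∈ Icc 1 K, L ^ 2 * ((2 * (K + 1 : ℕ) / q + 1) *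
            (2 * (2 * M + 4 * q * (1 + Real.log q)))) := by
        refine sum_le_sum fun k _ ↦ ?_
        rw [← mul_sum]
        refine mul_le_mul_of_nonneg_left (le_trans ?_ (sum_geomMaj_le hq ha hα (-(k * α))
          (Nat.cast_nonneg M) (K + 1))) (by positivity)
        refine sum_le_sum_of_subset_of_nonneg (fun l hl ↦ ?_)
          fun _ _ _ ↦ geomMaj_nonneg (Nat.cast_nonneg _) _
        simp at hl ⊢
        lia
      _ = _ := by simp; ring
  calc _ ≤ (∑ m ∈ Ioc M (2 * M), ‖G m‖) ^ 2 := by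
        gcongr
        exact norm_sum_le_of_le _ fun m _ ↦ h1 m
    _ ≤ _ := sq_sum_le_card_mul_sum_sq
    _ ≤ _ := by rw [hcard]; gcongr

lemma norm_sum_Icc_e_le {M : ℕ} {X : ℝ} (hX : (M : ℝ) ≤ X) (x : ℝ) :
    ‖∑ m ∈ Icc 1 M, e (m * x)‖ ≤ geomMaj X x :=
  norm_sum_e_le_geomMaj (a := 1) (b := M + 1) ((Nat.cast_nonneg M).trans hX) (by simpa using hX) x

lemma norm_sum_log_mul_e_le {M : ℕ} {X : ℝ} (hX : (M : ℝ) ≤ X) (x : ℝ) :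
    ‖∑ m ∈ Icc 1 M, (Real.log m : ℂ) * e (m * x)‖ ≤ 2 * Real.log M * geomMaj X x := by
  rcases Nat.eq_zero_or_pos M with rfl | hM
  · simp
  have hg := geomMaj_nonneg ((Nat.cast_nonneg M).trans hX) x
  have key := norm_sum_mul_le_of_forall_norm_sum_le (m := 0) (N := M)
    (f := fun m ↦ e (m * x)) (w := fun m ↦ (Real.log m : ℂ)) (D := geomMaj X x) hM
    fun y _ hy ↦ by
      exact norm_sum_Icc_e_le ((Nat.cast_le.mpr hy).trans hX) x
  have htel : ∑ n ∈ Ico (0 + 1) M, ‖(Real.log n : ℂ) - Real.log (n + 1 : ℕ)‖ = Real.log M := by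
    have : ∀ n ∈ Ico (0 + 1) M, ‖(Real.log n : ℂ) - Real.log (n + 1 : ℕ)‖ =
        Real.log (n + 1 : ℕ) - Real.log n := by
      intro n hn
      simp only [mem_Ico] at hn
      rw [← Complex.ofReal_sub, Complex.norm_real, Real.norm_eq_abs, abs_sub_comm, abs_of_nonneg]
      exact sub_nonneg.mpr (Real.log_le_log (by exact_mod_cast (by lia)) (by simp))
    rw [sum_congr rfl this, sum_Ico_eq_sub _ (by lia), sum_range_sub (fun n : ℕ ↦ Real.log n)]
    simp
  rw [htel, Complex.norm_real, Real.norm_of_nonneg (Real.log_natCast_nonneg M)] at key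
  refine le_trans (le_of_eq ?_) (key.trans (le_of_eq (by ring)))
  congr 1
  exact sum_congr rfl fun m _ ↦ mul_comm _ _

lemma sum_dyadic {E : Type*} [AddCommMonoid E] (f : ℕ → E) (U I : ℕ) :
    ∑ m ∈ Ioc U (2 ^ I * U), f m = ∑ i ∈ range I, ∑ m ∈ Ioc (2 ^ i * U) (2 * (2 ^ i * U)), f m := by
  induction I with
  | zero => simp
  | succ I ih =>
    rw [sum_range_succ, ← ih, pow_succ', mul_assoc, sum_Ioc_consecutive _
      (Nat.le_mul_of_pos_left _ (by positivity)) (by lia)]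

lemma sum_mul_apply_mul (f g : ArithmeticFunction ℝ) (N : ℕ) (w : ℕ → ℂ) :
    ∑ n ∈ Icc 1 N, ((f * g) n : ℂ) * w n =
      ∑ m ∈ Icc 1 N, ∑ k ∈ Icc 1 N with m * k ≤ N, (f m : ℂ) * g k * w (m * k) := by
  have h : ∀ n ∈ Icc 1 N, ((f * g) n : ℂ) * w n = ∑ m ∈ Icc 1 N, ∑ k ∈ Icc 1 N,
      if m * k = n then (f m : ℂ) * g k * w (m * k) else 0 := by
    intro n hn
    rw [mem_Icc] at hn
    rw [ArithmeticFunction.mul_apply, Nat.divisorsAntidiagonal_eq_prod_filter_of_le (by lia) hn.2,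
      sum_filter, sum_product]
    push_cast
    rw [sum_mul]
    refine sum_congr (by ext; simp; lia) fun m _ ↦ ?_
    rw [sum_mul]
    refine sum_congr (by ext; simp; lia) fun k _ ↦ ?_
    split_ifs with h
    · rw [← h, Complex.ofReal_mul]
    · simp
  rw [sum_congr rfl h, sum_comm]
  refine sum_congr rfl fun m hm ↦ ?_
  rw [sum_comm, sum_filter]
  refine sum_congr rfl fun k hk ↦ ?_
  rw [mem_Icc] at hm hk
  rw [sum_ite_eq]
  refine if_congr ?_ rfl rfl
  rw [mem_Icc]
  have := Nat.mul_pos hm.1 hk.1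
  exact ⟨fun h ↦ h.2, fun h ↦ ⟨this, h⟩⟩

/-- The restriction of an arithmetic function to an initial segment. -/
noncomputable def truncLE (U : ℕ) (f : ArithmeticFunction ℝ) : ArithmeticFunction ℝ :=
  ⟨fun n ↦ if n ≤ U then f n else 0, by simp⟩

lemma truncLE_apply (U : ℕ) (f : ArithmeticFunction ℝ) (n : ℕ) :
    truncLE U f n = if n ≤ U then f n else 0 := rfl

lemma sub_truncLE_apply (U : ℕ) (f : ArithmeticFunction ℝ) (n : ℕ) :
    (f - truncLE U f) n = if n ≤ U then 0 else f n := by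
  rw [sub_eq_add_neg, ArithmeticFunction.add_apply, ArithmeticFunction.neg_apply, truncLE_apply]
  split_ifs <;> simp

open scoped ArithmeticFunction.zeta ArithmeticFunction.Moebius ArithmeticFunction.vonMangoldt in
/-- Vaughan's identity. -/
lemma vonMangoldt_eq_vaughan (U : ℕ) : Λ = truncLE U Λ + truncLE U (μ : ArithmeticFunction ℝ) * ArithmeticFunction.log -
    truncLE U (μ : ArithmeticFunction ℝ) * truncLE U Λ * (ζ : ArithmeticFunction ℝ) +
    ((μ : ArithmeticFunction ℝ) - truncLE U (μ : ArithmeticFunction ℝ)) *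
      ((Λ - truncLE U Λ) * (ζ : ArithmeticFunction ℝ)) := by
  have h1 : (μ : ArithmeticFunction ℝ) * (ζ : ArithmeticFunction ℝ) = 1 :=
    ArithmeticFunction.coe_moebius_mul_coe_zeta
  have h2 : Λ * (ζ : ArithmeticFunction ℝ) = ArithmeticFunction.log :=
    ArithmeticFunction.vonMangoldt_mul_zeta
  rw [← h2]
  linear_combination (truncLE U Λ - Λ) * h1

open scoped ArithmeticFunction.vonMangoldt in
lemma sum_divisors_vonMangoldt_ite_le (p : ℕ → Prop) [DecidablePred p] (n : ℕ) :
    ∑ d ∈ n.divisors, (if p d then Λ d else 0) ≤ Real.log n := by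
  rw [← ArithmeticFunction.vonMangoldt_sum]
  refine sum_le_sum fun d _ ↦ ?_
  split_ifs
  exacts [le_rfl, ArithmeticFunction.vonMangoldt_nonneg]

open scoped ArithmeticFunction.zeta ArithmeticFunction.vonMangoldt in
lemma abs_sub_truncLE_mul_zeta_le (U n : ℕ) :
    |((Λ - truncLE U Λ) * (ζ : ArithmeticFunction ℝ)) n| ≤ Real.log n := by
  rw [ArithmeticFunction.coe_mul_zeta_apply]
  simp only [sub_truncLE_apply]
  rw [abs_of_nonneg (sum_nonneg fun d _ ↦ by split_ifs <;>
    simp [ArithmeticFunction.vonMangoldt_nonneg])]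
  simpa only [ite_not] using sum_divisors_vonMangoldt_ite_le (fun d ↦ ¬ d ≤ U) n

open scoped ArithmeticFunction.zeta ArithmeticFunction.vonMangoldt in
lemma sub_truncLE_mul_zeta_eq_zero {U n : ℕ} (h : n ≤ U) :
    ((Λ - truncLE U Λ) * (ζ : ArithmeticFunction ℝ)) n = 0 := by
  rw [ArithmeticFunction.coe_mul_zeta_apply]
  refine sum_eq_zero fun d hd ↦ ?_
  rw [sub_truncLE_apply, if_pos ((Nat.divisor_le hd).trans h)]

open scoped ArithmeticFunction.Moebius in
lemma abs_moebius_le_one' (n : ℕ) : |((μ : ArithmeticFunction ℝ) n)| ≤ 1 := by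
  rw [ArithmeticFunction.intCoe_apply]
  exact_mod_cast ArithmeticFunction.abs_moebius_le_one

open scoped ArithmeticFunction.Moebius ArithmeticFunction.vonMangoldt in
lemma abs_truncLE_mul_truncLE_le (U n : ℕ) :
    |(truncLE U (μ : ArithmeticFunction ℝ) * truncLE U Λ) n| ≤ Real.log n := by
  rw [mul_comm, ArithmeticFunction.mul_apply]
  refine (abs_sum_le_sum_abs _ _).trans ?_
  refine le_trans (sum_le_sum fun x _ ↦ ?_)
    (le_trans (le_of_eq (Nat.sum_divisorsAntidiagonal (n := n) fun d _ ↦ if d ≤ U then Λ d else 0))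
    (sum_divisors_vonMangoldt_ite_le (fun d ↦ d ≤ U) n))
  rw [abs_mul, truncLE_apply, truncLE_apply]
  have h1 := abs_moebius_le_one' x.2
  have h2 : |if x.1 ≤ U then Λ x.1 else 0| = if x.1 ≤ U then Λ x.1 else 0 := by
    rw [abs_of_nonneg]
    split_ifs <;> simp [ArithmeticFunction.vonMangoldt_nonneg]
  rw [h2]
  refine mul_le_of_le_one_right (by split_ifs <;> simp [ArithmeticFunction.vonMangoldt_nonneg]) ?_
  split_ifs
  exacts [h1, by simp]

open scoped ArithmeticFunction.Moebius ArithmeticFunction.vonMangoldt in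
lemma truncLE_mul_truncLE_eq_zero {U n : ℕ} (h : U * U < n) :
    (truncLE U (μ : ArithmeticFunction ℝ) * truncLE U Λ) n = 0 := by
  rw [ArithmeticFunction.mul_apply]
  refine sum_eq_zero fun x hx ↦ ?_
  rw [truncLE_apply, truncLE_apply]
  have hx := (Nat.mem_divisorsAntidiagonal.mp hx).1
  split_ifs with h1 h2
  · have := Nat.mul_le_mul h1 h2
    lia
  all_goals simp

lemma filter_mul_le_eq_Icc {m N : ℕ} (hm : 1 ≤ m) : {k ∈ Icc 1 N | m * k ≤ N} = Icc 1 (N / m) := by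
  ext k
  rw [mem_filter, mem_Icc, mem_Icc, Nat.le_div_iff_mul_le hm, mul_comm k]
  have : k ≤ m * k := Nat.le_mul_of_pos_left k hm
  constructor
  · tauto
  · intro h; exact ⟨⟨h.1, by lia⟩, h.2⟩

/-- Type I sums with smooth weight `1`. -/
lemma norm_sum_mul_zeta_le (f : ArithmeticFunction ℝ) {D N : ℕ} (hDN : D ≤ N) {q : ℕ} {a : ℤ}
    (hq : 0 < q) (ha : IsCoprime a q) {α : ℝ} (hα : |α - a / q| ≤ 1 / (q : ℝ) ^ 2) (hD0 : 0 < D)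
    (hD : D ≤ q)     {L : ℝ} (hf : ∀ d ∈ Icc 1 D, |f d| ≤ L) (hf0 : ∀ d, D < d → f d = 0)
    (g : ArithmeticFunction ℝ) {T : ℝ} (hT : 0 ≤ T)
    (hg : ∀ M ≤ N, ∀ x X : ℝ, (M : ℝ) ≤ X → ‖∑ m ∈ Icc 1 M, (g m : ℂ) * e (m * x)‖ ≤
      T * geomMaj X x) :
    ‖∑ n ∈ Icc 1 N, ((f * g) n : ℂ) * e (n * α)‖ ≤
      L * (T * (200 * (N / q + q * (1 + Real.log q)))) := by
  rw [sum_mul_apply_mul f g N fun n ↦ e (n * α)]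
  have h1 : ∀ m ∈ Icc 1 N, ∑ k ∈ Icc 1 N with m * k ≤ N, (f m : ℂ) * g k * e ((m * k : ℕ) * α) =
      f m * ∑ k ∈ Icc 1 (N / m), (g k : ℂ) * e (k * (m * α)) := by
    intro m hm
    rw [filter_mul_le_eq_Icc (mem_Icc.mp hm).1, mul_sum]
    refine sum_congr rfl fun k _ ↦ ?_
    rw [mul_assoc]
    congr 3
    push_cast
    ring
  rw [sum_congr rfl h1, ← sum_subset (Icc_subset_Icc_right hDN)]
  · calc _ ≤ ∑ m ∈ Icc 1 D, L * (T * geomMaj (N / m) (m * α)) := by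
          refine norm_sum_le_of_le _ fun m hm ↦ ?_
          rw [norm_mul, Complex.norm_real, Real.norm_eq_abs]
          refine mul_le_mul (hf m hm) (hg _ (Nat.div_le_self _ _) _ _ Nat.cast_div_le)
            (norm_nonneg _) ((abs_nonneg _).trans (hf m hm))
      _ ≤ _ := by
        rw [← mul_sum, ← mul_sum]
        have hL := (abs_nonneg _).trans (hf 1 (by simp; lia))
        gcongr
        exact sum_geomMaj_div_le hq ha hα (Nat.cast_nonneg N) hD
  · intro m hm hm'
    rw [mem_Icc] at hm hm'
    rw [hf0 m (by lia)]
    simp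

lemma natLog_two_add_one_le {N : ℕ} (hN : 3 ≤ N) (hL : 1 ≤ Real.log N) :
    ((Nat.log 2 N + 1 : ℕ) : ℝ) ≤ 3 * Real.log N := by
  have h := Real.natLog_le_logb N 2
  have h2 := Real.log_two_gt_d9
  rw [Real.logb, Nat.cast_ofNat] at h
  have h3 : Real.log N / Real.log 2 ≤ 2 * Real.log N := by
    rw [div_le_iff₀ (by linarith)]
    nlinarith
  push_cast
  linarith

lemma bilinear_block_bound {M K N U q L l : ℝ} (hU : 1 ≤ U) (hUq : U ^ 2 ≤ q)
    (hqN : q * U ^ 2 ≤ N) (hL : 1 ≤ L) (hl : 0 ≤ l) (hlL : l ≤ L) (hMK : M * K ≤ N) (hUK : U ≤ K)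
    (hUM : U ≤ M) :
    (2 * (K + 1) / q + 1) * (2 * (2 * M + 4 * q * (1 + l))) ≤ 100 * (N / U) * L ^ 2 := by
  have hU0 : 0 < U := by linarith
  have hUq1 : U ≤ q := by nlinarith
  have hq : 0 < q := by linarith
  have hN : 0 < N := lt_of_lt_of_le (by positivity) hqN
  have hK0 : 0 < K := by linarith
  have hM0 : 0 < M := by linarith
  have hKN : K ≤ N / U := by
    rw [le_div_iff₀ hU0]
    nlinarith
  have hMN : M ≤ N / U := by
    rw [le_div_iff₀ hU0]
    nlinarith
  have hqN1 : q ≤ N / U := by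
    rw [le_div_iff₀ hU0]
    nlinarith
  have h3 : M * K / q ≤ N / U := div_le_div₀ hN.le hMK hU0 hUq1
  have hNU : 0 ≤ N / U := by positivity
  calc _ ≤ (4 * K / q + 1) * (4 * M + 16 * q * L) := by
        refine mul_le_mul (add_le_add_left (div_le_div_of_nonneg_right (by linarith) hq.le) _)
          ?_ (by positivity) (by positivity)
        nlinarith
    _ = 16 * (M * K / q) + 64 * (K * L) + 4 * M + 16 * (q * L) := by
        field_simp
        ring
    _ ≤ 16 * (N / U) + 64 * (N / U * L) + 4 * (N / U) + 16 * (N / U * L) := by gcongr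
    _ ≤ _ := by
        have e3 : N / U * L ≤ N / U * L ^ 2 := mul_le_mul_of_nonneg_left (by nlinarith) hNU
        have e4 : N / U ≤ N / U * L := le_mul_of_one_le_right hNU hL
        linarith

/-- A dyadic block of the type II sum. -/
lemma norm_sum_bilinear_block_le {N U q : ℕ} (hL : 1 ≤ Real.log N) (hU : 1 ≤ U) (hUq : U ^ 2 ≤ q)
    (hqN : q * U ^ 2 ≤ N) {a : ℤ} (ha : IsCoprime a q) {α : ℝ}
    (hα : |α - a / q| ≤ 1 / (q : ℝ) ^ 2) {f g : ℕ → ℂ} (hf : ∀ m, ‖f m‖ ≤ 1)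
    (hg : ∀ k ∈ Icc 1 N, ‖g k‖ ≤ Real.log N) (hg0 : ∀ k ≤ U, g k = 0) {M : ℕ} (hM : U ≤ M) :
    ‖∑ m ∈ Ioc M (2 * M), ∑ k ∈ Icc 1 N with m * k ≤ N, f m * g k * e ((m * k : ℕ) * α)‖ ≤
      10 * (N * Real.log N ^ 2 / √U) := by
  have hU0 : (0 : ℝ) < U := by exact_mod_cast hU
  have hq : 0 < q := by nlinarith
  have hq0 : (0 : ℝ) < q := by exact_mod_cast hq
  have hM0 : 0 < M := by lia
  have hset : ∀ m ∈ Ioc M (2 * M), {k ∈ Icc 1 N | m * k ≤ N} = {k ∈ Icc 1 (N / M) | m * k ≤ N} := by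
    intro m hm
    ext k
    rw [mem_Ioc] at hm
    rw [mem_filter, mem_filter, mem_Icc, mem_Icc, Nat.le_div_iff_mul_le hM0]
    constructor
    · rintro ⟨⟨h1, h2⟩, h3⟩
      exact ⟨⟨h1, by nlinarith⟩, h3⟩
    · rintro ⟨⟨h1, h2⟩, h3⟩
      exact ⟨⟨h1, by nlinarith⟩, h3⟩
  rw [sum_congr rfl fun m hm ↦ by rw [hset m hm]]
  set K := N / M with hK
  have hKN : K ≤ N := Nat.div_le_self _ _
  rcases le_or_gt K U with h | h
  · rw [sum_eq_zero]
    · simp; positivity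
    · intro m _
      refine sum_eq_zero fun k hk ↦ ?_
      rw [mem_filter, mem_Icc] at hk
      rw [hg0 k (by lia)]
      simp
  have key := sq_norm_sum_bilinear_le hq ha hα (f := f) (g := g) (M := M) (K := K) N
    (L := Real.log N) (by linarith) hf fun k hk ↦ hg k (by simp at hk ⊢; lia)
  refine (pow_le_pow_iff_left₀ (norm_nonneg _) (by positivity) two_ne_zero).mp (key.trans ?_)
  have hMK : (M : ℝ) * K ≤ N := by exact_mod_cast Nat.mul_div_le N M
  have hqN1 : q ≤ N := (Nat.le_mul_of_pos_right q (by positivity)).trans hqN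
  have hsq : (10 * (N * Real.log N ^ 2 / √U)) ^ 2 =
      N * (Real.log N ^ 2 * (100 * (N / U) * Real.log N ^ 2)) := by
    rw [mul_pow, div_pow, Real.sq_sqrt hU0.le]
    ring
  rw [hsq, mul_left_comm (Real.log N ^ 2), ← mul_assoc (M : ℝ)]
  refine mul_le_mul hMK (mul_le_mul_of_nonneg_left ?_ (by positivity))
    (by have := Real.log_natCast_nonneg q; positivity) (by positivity)
  push_cast
  exact bilinear_block_bound (by exact_mod_cast hU) (by exact_mod_cast hUq)
    (by exact_mod_cast hqN) hL (Real.log_natCast_nonneg q)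
    (Real.log_le_log hq0 (by exact_mod_cast hqN1)) hMK (by exact_mod_cast h.le)
    (by exact_mod_cast hM)

/-- Type II sums. -/
lemma norm_sum_typeII_le {N U q : ℕ} (hN : 3 ≤ N) (hL : 1 ≤ Real.log N) (hU : 1 ≤ U)
    (hUq : U ^ 2 ≤ q) (hqN : q * U ^ 2 ≤ N) {a : ℤ} (ha : IsCoprime a q) {α : ℝ}
    (hα : |α - a / q| ≤ 1 / (q : ℝ) ^ 2) {f g : ArithmeticFunction ℝ} (hf : ∀ m, |f m| ≤ 1)
    (hf0 : ∀ m ≤ U, f m = 0)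
    (hg : ∀ k ∈ Icc 1 N, |g k| ≤ Real.log N) (hg0 : ∀ k ≤ U, g k = 0) :
    ‖∑ n ∈ Icc 1 N, ((f * g) n : ℂ) * e (n * α)‖ ≤ 30 * (N * Real.log N ^ 3 / √U) := by
  rw [sum_mul_apply_mul f g N fun n ↦ e (n * α)]
  set I := Nat.log 2 N + 1
  have hI : N < 2 ^ I * U := (Nat.lt_pow_succ_log_self one_lt_two N).trans_le
    (Nat.le_mul_of_pos_right _ hU)
  have h1 : ∑ m ∈ Icc 1 N, ∑ k ∈ Icc 1 N with m * k ≤ N, (f m : ℂ) * g k * e ((m * k : ℕ) * α) =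
      ∑ m ∈ Ioc U (2 ^ I * U), ∑ k ∈ Icc 1 N with m * k ≤ N,
        (f m : ℂ) * g k * e ((m * k : ℕ) * α) := by
    have hsub : Icc 1 N ⊆ Icc 1 (2 ^ I * U) := Icc_subset_Icc_right hI.le
    rw [sum_subset hsub]
    · refine (sum_subset (fun m hm ↦ by simp at hm ⊢; lia) fun m hm hm' ↦ ?_).symm
      rw [mem_Icc] at hm
      rw [mem_Ioc] at hm'
      simp [hf0 m (by lia)]
    · intro m hm hm'
      rw [mem_Icc] at hm hm'
      rw [filter_false_of_mem, sum_empty]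
      intro k hk
      rw [mem_Icc] at hk
      have : N < m := by lia
      nlinarith
  rw [h1, sum_dyadic]
  have hU0 : (0 : ℝ) < U := by exact_mod_cast hU
  refine (norm_sum_le _ _).trans ((sum_le_card_nsmul _ _ (10 * (N * Real.log N ^ 2 / √U))
    fun i _ ↦ ?_).trans ?_)
  · refine norm_sum_bilinear_block_le hL hU hUq hqN ha hα (f := fun m ↦ (f m : ℂ))
      (g := fun m ↦ (g m : ℂ)) ?_ ?_ ?_ (Nat.le_mul_of_pos_left _ (by positivity))
    · simpa using hf
    · simpa using hg
    · simpa using hg0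
  · rw [card_range, nsmul_eq_mul]
    refine (mul_le_mul_of_nonneg_right (natLog_two_add_one_le hN hL) (by positivity)).trans
      (le_of_eq (by ring))

/-- Exponential sums over primes on the minor arcs. -/
theorem norm_sum_vonMangoldt_e_le {N U q : ℕ} (hN : 3 ≤ N) (hU : 1 ≤ U)
    (hUq : U ^ 2 ≤ q) (hqN : q * U ^ 2 ≤ N) {a : ℤ} (ha : IsCoprime a q) {α : ℝ}
    (hα : |α - a / q| ≤ 1 / (q : ℝ) ^ 2) :
    ‖∑ n ∈ Icc 1 N, (ArithmeticFunction.vonMangoldt n : ℂ) * e (n * α)‖ ≤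
      2500 * (N * Real.log N ^ 3 / √U) := by
  have hL : 1 ≤ Real.log N := by
    rw [Real.le_log_iff_exp_le (by positivity)]
    have : (3 : ℝ) ≤ N := by exact_mod_cast hN
    linarith [Real.exp_one_lt_d9]
  have hlog0 : 0 ≤ Real.log N := by linarith
  have hU0 : (1 : ℝ) ≤ U := by exact_mod_cast hU
  have hq : 0 < q := by nlinarith
  have hq0 : (0 : ℝ) < q := by exact_mod_cast hq
  have hU2 : U ^ 2 ≤ N := by nlinarith
  have hUU : U ≤ U ^ 2 := by nlinarith
  have hqN1 : q ≤ N := (Nat.le_mul_of_pos_right q (by positivity)).trans hqN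
  have hlog : ∀ n ∈ Icc 1 N, Real.log n ≤ Real.log N := fun n hn ↦ by
    rw [mem_Icc] at hn
    exact Real.log_le_log (by exact_mod_cast hn.1) (by exact_mod_cast hn.2)
  have hsqrt : √U ≤ U := Real.sqrt_le_iff.mpr ⟨by linarith, by nlinarith⟩
  have hsqrt0 : 0 < √U := Real.sqrt_pos.mpr (by linarith)
  have hB : (N : ℝ) / q + q * (1 + Real.log q) ≤ 3 * (N * Real.log N / √U) := by
    have hqN' : (q : ℝ) * U ^ 2 ≤ N := by exact_mod_cast hqN
    have hUq' : (U : ℝ) ^ 2 ≤ q := by exact_mod_cast hUq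
    have hlq : Real.log q ≤ Real.log N := hlog q (by rw [mem_Icc]; exact ⟨hq, hqN1⟩)
    have hUU' : (U : ℝ) ≤ U ^ 2 := by exact_mod_cast hUU
    have e1 : (N : ℝ) / q ≤ N / √U :=
      div_le_div_of_nonneg_left (Nat.cast_nonneg N) hsqrt0 (by linarith)
    have e2 : (q : ℝ) ≤ N / √U := by
      rw [le_div_iff₀ hsqrt0]
      exact (mul_le_mul_of_nonneg_left (hsqrt.trans hUU') hq0.le).trans hqN'
    have e3 : 0 ≤ (N : ℝ) / √U := by positivity
    have e4 : q * Real.log q ≤ N / √U * Real.log N :=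
      mul_le_mul e2 hlq (Real.log_natCast_nonneg q) e3
    have e5 : (N : ℝ) / √U ≤ N / √U * Real.log N := le_mul_of_one_le_right e3 hL
    rw [mul_div_right_comm]
    linarith
  have h0 : ‖∑ n ∈ Icc 1 N, (truncLE U ArithmeticFunction.vonMangoldt n : ℂ) * e (n * α)‖ ≤
      N * Real.log N / √U := by
    have hUN : (U : ℝ) ^ 2 ≤ N := by exact_mod_cast hU2
    rw [← sum_subset (Icc_subset_Icc_right (by lia : U ≤ N))]
    · refine (norm_sum_le _ _).trans ((sum_le_card_nsmul _ _ (Real.log N) fun n hn ↦ ?_).trans ?_)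
      · rw [norm_mul, norm_e, mul_one, Complex.norm_real, truncLE_apply,
          if_pos (mem_Icc.mp hn).2, Real.norm_of_nonneg ArithmeticFunction.vonMangoldt_nonneg]
        exact ArithmeticFunction.vonMangoldt_le_log.trans (hlog n (by simp at hn ⊢; lia))
      · rw [Nat.card_Icc, nsmul_eq_mul, Nat.add_sub_cancel, mul_div_right_comm]
        refine mul_le_mul_of_nonneg_right ?_ hlog0
        rw [le_div_iff₀ hsqrt0]
        nlinarith
    · intro n hn hn'
      rw [mem_Icc] at hn hn'
      rw [truncLE_apply, if_neg (by lia)]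
      simp
  have h1 := norm_sum_mul_zeta_le (truncLE U (ArithmeticFunction.moebius : ArithmeticFunction ℝ))
    (D := U) (N := N) (by lia) hq ha hα (by lia) (by lia) (L := 1)
    (fun d _ ↦ by
      rw [truncLE_apply]
      split_ifs
      exacts [abs_moebius_le_one' d, by simp])
    (fun d hd ↦ by rw [truncLE_apply, if_neg (by lia)]) ArithmeticFunction.log
    (T := 2 * Real.log N) (by positivity) fun M hM x X hX ↦ by
      refine (norm_sum_log_mul_e_le hX x).trans ?_
      refine mul_le_mul_of_nonneg_right (mul_le_mul_of_nonneg_left ?_ zero_le_two)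
        (geomMaj_nonneg ((Nat.cast_nonneg M).trans hX) x)
      rcases Nat.eq_zero_or_pos M with rfl | hM0
      · simpa using hlog0
      · exact hlog M (by simp; lia)
  have h2 := norm_sum_mul_zeta_le (truncLE U (ArithmeticFunction.moebius : ArithmeticFunction ℝ) *
      truncLE U ArithmeticFunction.vonMangoldt)
    (D := U ^ 2) (N := N) hU2 hq ha hα (by positivity) hUq (L := Real.log N)
    (fun d hd ↦ (abs_truncLE_mul_truncLE_le U d).trans (hlog d (by simp at hd ⊢; lia)))
    (fun d hd ↦ truncLE_mul_truncLE_eq_zero (by nlinarith))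
    (ArithmeticFunction.zeta : ArithmeticFunction ℝ) (T := 1) zero_le_one fun M hM x X hX ↦ by
      refine le_trans (le_of_eq ?_) ((norm_sum_Icc_e_le hX x).trans (one_mul _).ge)
      congr 1
      refine sum_congr rfl fun m hm ↦ ?_
      rw [mem_Icc] at hm
      rw [ArithmeticFunction.natCoe_apply, ArithmeticFunction.zeta_apply_ne (by lia)]
      simp
  have h3 := norm_sum_typeII_le hN hL hU hUq hqN ha hα
    (f := (ArithmeticFunction.moebius : ArithmeticFunction ℝ) -
      truncLE U (ArithmeticFunction.moebius : ArithmeticFunction ℝ))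
    (g := (ArithmeticFunction.vonMangoldt - truncLE U ArithmeticFunction.vonMangoldt) *
      (ArithmeticFunction.zeta : ArithmeticFunction ℝ))
    (fun m ↦ by
      rw [sub_truncLE_apply]
      split_ifs
      exacts [by simp, abs_moebius_le_one' m])
    (fun m hm ↦ by rw [sub_truncLE_apply, if_pos hm])
    (fun k hk ↦ (abs_sub_truncLE_mul_zeta_le U k).trans (hlog k hk))
    (fun k hk ↦ sub_truncLE_mul_zeta_eq_zero hk)
  have hid := vonMangoldt_eq_vaughan U
  have hsum : ∑ n ∈ Icc 1 N, (ArithmeticFunction.vonMangoldt n : ℂ) * e (n * α) =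
      ∑ n ∈ Icc 1 N, (truncLE U ArithmeticFunction.vonMangoldt n : ℂ) * e (n * α) +
      ∑ n ∈ Icc 1 N, ((truncLE U (ArithmeticFunction.moebius : ArithmeticFunction ℝ) *
        ArithmeticFunction.log) n : ℂ) * e (n * α) -
      ∑ n ∈ Icc 1 N, ((truncLE U (ArithmeticFunction.moebius : ArithmeticFunction ℝ) *
        truncLE U ArithmeticFunction.vonMangoldt *
        (ArithmeticFunction.zeta : ArithmeticFunction ℝ)) n : ℂ) * e (n * α) +
      ∑ n ∈ Icc 1 N, ((((ArithmeticFunction.moebius : ArithmeticFunction ℝ) -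
        truncLE U (ArithmeticFunction.moebius : ArithmeticFunction ℝ)) *
        ((ArithmeticFunction.vonMangoldt - truncLE U ArithmeticFunction.vonMangoldt) *
        (ArithmeticFunction.zeta : ArithmeticFunction ℝ))) n : ℂ) * e (n * α) := by
    rw [← sum_add_distrib, ← sum_sub_distrib, ← sum_add_distrib]
    refine sum_congr rfl fun n _ ↦ ?_
    rw [← add_mul, ← sub_mul, ← add_mul]
    congr 1
    have := congrArg (fun F : ArithmeticFunction ℝ ↦ F n) hid
    simp only [sub_eq_add_neg, ArithmeticFunction.add_apply, ArithmeticFunction.neg_apply] at this ⊢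
    exact_mod_cast this
  rw [hsum]
  refine (norm_add_le _ _).trans ?_
  have hX : 0 ≤ N * Real.log N / √U := by positivity
  have e1 : N * Real.log N ^ 3 / √U = Real.log N ^ 2 * (N * Real.log N / √U) := by ring
  have hT := (norm_sub_le _ _).trans (add_le_add ((norm_add_le _ _).trans (add_le_add h0 h1)) h2)
  refine (add_le_add hT h3).trans ?_
  rw [e1] at *
  generalize N * Real.log N / √U = X at *
  generalize (N : ℝ) / q + q * (1 + Real.log q) = B at *
  generalize Real.log N = L at *
  have f1 : L * B ≤ L * (3 * X) := mul_le_mul_of_nonneg_left hB hlog0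
  have f2 : L * X ≤ L ^ 2 * X := mul_le_mul_of_nonneg_right (by nlinarith) hX
  have f3 : X ≤ L * X := le_mul_of_one_le_left hX hL
  linarith

/-- The exponential polynomial with coefficients `f` on `[1, N]`. -/
noncomputable def expSum (N : ℕ) (f : ℕ → ℂ) (α : ℝ) : ℂ := ∑ n ∈ Icc 1 N, f n * e (n * α)

/-- The weighted number of representations of `N` as a sum of three positive integers. -/
noncomputable def repSum (N : ℕ) (f g h : ℕ → ℂ) : ℂ :=
  ∑ a ∈ Icc 1 N, ∑ b ∈ Icc 1 N, ∑ c ∈ Icc 1 N, if a + b + c = N then f a * g b * h c else 0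

lemma sum_norm_sq_expSum {N : ℕ} (hN : 0 < N) (f : ℕ → ℂ) :
    ∑ k ∈ range (3 * N), ‖expSum N f (k / (3 * N : ℕ))‖ ^ 2 =
      (3 * N : ℕ) * ∑ n ∈ Icc 1 N, ‖f n‖ ^ 2 := by
  have hM : ((3 * N : ℕ) : ℝ) ≠ 0 := by positivity
  have hconj : ∀ k : ℕ, ∀ n ∈ Icc 1 N, (starRingEnd ℂ) (e (n * (k / (3 * N : ℕ)))) =
      e ((3 * N - n : ℕ) * (k / (3 * N : ℕ))) := by
    intro k n hn
    rw [mem_Icc] at hn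
    rw [conj_e, Nat.cast_sub (by lia), sub_mul, mul_div_cancel₀ _ hM, sub_eq_add_neg, add_comm,
      ← Int.cast_natCast k, e_add_intCast]
  have horth : ∀ m ∈ Icc 1 N, ∀ n ∈ Icc 1 N, ∑ k ∈ range (3 * N), e (m * (k / (3 * N : ℕ))) *
      (starRingEnd ℂ) (e (n * (k / (3 * N : ℕ)))) = if m = n then ((3 * N : ℕ) : ℂ) else 0 := by
    intro m hm n hn
    have h1 : ∀ k : ℕ, e (m * (k / (3 * N : ℕ))) * (starRingEnd ℂ) (e (n * (k / (3 * N : ℕ)))) =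
        e (k * ((m + (3 * N - n) : ℕ) / (3 * N : ℕ))) := by
      intro k
      rw [hconj k n hn, ← e_add, Nat.cast_add]
      congr 1
      ring
    simp only [h1]
    rw [sum_range_e_mul_div (by lia)]
    refine if_congr ?_ rfl rfl
    rw [mem_Icc] at hm hn
    constructor
    · rintro ⟨k, hk⟩
      have h3 : k < 2 := by
        by_contra! h4
        have := Nat.mul_le_mul_left (3 * N) h4
        lia
      interval_cases k <;> lia
    · intro h3
      exact ⟨1, by lia⟩
  have h : ((∑ k ∈ range (3 * N), ‖expSum N f (k / (3 * N : ℕ))‖ ^ 2 : ℝ) : ℂ) =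
      ((3 * N : ℕ) * ∑ n ∈ Icc 1 N, ‖f n‖ ^ 2 : ℝ) := by
    push_cast
    simp only [← Complex.mul_conj', expSum, map_sum, sum_mul_sum, map_mul]
    rw [sum_comm, mul_sum]
    refine sum_congr rfl fun m hm ↦ ?_
    rw [sum_comm]
    have h2 : ∀ n ∈ Icc 1 N, ∑ k ∈ range (3 * N), f m * e (m * (k / (3 * N))) *
        ((starRingEnd ℂ) (f n) * (starRingEnd ℂ) (e (n * (k / (3 * N))))) =
        f m * (starRingEnd ℂ) (f n) * if m = n then ((3 * N : ℕ) : ℂ) else 0 := by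
      intro n hn
      rw [← horth m hm n hn, mul_sum]
      refine sum_congr rfl fun k _ ↦ ?_
      push_cast
      ring
    rw [sum_congr rfl h2]
    simp only [mul_ite, mul_zero]
    rw [sum_ite_eq, if_pos hm]
    push_cast
    ring
  exact_mod_cast h

lemma sum_expSum_mul {N : ℕ} (hN : 0 < N) (f g h : ℕ → ℂ) :
    ∑ k ∈ range (3 * N), expSum N f (k / (3 * N : ℕ)) * expSum N g (k / (3 * N : ℕ)) *
      expSum N h (k / (3 * N : ℕ)) * e ((2 * N : ℕ) * (k / (3 * N : ℕ))) =
      (3 * N : ℕ) * repSum N f g h := by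
  have h1 : ∀ k : ℕ, expSum N f (k / (3 * N : ℕ)) * expSum N g (k / (3 * N : ℕ)) *
      expSum N h (k / (3 * N : ℕ)) * e ((2 * N : ℕ) * (k / (3 * N : ℕ))) =
      ∑ a ∈ Icc 1 N, ∑ b ∈ Icc 1 N, ∑ c ∈ Icc 1 N,
        f a * g b * h c * e (k * ((a + b + c + 2 * N : ℕ) / (3 * N : ℕ))) := by
    intro k
    rw [expSum, expSum, expSum, sum_mul_sum, sum_mul, sum_mul]
    refine sum_congr rfl fun a _ ↦ ?_
    rw [sum_mul, sum_mul]
    refine sum_congr rfl fun b _ ↦ ?_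
    rw [mul_sum, sum_mul]
    refine sum_congr rfl fun c _ ↦ ?_
    have : (k : ℝ) * ((a + b + c + 2 * N : ℕ) / (3 * N : ℕ)) = a * (k / (3 * N : ℕ)) +
        b * (k / (3 * N : ℕ)) + c * (k / (3 * N : ℕ)) + (2 * N : ℕ) * (k / (3 * N : ℕ)) := by
      push_cast
      ring
    rw [this, e_add, e_add, e_add]
    ring
  simp only [h1]
  rw [sum_comm, repSum, mul_sum]
  refine sum_congr rfl fun a ha ↦ ?_
  rw [sum_comm, mul_sum]
  refine sum_congr rfl fun b hb ↦ ?_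
  rw [sum_comm, mul_sum]
  refine sum_congr rfl fun c hc ↦ ?_
  rw [mem_Icc] at ha hb hc
  have h2 : 3 * N ∣ a + b + c + 2 * N ↔ a + b + c = N := by
    constructor
    · rintro ⟨k, hk⟩
      have h3 : k < 2 := by
        by_contra! h4
        nlinarith
      interval_cases k <;> lia
    · intro h3
      exact ⟨1, by lia⟩
  rw [← mul_sum, sum_range_e_mul_div (by lia)]
  simp only [h2]
  split_ifs
  · ring
  · simp

/-- Comparison of two ternary representation counts through the uniform norm of a difference of
exponential sums. -/
theorem norm_repSum_sub_repSum_le {N : ℕ} (hN : 0 < N) (f g : ℕ → ℂ) {B : ℝ}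
    (hB : ∀ α : ℝ, ‖expSum N f α - expSum N g α‖ ≤ B) :
    ‖repSum N f f f - repSum N g g g‖ ≤
      3 / 2 * B * (∑ n ∈ Icc 1 N, ‖f n‖ ^ 2 + ∑ n ∈ Icc 1 N, ‖g n‖ ^ 2) := by
  have hM : (0 : ℝ) < (3 * N : ℕ) := by positivity
  have h1 : ((3 * N : ℕ) : ℂ) * (repSum N f f f - repSum N g g g) =
      ∑ k ∈ range (3 * N), (expSum N f (k / (3 * N : ℕ)) - expSum N g (k / (3 * N : ℕ))) *
        (expSum N f (k / (3 * N : ℕ)) ^ 2 + expSum N f (k / (3 * N : ℕ)) *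
          expSum N g (k / (3 * N : ℕ)) + expSum N g (k / (3 * N : ℕ)) ^ 2) *
        e ((2 * N : ℕ) * (k / (3 * N : ℕ))) := by
    rw [mul_sub, ← sum_expSum_mul hN, ← sum_expSum_mul hN, ← sum_sub_distrib]
    exact sum_congr rfl fun k _ ↦ by ring
  have hB0 : 0 ≤ B := (norm_nonneg _).trans (hB 0)
  have h2 : ((3 * N : ℕ) : ℝ) * ‖repSum N f f f - repSum N g g g‖ ≤
      ∑ k ∈ range (3 * N), B * (3 / 2 * (‖expSum N f (k / (3 * N : ℕ))‖ ^ 2 +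
        ‖expSum N g (k / (3 * N : ℕ))‖ ^ 2)) := by
    have h3 : ((3 * N : ℕ) : ℝ) * ‖repSum N f f f - repSum N g g g‖ =
        ‖((3 * N : ℕ) : ℂ) * (repSum N f f f - repSum N g g g)‖ := by
      rw [norm_mul, Complex.norm_natCast]
    rw [h3, h1]
    refine norm_sum_le_of_le _ fun k _ ↦ ?_
    rw [norm_mul, norm_e, mul_one, norm_mul]
    refine mul_le_mul (hB _) ?_ (norm_nonneg _) hB0
    refine (norm_add₃_le).trans ?_
    rw [norm_pow, norm_mul, norm_pow]
    nlinarith [sq_nonneg (‖expSum N f (k / (3 * N : ℕ))‖ - ‖expSum N g (k / (3 * N : ℕ))‖)]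
  rw [← mul_sum, ← mul_sum, sum_add_distrib, sum_norm_sq_expSum hN, sum_norm_sq_expSum hN] at h2
  refine le_of_mul_le_mul_left (h2.trans (le_of_eq ?_)) hM
  ring

lemma norm_sum_Icc_e_le_inv {δ : ℝ} (hδ : 0 < δ) (N : ℕ) {x : ℝ} (hx : δ ≤ distInt x) :
    ‖∑ n ∈ Icc 1 N, e (n * x)‖ ≤ 1 / (2 * δ) := by
  have h := norm_sum_e_mul_distInt_le 1 (N + 1) x
  change ‖∑ n ∈ Icc 1 N, e (n * x)‖ * distInt x ≤ 1 / 2 at h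
  rw [le_div_iff₀ (by positivity)]
  nlinarith [norm_nonneg (∑ n ∈ Icc 1 N, e (n * x))]

lemma repSum_swap_left (N : ℕ) (f g h : ℕ → ℂ) : repSum N f g h = repSum N g f h := by
  rw [repSum, repSum, sum_comm]
  refine sum_congr rfl fun b _ ↦ sum_congr rfl fun a _ ↦ sum_congr rfl fun c _ ↦ ?_
  rw [add_comm a b, mul_comm (f a)]

lemma repSum_swap_right (N : ℕ) (f g h : ℕ → ℂ) : repSum N f g h = repSum N f h g := by
  rw [repSum, repSum]
  refine sum_congr rfl fun a _ ↦ ?_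
  rw [sum_comm]
  refine sum_congr rfl fun c _ ↦ sum_congr rfl fun b _ ↦ ?_
  rw [add_right_comm, mul_right_comm]

lemma norm_repSum_e_le {δ : ℝ} (hδ : 0 < δ) (N : ℕ) {x y : ℝ} (z : ℝ) (hxy : δ ≤ distInt (x - y)) :
    ‖repSum N (fun n ↦ e (n * x)) (fun n ↦ e (n * y)) (fun n ↦ e (n * z))‖ ≤
      N * (1 / (2 * δ)) := by
  rw [repSum_swap_right, repSum_swap_left, repSum]
  refine (norm_sum_le _ _).trans ((sum_le_card_nsmul _ _ (1 / (2 * δ)) fun c hc ↦ ?_).trans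
    (le_of_eq (by simp)))
  have h1 : ∀ a ∈ Icc 1 N, (∑ b ∈ Icc 1 N, if c + a + b = N then
      e (c * z) * e (a * x) * e (b * y) else 0) =
      if a ∈ Icc 1 (N - c - 1) then e (c * z) * e ((N - c : ℕ) * y) * e (a * (x - y)) else 0 := by
    intro a ha
    rw [mem_Icc] at ha
    by_cases h : a ∈ Icc 1 (N - c - 1)
    · rw [if_pos h]
      rw [mem_Icc] at h
      rw [sum_eq_single (N - c - a)]
      · rw [if_pos (by lia), ← e_add, ← e_add, ← e_add, ← e_add,
          Nat.cast_sub (by lia : a ≤ N - c)]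
        congr 1
        ring
      · intro b _ hb
        rw [if_neg (by lia)]
      · intro hb
        rw [mem_Icc] at hb
        lia
    · rw [if_neg h]
      rw [mem_Icc] at h
      refine sum_eq_zero fun b hb ↦ ?_
      rw [mem_Icc] at hb
      rw [if_neg (by lia)]
  rw [sum_congr rfl h1, ← sum_filter, filter_mem_eq_inter,
    inter_eq_right.mpr (Icc_subset_Icc_right (by lia)), ← mul_sum, norm_mul, norm_mul, norm_e,
    norm_e, one_mul, one_mul]
  exact norm_sum_Icc_e_le_inv hδ _ hxy

lemma repSum_e_self (N : ℕ) (x : ℝ) :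
    repSum N (fun n ↦ e (n * x)) (fun n ↦ e (n * x)) (fun n ↦ e (n * x)) =
      repSum N (fun _ ↦ 1) (fun _ ↦ 1) (fun _ ↦ 1) * e (N * x) := by
  simp only [repSum, sum_mul, ite_mul, zero_mul]
  refine sum_congr rfl fun a _ ↦ sum_congr rfl fun b _ ↦ sum_congr rfl fun c _ ↦ ?_
  split_ifs with h
  · rw [← e_add, ← e_add, ← h]
    push_cast
    ring_nf
  · rfl

lemma repSum_sum_left {ι : Type*} (s : Finset ι) (N : ℕ) (F : ι → ℕ → ℂ) (g h : ℕ → ℂ) :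
    repSum N (fun n ↦ ∑ i ∈ s, F i n) g h = ∑ i ∈ s, repSum N (F i) g h := by
  simp only [repSum]
  symm
  rw [sum_comm]
  refine sum_congr rfl fun a _ ↦ ?_
  rw [sum_comm]
  refine sum_congr rfl fun b _ ↦ ?_
  rw [sum_comm]
  refine sum_congr rfl fun c _ ↦ ?_
  split_ifs
  · rw [sum_mul, sum_mul]
  · rw [sum_const_zero]

lemma repSum_sum {ι : Type*} (s : Finset ι) (N : ℕ) (F : ι → ℕ → ℂ) :
    repSum N (fun n ↦ ∑ i ∈ s, F i n) (fun n ↦ ∑ i ∈ s, F i n) (fun n ↦ ∑ i ∈ s, F i n) =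
      ∑ i ∈ s, ∑ j ∈ s, ∑ k ∈ s, repSum N (F i) (F j) (F k) := by
  rw [repSum_sum_left]
  refine sum_congr rfl fun i _ ↦ ?_
  rw [repSum_swap_left, repSum_sum_left]
  refine sum_congr rfl fun j _ ↦ ?_
  rw [repSum_swap_left, repSum_swap_right, repSum_swap_left, repSum_sum_left]
  refine sum_congr rfl fun k _ ↦ ?_
  rw [repSum_swap_left, repSum_swap_right]

lemma repSum_const_mul (N : ℕ) (a b c : ℂ) (f g h : ℕ → ℂ) :
    repSum N (fun n ↦ a * f n) (fun n ↦ b * g n) (fun n ↦ c * h n) =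
      a * b * c * repSum N f g h := by
  simp only [repSum, mul_sum, mul_ite, mul_zero]
  refine sum_congr rfl fun _ _ ↦ sum_congr rfl fun _ _ ↦ sum_congr rfl fun _ _ ↦ ?_
  split_ifs
  · ring
  · rfl

section WellSpaced

variable {ι : Type*} {s : Finset ι} {c : ι → ℂ} {y : ι → ℝ} {δ P : ℝ}

lemma norm_repSum_wellSpaced_sub_le (hδ : 0 < δ)
    (hy : ∀ i ∈ s, ∀ j ∈ s, i ≠ j → δ ≤ distInt (y i - y j)) (hc : ∑ i ∈ s, ‖c i‖ ≤ P) (N : ℕ) :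
    ‖repSum N (fun n ↦ ∑ i ∈ s, c i * e (n * y i)) (fun n ↦ ∑ i ∈ s, c i * e (n * y i))
        (fun n ↦ ∑ i ∈ s, c i * e (n * y i)) -
      repSum N (fun _ ↦ 1) (fun _ ↦ 1) (fun _ ↦ 1) * ∑ i ∈ s, c i ^ 3 * e (N * y i)‖ ≤
      P ^ 3 * (N * (1 / (2 * δ))) := by
  classical
  have hP : 0 ≤ P := (sum_nonneg fun _ _ ↦ norm_nonneg _).trans hc
  have h1 : repSum N (fun _ ↦ 1) (fun _ ↦ 1) (fun _ ↦ 1) * ∑ i ∈ s, c i ^ 3 * e (N * y i) =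
      ∑ i ∈ s, ∑ j ∈ s, ∑ k ∈ s, if i = j ∧ i = k then c i * c j * c k *
        repSum N (fun n ↦ e (n * y i)) (fun n ↦ e (n * y j)) (fun n ↦ e (n * y k)) else 0 := by
    rw [mul_sum]
    refine sum_congr rfl fun i hi ↦ ?_
    simp only [ite_and]
    rw [sum_eq_single i, sum_eq_single i]
    · rw [if_pos rfl, if_pos rfl, repSum_e_self]
      ring
    · intro k _ hk
      rw [if_pos rfl, if_neg hk.symm]
    · exact fun h ↦ absurd hi h
    · intro j _ hj
      simp [hj.symm]
    · exact fun h ↦ absurd hi h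
  rw [repSum_sum, h1, ← sum_sub_distrib]
  simp only [← sum_sub_distrib, repSum_const_mul]
  have h2 : ∀ i ∈ s, ∀ j ∈ s, ∀ k ∈ s, ‖c i * c j * c k *
      repSum N (fun n ↦ e (n * y i)) (fun n ↦ e (n * y j)) (fun n ↦ e (n * y k)) -
      (if i = j ∧ i = k then c i * c j * c k *
        repSum N (fun n ↦ e (n * y i)) (fun n ↦ e (n * y j)) (fun n ↦ e (n * y k)) else 0)‖ ≤
      ‖c i‖ * ‖c j‖ * ‖c k‖ * (N * (1 / (2 * δ))) := by
    intro i hi j hj k hk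
    split_ifs with h
    · rw [sub_self, norm_zero]
      positivity
    · rw [sub_zero, norm_mul, norm_mul, norm_mul]
      refine mul_le_mul_of_nonneg_left ?_ (by positivity)
      by_cases hij : i = j
      · rw [repSum_swap_right]
        exact norm_repSum_e_le hδ N _ (hy i hi k hk (by tauto))
      · exact norm_repSum_e_le hδ N _ (hy i hi j hj hij)
  calc _ ≤ ∑ i ∈ s, ∑ j ∈ s, ∑ k ∈ s, ‖c i‖ * ‖c j‖ * ‖c k‖ * (N * (1 / (2 * δ))) :=
        norm_sum_le_of_le _ fun i hi ↦ norm_sum_le_of_le _ fun j hj ↦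
          norm_sum_le_of_le _ fun k hk ↦ h2 i hi j hj k hk
    _ = (∑ i ∈ s, ‖c i‖) ^ 3 * (N * (1 / (2 * δ))) := by
        simp only [← sum_mul, ← mul_sum]
        ring
    _ ≤ _ := by gcongr

lemma sum_norm_sq_wellSpaced_le (hδ : 0 < δ)
    (hy : ∀ i ∈ s, ∀ j ∈ s, i ≠ j → δ ≤ distInt (y i - y j)) (hc : ∑ i ∈ s, ‖c i‖ ≤ P) (N : ℕ) :
    ∑ n ∈ Icc 1 N, ‖∑ i ∈ s, c i * e (n * y i)‖ ^ 2 ≤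
      N * ∑ i ∈ s, ‖c i‖ ^ 2 + P ^ 2 * (1 / (2 * δ)) := by
  classical
  have hP : 0 ≤ P := (sum_nonneg fun _ _ ↦ norm_nonneg _).trans hc
  have h1 : ((∑ n ∈ Icc 1 N, ‖∑ i ∈ s, c i * e (n * y i)‖ ^ 2 : ℝ) : ℂ) =
      ∑ i ∈ s, ∑ j ∈ s, c i * (starRingEnd ℂ) (c j) * ∑ n ∈ Icc 1 N, e (n * (y i - y j)) := by
    push_cast
    simp only [← Complex.mul_conj', map_sum, sum_mul_sum]
    rw [sum_comm]
    refine sum_congr rfl fun i _ ↦ ?_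
    rw [sum_comm]
    refine sum_congr rfl fun j _ ↦ ?_
    rw [mul_sum]
    refine sum_congr rfl fun n _ ↦ ?_
    rw [map_mul, conj_e, mul_sub, sub_eq_add_neg, e_add]
    ring
  have h2 : ∀ i ∈ s, ∀ j ∈ s, ‖c i * (starRingEnd ℂ) (c j) *
      ∑ n ∈ Icc 1 N, e (n * (y i - y j))‖ ≤
      (if i = j then N * ‖c i‖ ^ 2 else 0) + ‖c i‖ * ‖c j‖ * (1 / (2 * δ)) := by
    intro i hi j hj
    rw [norm_mul, norm_mul, RCLike.norm_conj]
    split_ifs with h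
    · subst h
      have : ‖∑ n ∈ Icc 1 N, e (n * (y i - y i))‖ = N := by simp [e_zero]
      rw [this]
      have : 0 ≤ ‖c i‖ * ‖c i‖ * (1 / (2 * δ)) := by positivity
      linarith
    · rw [zero_add]
      exact mul_le_mul_of_nonneg_left (norm_sum_Icc_e_le_inv hδ N (hy i hi j hj h)) (by positivity)
  calc _ = ‖((∑ n ∈ Icc 1 N, ‖∑ i ∈ s, c i * e (n * y i)‖ ^ 2 : ℝ) : ℂ)‖ := by
        rw [Complex.norm_real, Real.norm_of_nonneg (by positivity)]
    _ ≤ ∑ i ∈ s, ∑ j ∈ s, ((if i = j then N * ‖c i‖ ^ 2 else 0) +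
          ‖c i‖ * ‖c j‖ * (1 / (2 * δ))) := by
        rw [h1]
        exact norm_sum_le_of_le _ fun i hi ↦ norm_sum_le_of_le _ fun j hj ↦ h2 i hi j hj
    _ = N * ∑ i ∈ s, ‖c i‖ ^ 2 + (∑ i ∈ s, ‖c i‖) ^ 2 * (1 / (2 * δ)) := by
        simp only [sum_add_distrib, sum_ite_eq]
        rw [sum_congr rfl fun i hi ↦ if_pos hi, ← mul_sum, sq, sum_mul_sum, sum_mul]
        congr 1
        exact sum_congr rfl fun i _ ↦ (sum_mul ..).symm
    _ ≤ _ := by gcongr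

lemma expSum_sum (N : ℕ) (α : ℝ) : expSum N (fun n ↦ ∑ i ∈ s, c i * e (n * y i)) α =
    ∑ i ∈ s, c i * ∑ n ∈ Icc 1 N, e (n * (α + y i)) := by
  simp only [expSum, sum_mul, mul_sum]
  rw [sum_comm]
  refine sum_congr rfl fun i _ ↦ sum_congr rfl fun n _ ↦ ?_
  rw [mul_add, e_add]
  ring

lemma norm_expSum_wellSpaced_le (hδ : 0 < δ) (hc : ∑ i ∈ s, ‖c i‖ ≤ P) (N : ℕ) {α : ℝ}
    (hα : ∀ i ∈ s, δ ≤ distInt (α + y i)) :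
    ‖expSum N (fun n ↦ ∑ i ∈ s, c i * e (n * y i)) α‖ ≤ P * (1 / (2 * δ)) := by
  rw [expSum_sum]
  calc _ ≤ ∑ i ∈ s, ‖c i‖ * (1 / (2 * δ)) := norm_sum_le_of_le _ fun i hi ↦ by
        rw [norm_mul]
        exact mul_le_mul_of_nonneg_left (norm_sum_Icc_e_le_inv hδ N (hα i hi)) (norm_nonneg _)
    _ ≤ _ := by rw [← sum_mul]; gcongr

lemma norm_expSum_wellSpaced_sub_le (hδ : 0 < δ) (hc : ∑ i ∈ s, ‖c i‖ ≤ P) (N : ℕ) {α : ℝ} {i₀ : ι}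
    (hi₀ : i₀ ∈ s) (hα : ∀ i ∈ s, i ≠ i₀ → δ ≤ distInt (α + y i)) :
    ‖expSum N (fun n ↦ ∑ i ∈ s, c i * e (n * y i)) α -
      c i₀ * ∑ n ∈ Icc 1 N, e (n * (α + y i₀))‖ ≤ P * (1 / (2 * δ)) := by
  classical
  have h := norm_expSum_wellSpaced_le (s := s.erase i₀) (P := P) hδ
    ((sum_le_sum_of_subset_of_nonneg (erase_subset _ _) fun _ _ _ ↦ norm_nonneg _).trans hc) N
    fun i hi ↦ hα i (mem_of_mem_erase hi) (ne_of_mem_erase hi)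
  rw [expSum_sum] at h ⊢
  rwa [← add_sum_erase s _ hi₀, add_sub_cancel_left]

end WellSpaced

lemma one_div_mul_le_distInt {q r : ℕ} (hq : 0 < q) (hr : 0 < r) {a b : ℤ}
    (h : ¬ (q * r : ℤ) ∣ a * r - b * q) : 1 / (q * r : ℝ) ≤ distInt (a / q - b / r) := by
  have hq0 : (0 : ℝ) < q := by exact_mod_cast hq
  have hr0 : (0 : ℝ) < r := by exact_mod_cast hr
  set k := round ((a : ℝ) / q - b / r) with hk
  have h1 : a * r - b * q - k * (q * r) ≠ 0 := fun h2 ↦ h ⟨k, by linarith⟩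
  have h2 : (1 : ℝ) ≤ |((a * r - b * q - k * (q * r) : ℤ) : ℝ)| := by
    exact_mod_cast Int.one_le_abs h1
  have h3 : (a : ℝ) / q - b / r - k = ((a * r - b * q - k * (q * r) : ℤ) : ℝ) / (q * r) := by
    push_cast
    field_simp
  rw [distInt, ← hk, h3, abs_div, abs_of_pos (mul_pos hq0 hr0)]
  gcongr

lemma eq_and_dvd_of_mul_dvd {q r : ℕ} {a b : ℤ} (ha : IsCoprime a q) (hb : IsCoprime b r)
    (h : (q * r : ℤ) ∣ a * r - b * q) : q = r ∧ (q : ℤ) ∣ a * r - b * r := by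
  have h1 : (q : ℤ) ∣ r := by
    refine ha.symm.dvd_of_dvd_mul_left ?_
    have := (dvd_of_mul_right_dvd h).add (dvd_mul_left (q : ℤ) b)
    rwa [sub_add_cancel] at this
  have h2 : (r : ℤ) ∣ q := by
    refine hb.symm.dvd_of_dvd_mul_left ?_
    have := (dvd_mul_left (r : ℤ) a).sub (dvd_of_mul_left_dvd h)
    rwa [sub_sub_cancel] at this
  have h3 : q = r := Nat.dvd_antisymm (Int.natCast_dvd_natCast.mp h1)
    (Int.natCast_dvd_natCast.mp h2)
  subst h3
  exact ⟨rfl, dvd_of_mul_right_dvd h⟩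

/-- The reduced fractions `b / q` in `[0, 1)` with denominator at most `P`. -/
def farey (P : ℕ) : Finset (Σ _ : ℕ, ℕ) := (Icc 1 P).sigma fun q ↦ {b ∈ range q | b.Coprime q}

/-- The real number `b / q` attached to the pair `(q, b)`. -/
noncomputable def fareyPoint (i : Σ _ : ℕ, ℕ) : ℝ := i.2 / i.1

/-- The weight `μ(q) / φ(q)` of the fraction `b / q` in the major arc model. -/
noncomputable def fareyWeight (i : Σ _ : ℕ, ℕ) : ℂ :=
  (ArithmeticFunction.moebius i.1 : ℂ) / i.1.totient

/-- The major arc model for the von Mangoldt function. -/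
noncomputable def model (P n : ℕ) : ℂ := ∑ i ∈ farey P, fareyWeight i * e (n * -fareyPoint i)

lemma mem_farey {P : ℕ} {i : Σ _ : ℕ, ℕ} :
    i ∈ farey P ↔ (1 ≤ i.1 ∧ i.1 ≤ P) ∧ i.2 < i.1 ∧ i.2.Coprime i.1 := by
  rw [farey, mem_sigma, mem_Icc, mem_filter, mem_range]

lemma card_coprime_range (q : ℕ) : #{b ∈ range q | b.Coprime q} = q.totient := by
  rw [Nat.totient_eq_card_coprime]
  simp only [Nat.coprime_comm]

lemma norm_fareyWeight_le (i : Σ _ : ℕ, ℕ) : ‖fareyWeight i‖ ≤ 1 / i.1.totient := by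
  rw [fareyWeight, norm_div, Complex.norm_natCast, Complex.norm_intCast]
  gcongr
  exact_mod_cast ArithmeticFunction.abs_moebius_le_one

lemma sum_norm_fareyWeight_le (P : ℕ) : ∑ i ∈ farey P, ‖fareyWeight i‖ ≤ P := by
  refine (sum_le_sum fun i _ ↦ norm_fareyWeight_le i).trans ?_
  rw [farey, sum_sigma]
  refine (sum_le_card_nsmul _ _ 1 fun q hq ↦ ?_).trans (by simp)
  dsimp only
  rw [sum_const, card_coprime_range, nsmul_eq_mul, mul_one_div]
  exact div_self_le_one _

lemma sum_norm_sq_fareyWeight_le (P : ℕ) :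
    ∑ i ∈ farey P, ‖fareyWeight i‖ ^ 2 ≤ ∑ q ∈ Icc 1 P, 1 / (q.totient : ℝ) := by
  refine (sum_le_sum fun i _ ↦ pow_le_pow_left₀ (norm_nonneg _) (norm_fareyWeight_le i) 2).trans ?_
  rw [farey, sum_sigma]
  refine sum_le_sum fun q hq ↦ ?_
  have hq0 : (0 : ℝ) < q.totient := by exact_mod_cast Nat.totient_pos.mpr (mem_Icc.mp hq).1
  dsimp only
  rw [sum_const, card_coprime_range, nsmul_eq_mul]
  apply le_of_eq
  field_simp

lemma one_div_sq_le_distInt_fareyPoint {P q b : ℕ} (hq : 1 ≤ q) (hqP : q ≤ P) (hb : b < q)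
    (hbq : b.Coprime q) {i : Σ _ : ℕ, ℕ} (hi : i ∈ farey P) (hne : i ≠ ⟨q, b⟩) :
    1 / (P : ℝ) ^ 2 ≤ distInt (b / q + -fareyPoint i) := by
  rw [mem_farey] at hi
  obtain ⟨r, d⟩ := i
  obtain ⟨⟨h1, h2⟩, h3, h4⟩ := hi
  dsimp only at h1 h2 h3 h4
  have h := one_div_mul_le_distInt hq h1 (a := b) (b := d) fun h ↦ by
    obtain ⟨h5, h6⟩ := eq_and_dvd_of_mul_dvd (Nat.isCoprime_iff_coprime.mpr hbq)
      (Nat.isCoprime_iff_coprime.mpr h4) h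
    subst h5
    have h7 : (q : ℤ) ∣ b - d := by
      have hq0 : (q : ℤ) ≠ 0 := by exact_mod_cast (by lia : q ≠ 0)
      refine (mul_dvd_mul_iff_right hq0).mp ?_
      rwa [sub_mul]
    have h8 := Int.eq_zero_of_abs_lt_dvd h7 (by rw [abs_lt]; lia)
    exact hne (by congr 1; lia)
  have h5 : (0 : ℝ) < q := by exact_mod_cast hq
  have h6 : (0 : ℝ) < r := by exact_mod_cast h1
  refine le_trans ?_ h
  rw [sq]
  gcongr

lemma expSum_add_intCast (N : ℕ) (f : ℕ → ℂ) (α : ℝ) (k : ℤ) :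
    expSum N f (α + k) = expSum N f α := by
  refine sum_congr rfl fun n _ ↦ ?_
  rw [mul_add, ← Int.cast_natCast, ← Int.cast_mul, e_add_intCast]

lemma minor_arc_gap {N P q β : ℝ} (hP : 1 ≤ P) (hN : 2 * P ^ 5 ≤ N) (hq : 0 < q)
    (hqN : q * P ^ 3 ≤ N) (hβ : |β| ≤ P ^ 3 / (N * q)) : P ^ 2 / (2 * N) ≤ 1 / (q * P) - |β| := by
  have hP5 : (0 : ℝ) < P ^ 5 := by positivity
  have hN0 : 0 < N := by linarith
  have h1 : P ^ 4 ≤ P ^ 5 := pow_le_pow_right₀ hP (by norm_num)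
  have h2 : P ^ 3 / (N * q) ≤ 1 / (2 * (q * P)) := by
    rw [div_le_div_iff₀ (by positivity) (by positivity)]
    nlinarith
  have h3 : P ^ 2 / (2 * N) ≤ 1 / (2 * (q * P)) := by
    rw [div_le_div_iff₀ (by positivity) (by positivity)]
    nlinarith
  have h4 : 1 / (2 * (q * P)) = 1 / (q * P) / 2 := by field_simp
  linarith

lemma major_arc_gap {N P q β : ℝ} (hP : 1 ≤ P) (hN : 2 * P ^ 5 ≤ N) (hq : 1 ≤ q)
    (hβ : |β| ≤ P ^ 3 / (N * q)) : 1 / (2 * P ^ 2) ≤ 1 / P ^ 2 - |β| := by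
  have hP5 : (0 : ℝ) < P ^ 5 := by positivity
  have hN0 : 0 < N := by linarith
  have h2 : P ^ 3 / (N * q) ≤ 1 / (2 * P ^ 2) := by
    rw [div_le_div_iff₀ (by positivity) (by positivity)]
    nlinarith
  have h4 : 1 / (2 * P ^ 2) = 1 / P ^ 2 / 2 := by field_simp
  linarith

lemma exists_rat_approx {N P : ℕ} (hP : 1 ≤ P) (hN : 2 * P ^ 5 ≤ N) (α : ℝ) :
    ∃ (q : ℕ) (a : ℤ), 1 ≤ q ∧ IsCoprime a q ∧ q * P ^ 3 ≤ N ∧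
      |α - a / q| ≤ 1 / (q : ℝ) ^ 2 ∧ |α - a / q| ≤ (P : ℝ) ^ 3 / (N * q) := by
  have hP5 : P ^ 3 ≤ P ^ 5 := Nat.pow_le_pow_right hP (by norm_num)
  have hP3 : 0 < P ^ 3 := by positivity
  obtain ⟨x, hx, hxn⟩ := Real.exists_rat_abs_sub_le_and_den_le α
    (Nat.div_pos (by lia : P ^ 3 ≤ N) hP3)
  have hx0 : (0 : ℝ) < x.den := by exact_mod_cast x.pos
  have hN0 : (0 : ℝ) < N := by exact_mod_cast (by lia : 0 < N)
  refine ⟨x.den, x.num, x.pos, ?_, ?_, ?_, ?_⟩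
  · exact Int.isCoprime_iff_gcd_eq_one.mpr x.reduced
  · exact (Nat.mul_le_mul_right _ hxn).trans (Nat.div_mul_le_self _ _)
  · rw [Rat.cast_def] at hx
    refine hx.trans ?_
    have : (x.den : ℝ) ≤ (N / P ^ 3 : ℕ) := by exact_mod_cast hxn
    rw [sq]
    gcongr
    linarith
  · rw [Rat.cast_def] at hx
    refine hx.trans ?_
    have h1 : (N : ℝ) ≤ P ^ 3 * ((N / P ^ 3 : ℕ) + 1) := by
      exact_mod_cast (Nat.lt_mul_div_succ N hP3).le
    rw [div_le_div_iff₀ (by positivity) (by positivity)]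
    nlinarith

lemma norm_expSum_model_le {N P q : ℕ} (hP : 1 ≤ P) (hN : 2 * P ^ 5 ≤ N) (hPq : P < q)
    (hqN : q * P ^ 3 ≤ N) {a : ℤ} (ha : IsCoprime a q) {α : ℝ}
    (hα : |α - a / q| ≤ (P : ℝ) ^ 3 / (N * q)) :
    ‖expSum N (model P) α‖ ≤ N / P := by
  have hP1 : (1 : ℝ) ≤ P := by exact_mod_cast hP
  have hq1 : (0 : ℝ) < q := by exact_mod_cast (by lia : 0 < q)
  have hN1 : 2 * (P : ℝ) ^ 5 ≤ N := by exact_mod_cast hN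
  have hP5 : (0 : ℝ) < (P : ℝ) ^ 5 := by positivity
  have hN0 : (0 : ℝ) < N := by linarith
  have hgap := minor_arc_gap hP1 hN1 hq1 (by exact_mod_cast hqN) hα
  refine (norm_expSum_wellSpaced_le (δ := (P : ℝ) ^ 2 / (2 * N)) (by positivity)
    (sum_norm_fareyWeight_le P) N fun i hi ↦ ?_).trans (le_of_eq ?_)
  · refine hgap.trans ?_
    obtain ⟨r, d⟩ := i
    rw [mem_farey] at hi
    obtain ⟨⟨h1, h2⟩, h3, h4⟩ := hi
    dsimp only at h1 h2 h3 h4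
    have h := one_div_mul_le_distInt (by lia : 0 < q) h1 (a := a) (b := d) fun h ↦ by
      have := (eq_and_dvd_of_mul_dvd ha (Nat.isCoprime_iff_coprime.mpr h4) h).1
      lia
    have h5 : (0 : ℝ) < r := by exact_mod_cast h1
    have h6 : 1 / (q * P : ℝ) ≤ 1 / (q * r : ℝ) := by gcongr
    have h7 := distInt_add_le (α + -fareyPoint ⟨r, d⟩) (-(α - a / q))
    have h8 : α + -fareyPoint ⟨r, d⟩ + -(α - a / q) = a / q - (d : ℤ) / r := by
      simp only [fareyPoint, Int.cast_natCast]
      ring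
    have h9 := distInt_le (α - a / q) 0
    rw [Int.cast_zero, sub_zero] at h9
    rw [h8, distInt_neg] at h7
    linarith
  · field_simp

lemma norm_expSum_model_sub_le {N P q b : ℕ} (hq : 1 ≤ q) (hqP : q ≤ P) (hN : 2 * P ^ 5 ≤ N)
    (hb : b < q) (hbq : b.Coprime q) {β : ℝ} (hβ : |β| ≤ (P : ℝ) ^ 3 / (N * q)) :
    ‖expSum N (model P) (b / q + β) -
      (ArithmeticFunction.moebius q : ℂ) / q.totient * ∑ n ∈ Icc 1 N, e (n * β)‖ ≤
      (P : ℝ) ^ 3 := by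
  have hP1 : (1 : ℝ) ≤ P := by exact_mod_cast hq.trans hqP
  have hN1 : 2 * (P : ℝ) ^ 5 ≤ N := by exact_mod_cast hN
  have hgap := major_arc_gap hP1 hN1 (by exact_mod_cast hq) hβ
  have h := norm_expSum_wellSpaced_sub_le (δ := 1 / (2 * (P : ℝ) ^ 2)) (by positivity)
    (sum_norm_fareyWeight_le P) N (i₀ := ⟨q, b⟩) (y := fun i ↦ -fareyPoint i) (α := b / q + β)
    (mem_farey.mpr ⟨⟨hq, hqP⟩, hb, hbq⟩) fun i hi hne ↦ by
      have h1 := one_div_sq_le_distInt_fareyPoint hq hqP hb hbq hi hne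
      have h7 := distInt_add_le (b / q + β + -fareyPoint i) (-β)
      have h8 : b / q + β + -fareyPoint i + -β = b / q + -fareyPoint i := by ring
      have h9 := distInt_le β 0
      rw [Int.cast_zero, sub_zero] at h9
      rw [h8, distInt_neg] at h7
      linarith
  have h2 : b / q + β + -fareyPoint ⟨q, b⟩ = β := by
    simp only [fareyPoint]
    ring
  rw [h2] at h
  refine h.trans (le_of_eq ?_)
  field_simp

theorem exists_norm_expSum_vonMangoldt_sub_le (A : ℕ) : ∃ C : ℝ, 0 < C ∧ ∀ N U : ℕ, 3 ≤ N →
    1 ≤ U → 2 * (U ^ 2) ^ 5 ≤ N → ((U ^ 2 : ℕ) : ℝ) ≤ Real.log N ^ A → ∀ α : ℝ,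
      ‖expSum N (fun n ↦ (ArithmeticFunction.vonMangoldt n : ℂ)) α -
        expSum N (model (U ^ 2)) α‖ ≤
        2500 * (N * Real.log N ^ 3 / √U) + N / (U ^ 2 : ℕ) +
          C * (((U ^ 2 : ℕ) : ℝ) ^ 4 * (N / Real.log N ^ A)) + ((U ^ 2 : ℕ) : ℝ) ^ 3 := by
  obtain ⟨C, hC, h⟩ := exists_norm_sum_vonMangoldt_e_sub_le A
  refine ⟨8 * C, by positivity, fun N U hN hU hNU hUA α ↦ ?_⟩
  set P := U ^ 2 with hP
  have hP1 : 1 ≤ P := Nat.one_le_pow _ _ hU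
  have hPr : (1 : ℝ) ≤ P := by exact_mod_cast hP1
  have hN0 : (0 : ℝ) < N := by exact_mod_cast (by lia : 0 < N)
  have hN1 : (1 : ℝ) < N := by exact_mod_cast (by lia : 1 < N)
  have hL := Real.log_pos hN1
  obtain ⟨q, a, hq, ha, hqN, hα, hα'⟩ := exists_rat_approx hP1 hNU α
  have hqr : (1 : ℝ) ≤ q := by exact_mod_cast hq
  rcases lt_or_ge P q with hPq | hPq
  · have h1 := norm_expSum_model_le hP1 hNU hPq hqN ha hα'
    have h2 := norm_sum_vonMangoldt_e_le hN hU (by lia : U ^ 2 ≤ q)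
      (le_trans (Nat.mul_le_mul_left q (le_self_pow₀ hP1 (by norm_num))) hqN) ha hα
    have h3 := norm_sub_le (expSum N (fun n ↦ (ArithmeticFunction.vonMangoldt n : ℂ)) α)
      (expSum N (model P) α)
    rw [← expSum.eq_def N (fun n ↦ (ArithmeticFunction.vonMangoldt n : ℂ)) α] at h2
    have h4 : 0 ≤ 8 * C * ((P : ℝ) ^ 4 * (N / Real.log N ^ A)) + (P : ℝ) ^ 3 := by positivity
    linarith
  · obtain ⟨k, b, hb, hab⟩ : ∃ (k : ℤ) (b : ℕ), b < q ∧ a = b + q * k := by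
      have hq0 : (0 : ℤ) < q := by exact_mod_cast hq
      obtain ⟨b, hb⟩ := Int.eq_ofNat_of_zero_le (Int.emod_nonneg a hq0.ne')
      refine ⟨a / q, b, ?_, ?_⟩
      · have := Int.emod_lt_of_pos a hq0
        lia
      · rw [← hb, Int.emod_add_mul_ediv]
    have hbq : b.Coprime q := by
      rw [hab] at ha
      exact Nat.isCoprime_iff_coprime.mp (IsCoprime.add_mul_left_left_iff.mp ha)
    have hαβ : α = b / q + (α - a / q) + k := by
      rw [hab]
      push_cast
      field_simp
      ring
    set β := α - a / q
    have h1 := norm_expSum_model_sub_le hq hPq hNU hb hbq hα'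
    have h2 := h N (by lia) q hq ((by exact_mod_cast hPq : (q : ℝ) ≤ P).trans hUA) b hbq β
    rw [hαβ, expSum_add_intCast, expSum_add_intCast]
    rw [← expSum.eq_def N (fun n ↦ (ArithmeticFunction.vonMangoldt n : ℂ)) (b / q + β)] at h2
    have h3 := norm_sub_le_norm_sub_add_norm_sub
      (expSum N (fun n ↦ (ArithmeticFunction.vonMangoldt n : ℂ)) (b / q + β))
      ((ArithmeticFunction.moebius q : ℂ) / q.totient * ∑ n ∈ Icc 1 N, e (n * β))
      (expSum N (model P) (b / q + β))
    rw [norm_sub_rev (_ * _) _] at h3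
    have h4 : N * |β| ≤ (P : ℝ) ^ 3 := by
      calc N * |β| ≤ N * ((P : ℝ) ^ 3 / (N * q)) := by gcongr
        _ = (P : ℝ) ^ 3 / q := by field_simp
        _ ≤ (P : ℝ) ^ 3 := div_le_self (by positivity) hqr
    have h5 : C * q * (N / Real.log N ^ A) * (1 + 7 * (N * |β|)) ≤
        8 * C * ((P : ℝ) ^ 4 * (N / Real.log N ^ A)) := by
      calc C * q * (N / Real.log N ^ A) * (1 + 7 * (N * |β|))
          ≤ C * P * (N / Real.log N ^ A) * (1 * (P : ℝ) ^ 3 + 7 * (P : ℝ) ^ 3) := by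
            gcongr
            linarith [one_le_pow₀ hPr (n := 3)]
        _ = _ := by ring
    have h6 : 0 ≤ 2500 * (N * Real.log N ^ 3 / √U) + N / (P : ℝ) := by positivity
    linarith

/-- The arithmetic function `d ↦ d` restricted to the divisors of `n`. -/
def dvdIndicator (n : ℕ) : ArithmeticFunction ℤ := ⟨fun d ↦ if d ∣ n then d else 0, by simp⟩

/-- The Ramanujan sum `q ↦ c_q(n)` as an integer-valued arithmetic function. -/
def ramanujan (n : ℕ) : ArithmeticFunction ℤ := ArithmeticFunction.moebius * dvdIndicator n

lemma isMultiplicative_dvdIndicator (n : ℕ) : (dvdIndicator n).IsMultiplicative := by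
  refine ⟨by simp [dvdIndicator], fun {a b} hab ↦ ?_⟩
  simp only [dvdIndicator, ArithmeticFunction.coe_mk]
  by_cases ha : a ∣ n
  · by_cases hb : b ∣ n
    · rw [if_pos ha, if_pos hb, if_pos (hab.mul_dvd_of_dvd_of_dvd ha hb), Nat.cast_mul]
    · rw [if_neg hb, if_neg fun h ↦ hb (dvd_of_mul_left_dvd h), mul_zero]
  · rw [if_neg ha, if_neg fun h ↦ ha (dvd_of_mul_right_dvd h), zero_mul]

lemma isMultiplicative_ramanujan (n : ℕ) : (ramanujan n).IsMultiplicative :=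
  ArithmeticFunction.isMultiplicative_moebius.mul (isMultiplicative_dvdIndicator n)

lemma ramanujanSum_eq_intCast {q : ℕ} (hq : 0 < q) (n : ℕ) :
    ramanujanSum q n = (ramanujan n q : ℂ) := by
  rw [ramanujanSum_eq_sum_divisors hq, ramanujan, ArithmeticFunction.mul_apply,
    Nat.sum_divisorsAntidiagonal (fun i j ↦ ArithmeticFunction.moebius i * dvdIndicator n j)]
  rw [Int.cast_sum]
  refine sum_congr rfl fun d _ ↦ ?_
  rw [Int.cast_mul, dvdIndicator, ArithmeticFunction.coe_mk]
  split_ifs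
  · rw [Int.cast_natCast]
  · rw [Int.cast_zero]

lemma abs_ramanujan_le (n q : ℕ) : |(ramanujan n q : ℝ)| ≤ q.totient := by
  rcases Nat.eq_zero_or_pos q with rfl | hq
  · simp
  · have h : ‖ramanujanSum q n‖ ≤ q.totient := by
      refine (norm_sum_le _ _).trans (le_of_eq ?_)
      simp [norm_e, card_coprime_range]
    rwa [ramanujanSum_eq_intCast hq, Complex.norm_intCast] at h

lemma ramanujan_apply_prime {p : ℕ} (hp : p.Prime) (n : ℕ) :
    ramanujan n p = (if p ∣ n then (p : ℤ) else 0) - 1 := by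
  rw [ramanujan, ArithmeticFunction.mul_apply,
    Nat.sum_divisorsAntidiagonal (fun i j ↦ ArithmeticFunction.moebius i * dvdIndicator n j),
    hp.sum_divisors, ArithmeticFunction.moebius_apply_prime hp]
  simp only [dvdIndicator, ArithmeticFunction.coe_mk, ArithmeticFunction.moebius_apply_one,
    Nat.div_one, Nat.div_self hp.pos]
  simp
  ring

/-- The terms of the singular series of the ternary Goldbach problem. -/
noncomputable def singularTerm (n q : ℕ) : ℝ :=
  (ArithmeticFunction.moebius q : ℝ) * ramanujan n q / q.totient ^ 3

lemma exists_inv_totient_le {ε : ℝ} (hε : 0 < ε) :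
    ∃ C : ℝ, 0 < C ∧ ∀ q : ℕ, 1 ≤ q → 1 / (q.totient : ℝ) ≤ C * (q : ℝ) ^ (ε - 1) := by
  obtain ⟨c, hc, h⟩ := exists_half_pow_mul_rpow_le_prod hε
  refine ⟨1 / c, by positivity, fun q hq ↦ ?_⟩
  have hq0 : (0 : ℝ) < q := by exact_mod_cast hq
  have h1 : (q.totient : ℝ) = q * ∏ p ∈ q.primeFactors, (1 - (p : ℝ)⁻¹) := by
    have := congrArg (fun x : ℚ ↦ (x : ℝ)) (Nat.totient_eq_mul_prod_factors q)
    push_cast at this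
    exact this
  have h2 : c * (q : ℝ) ^ (1 - ε) ≤ q.totient := by
    rw [h1, sub_eq_add_neg, Real.rpow_add hq0, Real.rpow_one]
    have := mul_le_mul_of_nonneg_left (h q (by lia)) hq0.le
    linarith
  have h3 : (q : ℝ) ^ (ε - 1) = 1 / (q : ℝ) ^ (1 - ε) := by
    rw [← neg_sub, Real.rpow_neg hq0.le, one_div]
  rw [h3, div_mul_div_comm, one_mul]
  gcongr

lemma exists_abs_singularTerm_le : ∃ C : ℝ, 0 < C ∧ ∀ n q : ℕ,
    |singularTerm n q| ≤ C * (q : ℝ) ^ (-3 / 2 : ℝ) := by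
  obtain ⟨C, hC, h⟩ := exists_inv_totient_le (ε := 1 / 4) (by norm_num)
  refine ⟨C ^ 2, by positivity, fun n q ↦ ?_⟩
  rcases Nat.eq_zero_or_pos q with rfl | hq
  · simp [singularTerm]
  · have hq0 : (0 : ℝ) < q := by exact_mod_cast hq
    have hφ : (0 : ℝ) < q.totient := by exact_mod_cast Nat.totient_pos.mpr hq
    have h1 : |(ArithmeticFunction.moebius q : ℝ)| ≤ 1 := by
      exact_mod_cast ArithmeticFunction.abs_moebius_le_one
    calc |singularTerm n q| ≤ 1 * q.totient / (q.totient : ℝ) ^ 3 := by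
          rw [singularTerm, abs_div, abs_mul, abs_of_pos (pow_pos hφ 3)]
          gcongr
          exact abs_ramanujan_le n q
      _ = (1 / (q.totient : ℝ)) ^ 2 := by field_simp
      _ ≤ (C * (q : ℝ) ^ (1 / 4 - 1 : ℝ)) ^ 2 := by
          gcongr
          exact h q hq
      _ = C ^ 2 * (q : ℝ) ^ (-3 / 2 : ℝ) := by
          rw [mul_pow, ← Real.rpow_natCast (_ ^ _) 2, ← Real.rpow_mul hq0.le]
          norm_num

lemma summable_singularTerm (n : ℕ) : Summable fun q ↦ ‖singularTerm n q‖ := by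
  obtain ⟨C, hC, h⟩ := exists_abs_singularTerm_le
  refine Summable.of_nonneg_of_le (fun _ ↦ norm_nonneg _) (h n) ?_
  exact (Real.summable_nat_rpow.mpr (by norm_num)).mul_left C

lemma singularTerm_mul {n a b : ℕ} (hab : a.Coprime b) :
    singularTerm n (a * b) = singularTerm n a * singularTerm n b := by
  rw [singularTerm, singularTerm, singularTerm,
    ArithmeticFunction.isMultiplicative_moebius.map_mul_of_coprime hab,
    (isMultiplicative_ramanujan n).map_mul_of_coprime hab, Nat.totient_mul hab, div_mul_div_comm]
  push_cast
  congr 1 <;> ring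

lemma singularTerm_prime {p : ℕ} (hp : p.Prime) (n : ℕ) : singularTerm n p =
    if p ∣ n then -1 / ((p : ℝ) - 1) ^ 2 else 1 / ((p : ℝ) - 1) ^ 3 := by
  have hp1 : (p : ℝ) - 1 ≠ 0 := by
    have : (1 : ℝ) < p := by exact_mod_cast hp.one_lt
    linarith
  rw [singularTerm, ArithmeticFunction.moebius_apply_prime hp, ramanujan_apply_prime hp,
    Nat.totient_prime hp, Nat.cast_sub hp.one_le]
  split_ifs
  · push_cast
    field_simp
  · push_cast
    simp

lemma tsum_singularTerm_prime_pow {p : ℕ} (hp : p.Prime) (n : ℕ) :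
    ∑' k : ℕ, singularTerm n (p ^ k) = 1 + singularTerm n p := by
  rw [tsum_eq_sum (s := range 2) fun k hk ↦ ?_]
  · rw [sum_range_succ, sum_range_one, pow_zero, pow_one]
    simp [singularTerm, (isMultiplicative_ramanujan n).map_one]
  · rw [mem_range] at hk
    rw [singularTerm, ArithmeticFunction.moebius_apply_prime_pow hp (by lia), if_neg (by lia)]
    simp

lemma le_prod_primesBelow {n : ℕ} (hn : Odd n) {m : ℕ} (hm : 3 ≤ m) :
    ((m : ℝ) - 1) / (m - 2) ≤ ∏ p ∈ m.primesBelow, (1 + singularTerm n p) := by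
  induction m, hm using Nat.le_induction with
  | base =>
    have h1 : Nat.primesBelow 3 = {2} := by decide
    rw [h1, prod_singleton, singularTerm_prime Nat.prime_two,
      if_neg fun h ↦ (Nat.not_even_iff_odd.mpr hn) (even_iff_two_dvd.mpr h)]
    norm_num
  | succ m hm ih =>
    have hm3 : (3 : ℝ) ≤ m := by exact_mod_cast hm
    have h2 : (0 : ℝ) < m - 2 := by linarith
    have h1 : (0 : ℝ) < m - 1 := by linarith
    have h0 : (0 : ℝ) < m := by linarith
    have h3 : ((m + 1 : ℕ) : ℝ) - 1 = m := by push_cast; ring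
    have h4 : ((m + 1 : ℕ) : ℝ) - 2 = m - 1 := by push_cast; ring
    rw [h3, h4, Nat.primesBelow_succ]
    split_ifs with hp
    · rw [prod_insert (by simp [Nat.primesBelow])]
      have h5 : 1 - 1 / ((m : ℝ) - 1) ^ 2 ≤ 1 + singularTerm n m := by
        rw [singularTerm_prime hp]
        split_ifs
        · rw [neg_div, sub_eq_add_neg]
        · have : 0 ≤ 1 / ((m : ℝ) - 1) ^ 3 + 1 / ((m : ℝ) - 1) ^ 2 := by positivity
          linarith
      have h6 : 0 ≤ 1 - 1 / ((m : ℝ) - 1) ^ 2 := by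
        rw [sub_nonneg, div_le_one (by positivity)]
        nlinarith
      calc (m : ℝ) / (m - 1) = (1 - 1 / ((m : ℝ) - 1) ^ 2) * ((m - 1) / (m - 2)) := by
            field_simp
            ring
        _ ≤ _ := mul_le_mul h5 ih (by positivity) (h6.trans h5)
    · refine le_trans ?_ ih
      rw [div_le_div_iff₀ h1 h2]
      nlinarith

lemma one_le_tsum_singularTerm {n : ℕ} (hn : Odd n) : 1 ≤ ∑' q, singularTerm n q := by
  have h := EulerProduct.eulerProduct (f := singularTerm n)
    (by simp [singularTerm, (isMultiplicative_ramanujan n).map_one])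
    singularTerm_mul (summable_singularTerm n) (by simp [singularTerm])
  refine ge_of_tendsto h ?_
  filter_upwards [eventually_ge_atTop 3] with m hm
  rw [prod_congr rfl fun p hp ↦ tsum_singularTerm_prime_pow (Nat.prime_of_mem_primesBelow hp) n]
  refine le_trans ?_ (le_prod_primesBelow hn hm)
  have hm3 : (3 : ℝ) ≤ m := by exact_mod_cast hm
  rw [one_le_div (by linarith)]
  linarith

theorem exists_half_le_sum_singularTerm : ∃ P₀ : ℕ, ∀ P, P₀ ≤ P → ∀ n, Odd n →
    1 / 2 ≤ ∑ q ∈ Icc 1 P, singularTerm n q := by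
  obtain ⟨C, hC, h⟩ := exists_abs_singularTerm_le
  have hs : Summable fun q : ℕ ↦ C * (q : ℝ) ^ (-3 / 2 : ℝ) :=
    (Real.summable_nat_rpow.mpr (by norm_num)).mul_left C
  have ht := tendsto_sum_nat_add fun q : ℕ ↦ C * (q : ℝ) ^ (-3 / 2 : ℝ)
  obtain ⟨P₀, hP₀⟩ := eventually_atTop.mp (ht.eventually_le_const (by norm_num : (0 : ℝ) < 1 / 2))
  refine ⟨P₀, fun P hP n hn ↦ ?_⟩
  have h1 := (summable_singularTerm n).of_norm.sum_add_tsum_nat_add (P + 1)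
  have h2 := tsum_of_norm_bounded ((summable_nat_add_iff (P + 1)).mpr hs).hasSum
    (f := fun k ↦ singularTerm n (k + (P + 1))) fun k ↦ h n _
  have h3 := hP₀ (P + 1) (by lia)
  have h4 := le_abs_self (∑' k, singularTerm n (k + (P + 1)))
  rw [Real.norm_eq_abs] at h2
  have h5 : ∑ q ∈ Icc 1 P, singularTerm n q = ∑ q ∈ range (P + 1), singularTerm n q := by
    rw [sum_range_eq_add_Ico _ (by lia)]
    have : singularTerm n 0 = 0 := by simp [singularTerm]
    rw [this, zero_add]
    rfl
  have h6 := one_le_tsum_singularTerm hn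
  rw [h5]
  linarith

lemma sum_farey_eq_sum_singularTerm (P n : ℕ) :
    ∑ i ∈ farey P, fareyWeight i ^ 3 * e (n * -fareyPoint i) =
      ((∑ q ∈ Icc 1 P, singularTerm n q : ℝ) : ℂ) := by
  rw [farey, sum_sigma, Complex.ofReal_sum]
  refine sum_congr rfl fun q hq ↦ ?_
  simp only [fareyWeight, fareyPoint]
  have h1 : ∑ b ∈ range q with b.Coprime q, e (n * -((b : ℝ) / q)) = (ramanujan n q : ℂ) := by
    rw [← map_intCast (starRingEnd ℂ), ← ramanujanSum_eq_intCast (mem_Icc.mp hq).1, ramanujanSum, map_sum]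
    refine sum_congr rfl fun b _ ↦ ?_
    rw [conj_e]
    congr 1
    ring
  have h2 : (ArithmeticFunction.moebius q) ^ 3 = ArithmeticFunction.moebius q := by
    rcases ArithmeticFunction.moebius_eq_or q with h | h | h <;> simp [h]
  rw [← mul_sum, h1, singularTerm, div_pow, ← Int.cast_pow, h2]
  push_cast
  ring

lemma exists_repSum_one_eq {N : ℕ} (hN : 4 ≤ N) : ∃ K : ℝ, (N : ℝ) ^ 2 / 16 ≤ K ∧
    repSum N (fun _ ↦ 1) (fun _ ↦ 1) (fun _ ↦ 1) = (K : ℂ) := by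
  refine ⟨∑ a ∈ Icc 1 N, ∑ b ∈ Icc 1 N, ∑ c ∈ Icc 1 N, if a + b + c = N then 1 else 0, ?_, ?_⟩
  · set m := (N - 1) / 2 with hm
    have hsub : Icc 1 m ⊆ Icc 1 N := Icc_subset_Icc_right (by lia)
    have hmN : (N : ℝ) ≤ 4 * m := by exact_mod_cast (by lia : N ≤ 4 * m)
    have h0 : ∀ a b, (0 : ℝ) ≤ ∑ c ∈ Icc 1 N, if a + b + c = N then 1 else 0 := fun a b ↦
      sum_nonneg fun c _ ↦ by split_ifs <;> norm_num
    calc (N : ℝ) ^ 2 / 16 ≤ (m : ℝ) ^ 2 := by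
          have : (0 : ℝ) ≤ N := by positivity
          nlinarith
      _ = ∑ a ∈ Icc 1 m, ∑ b ∈ Icc 1 m, (1 : ℝ) := by simp [sq]
      _ ≤ ∑ a ∈ Icc 1 m, ∑ b ∈ Icc 1 m, ∑ c ∈ Icc 1 N, if a + b + c = N then (1 : ℝ) else 0 := by
          refine sum_le_sum fun a ha ↦ sum_le_sum fun b hb ↦ ?_
          rw [mem_Icc] at ha hb
          rw [sum_eq_single (N - a - b) (fun c _ hc ↦ if_neg (by lia)) fun h ↦ ?_,
            if_pos (by lia)]
          rw [mem_Icc] at h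
          lia
      _ ≤ ∑ a ∈ Icc 1 m, ∑ b ∈ Icc 1 N, ∑ c ∈ Icc 1 N, if a + b + c = N then (1 : ℝ) else 0 :=
          sum_le_sum fun a _ ↦ sum_le_sum_of_subset_of_nonneg hsub fun b _ _ ↦ h0 a b
      _ ≤ _ := sum_le_sum_of_subset_of_nonneg hsub fun a _ _ ↦ sum_nonneg fun b _ ↦ h0 a b
  · simp only [repSum, Complex.ofReal_sum, apply_ite Complex.ofReal, Complex.ofReal_one,
      Complex.ofReal_zero, mul_one]

lemma repSum_add_self (N : ℕ) (f g : ℕ → ℂ) : repSum N (fun n ↦ f n + g n) (fun n ↦ f n + g n)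
    (fun n ↦ f n + g n) = repSum N g (fun n ↦ f n + g n) (fun n ↦ f n + g n) +
      repSum N f g (fun n ↦ f n + g n) + repSum N f f g + repSum N f f f := by
  simp only [repSum, ← sum_add_distrib]
  refine sum_congr rfl fun a _ ↦ sum_congr rfl fun b _ ↦ sum_congr rfl fun c _ ↦ ?_
  split_ifs
  · ring
  · simp

lemma norm_repSum_le {N : ℕ} {f g h : ℕ → ℂ} {B : ℝ} (hg : ∀ n ∈ Icc 1 N, ‖g n‖ ≤ B)
    (hh : ∀ n ∈ Icc 1 N, ‖h n‖ ≤ B) :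
    ‖repSum N f g h‖ ≤ (∑ n ∈ Icc 1 N, ‖f n‖) * (N * B ^ 2) := by
  rw [repSum, sum_mul]
  refine norm_sum_le_of_le _ fun a ha ↦ ?_
  have hB : 0 ≤ B := (norm_nonneg _).trans (hg a ha)
  refine (norm_sum_le _ _).trans ((sum_le_card_nsmul _ _ (‖f a‖ * B ^ 2) fun b hb ↦ ?_).trans
    (le_of_eq (by simp; ring)))
  have h1 : ∀ c ∈ Icc 1 N, (if a + b + c = N then f a * g b * h c else 0) =
      if N - a - b = c then (if a + b + c = N then f a * g b * h c else 0) else 0 := by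
    intro c hc
    rw [mem_Icc] at hc
    by_cases h : a + b + c = N
    · rw [if_pos (by lia : N - a - b = c)]
    · rw [if_neg h, ite_self]
  rw [sum_congr rfl h1, sum_ite_eq]
  split_ifs with h2 h3
  · rw [norm_mul, norm_mul, mul_assoc, sq]
    exact mul_le_mul_of_nonneg_left
      (mul_le_mul (hg b hb) (hh _ h2) (norm_nonneg _) hB) (norm_nonneg _)
  all_goals
    rw [norm_zero]
    positivity

lemma sum_vonMangoldt_not_prime_le {N : ℕ} (hN : 1 ≤ N) :
    ∑ n ∈ Icc 1 N, (if n.Prime then 0 else ArithmeticFunction.vonMangoldt n) ≤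
      2 * √N * Real.log N := by
  have h := (le_abs_self _).trans
    (Chebyshev.abs_psi_sub_theta_le_sqrt_mul_log (x := N) (by exact_mod_cast hN))
  refine le_trans (le_of_eq ?_) h
  have hI : Ioc 0 N = Icc 1 N := by ext; simp; lia
  rw [Chebyshev.psi, Chebyshev.theta, Nat.floor_natCast, sum_filter, ← sum_sub_distrib, hI]
  refine sum_congr rfl fun n _ ↦ ?_
  split_ifs with hn
  · rw [ArithmeticFunction.vonMangoldt_apply_prime hn, sub_self]
  · rw [sub_zero]

/-- If `N` is not a sum of three primes, then the weighted number of representations of `N` as a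
sum of three prime powers is small. -/
lemma norm_repSum_vonMangoldt_le {N : ℕ} (hN : 1 ≤ N)
    (h : ¬ ∃ p q r : ℕ, p.Prime ∧ q.Prime ∧ r.Prime ∧ N = p + q + r) :
    ‖repSum N (fun n ↦ (ArithmeticFunction.vonMangoldt n : ℂ))
      (fun n ↦ (ArithmeticFunction.vonMangoldt n : ℂ))
      (fun n ↦ (ArithmeticFunction.vonMangoldt n : ℂ))‖ ≤
      3 * ((2 * √N * Real.log N) * (N * Real.log N ^ 2)) := by
  set f : ℕ → ℂ := fun n ↦ if n.Prime then (ArithmeticFunction.vonMangoldt n : ℂ) else 0 with hf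
  set g : ℕ → ℂ := fun n ↦ if n.Prime then 0 else (ArithmeticFunction.vonMangoldt n : ℂ) with hg
  have hfg : (fun n ↦ (ArithmeticFunction.vonMangoldt n : ℂ)) = fun n ↦ f n + g n := by
    funext n
    simp only [hf, hg]
    split_ifs <;> simp
  have hΛ : ∀ n ∈ Icc 1 N, ‖f n + g n‖ ≤ Real.log N := by
    intro n hn
    rw [mem_Icc] at hn
    rw [← congrFun hfg n, Complex.norm_real, Real.norm_of_nonneg (by simp)]
    refine ArithmeticFunction.vonMangoldt_le_log.trans ?_
    exact Real.log_le_log (by exact_mod_cast hn.1) (by exact_mod_cast hn.2)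
  have hf1 : ∀ n ∈ Icc 1 N, ‖f n‖ ≤ Real.log N := by
    intro n hn
    refine le_trans ?_ (hΛ n hn)
    simp only [hf, hg]
    split_ifs <;> simp
  have hg1 : ∑ n ∈ Icc 1 N, ‖g n‖ ≤ 2 * √N * Real.log N := by
    refine le_trans (le_of_eq (sum_congr rfl fun n _ ↦ ?_)) (sum_vonMangoldt_not_prime_le hN)
    simp only [hg]
    split_ifs
    · rw [norm_zero]
    · rw [Complex.norm_real, Real.norm_of_nonneg (by simp)]
  have h0 : repSum N f f f = 0 := by
    refine sum_eq_zero fun a _ ↦ sum_eq_zero fun b _ ↦ sum_eq_zero fun c _ ↦ ?_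
    split_ifs with habc
    · by_contra hne
      refine h ⟨a, b, c, ?_, ?_, ?_, habc.symm⟩
      all_goals
        by_contra hp
        simp [hf, hp] at hne
    · rfl
  have h1 := norm_repSum_le (f := g) hΛ hΛ
  have h2 := norm_repSum_le (f := g) hf1 hΛ
  have h3 := norm_repSum_le (f := g) hf1 hf1
  have h4 := mul_le_mul_of_nonneg_right hg1 (by positivity : 0 ≤ N * Real.log N ^ 2)
  rw [hfg, repSum_add_self, h0, add_zero, repSum_swap_left N f g, repSum_swap_right N f f g,
    repSum_swap_left N f g f]
  refine norm_add₃_le.trans ?_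
  linarith

lemma exists_sum_inv_totient_le {ε : ℝ} (hε : 0 < ε) : ∃ C : ℝ, 0 < C ∧ ∀ P : ℕ, 1 ≤ P →
    ∑ q ∈ Icc 1 P, 1 / (q.totient : ℝ) ≤ C * (P : ℝ) ^ (2 * ε) := by
  obtain ⟨C, hC, h⟩ := exists_inv_totient_le hε
  have hs : Summable fun q : ℕ ↦ (q : ℝ) ^ (-1 - ε) := Real.summable_nat_rpow.mpr (by linarith)
  have hs1 : 1 ≤ ∑' q : ℕ, (q : ℝ) ^ (-1 - ε) := by
    have := hs.le_tsum 1 fun q _ ↦ by positivity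
    simpa using this
  refine ⟨C * ∑' q : ℕ, (q : ℝ) ^ (-1 - ε), by positivity, fun P hP ↦ ?_⟩
  calc ∑ q ∈ Icc 1 P, 1 / (q.totient : ℝ)
      ≤ ∑ q ∈ Icc 1 P, C * (P : ℝ) ^ (2 * ε) * (q : ℝ) ^ (-1 - ε) := by
        refine sum_le_sum fun q hq ↦ (h q (mem_Icc.mp hq).1).trans ?_
        have hq0 : (0 : ℝ) < q := by exact_mod_cast (mem_Icc.mp hq).1
        have hqP : (q : ℝ) ≤ P := by exact_mod_cast (mem_Icc.mp hq).2
        rw [mul_assoc, (by ring : ε - 1 = 2 * ε + (-1 - ε)), Real.rpow_add hq0]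
        gcongr
    _ ≤ C * (P : ℝ) ^ (2 * ε) * ∑' q : ℕ, (q : ℝ) ^ (-1 - ε) := by
        rw [← mul_sum]
        gcongr
        exact hs.sum_le_tsum _ fun q _ ↦ by positivity
    _ = _ := by ring

lemma one_div_sq_le_distInt_fareyPoint_sub {P : ℕ} {i j : Σ _ : ℕ, ℕ} (hi : i ∈ farey P)
    (hj : j ∈ farey P) (hij : i ≠ j) :
    1 / (P : ℝ) ^ 2 ≤ distInt (-fareyPoint i - -fareyPoint j) := by
  have h := mem_farey.mp hj
  have h1 := one_div_sq_le_distInt_fareyPoint h.1.1 h.1.2 h.2.1 h.2.2 hi hij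
  rwa [neg_sub_neg, sub_eq_add_neg]

lemma norm_repSum_model_sub_le {N P : ℕ} (hP : 1 ≤ P) :
    ‖repSum N (model P) (model P) (model P) - repSum N (fun _ ↦ 1) (fun _ ↦ 1) (fun _ ↦ 1) *
      ((∑ q ∈ Icc 1 P, singularTerm N q : ℝ) : ℂ)‖ ≤ N * (P : ℝ) ^ 5 / 2 := by
  have hP0 : (0 : ℝ) < P := by exact_mod_cast hP
  rw [← sum_farey_eq_sum_singularTerm]
  refine (norm_repSum_wellSpaced_sub_le (δ := 1 / (P : ℝ) ^ 2) (by positivity)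
    (fun i hi j hj hij ↦ one_div_sq_le_distInt_fareyPoint_sub hi hj hij)
    (sum_norm_fareyWeight_le P) N).trans (le_of_eq ?_)
  field_simp

lemma sum_norm_sq_model_le {N P : ℕ} (hP : 1 ≤ P) :
    ∑ n ∈ Icc 1 N, ‖model P n‖ ^ 2 ≤
      N * ∑ q ∈ Icc 1 P, 1 / (q.totient : ℝ) + (P : ℝ) ^ 4 / 2 := by
  have hP0 : (0 : ℝ) < P := by exact_mod_cast hP
  refine (sum_norm_sq_wellSpaced_le (δ := 1 / (P : ℝ) ^ 2) (by positivity)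
    (fun i hi j hj hij ↦ one_div_sq_le_distInt_fareyPoint_sub hi hj hij)
    (sum_norm_fareyWeight_le P) N).trans (add_le_add ?_ (le_of_eq ?_))
  · gcongr
    exact sum_norm_sq_fareyWeight_le P
  · field_simp

lemma sum_norm_sq_vonMangoldt_le (N : ℕ) :
    ∑ n ∈ Icc 1 N, ‖(ArithmeticFunction.vonMangoldt n : ℂ)‖ ^ 2 ≤ N * Real.log N ^ 2 := by
  refine (sum_le_card_nsmul _ _ (Real.log N ^ 2) fun n hn ↦ ?_).trans (le_of_eq (by simp))
  rw [mem_Icc] at hn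
  rw [Complex.norm_real, Real.norm_of_nonneg (by simp)]
  gcongr
  refine ArithmeticFunction.vonMangoldt_le_log.trans ?_
  exact Real.log_le_log (by exact_mod_cast hn.1) (by exact_mod_cast hn.2)

lemma floor_log_pow_bounds {L : ℝ} (hL : 2 ≤ L) :
    L ^ 16 / 2 ≤ (⌊L ^ 16⌋₊ : ℝ) ∧ (⌊L ^ 16⌋₊ : ℝ) ≤ L ^ 16 := by
  have h1 := Nat.lt_floor_add_one (L ^ 16)
  have h2 : (2 : ℝ) ^ 16 ≤ L ^ 16 := pow_le_pow_left₀ (by norm_num) hL 16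
  exact ⟨by linarith, Nat.floor_le (by positivity)⟩

lemma minor_arc_error_le {L N U : ℝ} (hL : 2 ≤ L) (hN : 0 ≤ N) (hU : L ^ 16 / 2 ≤ U) :
    2500 * (N * L ^ 3 / √U) ≤ 5000 * (N / L ^ 5) := by
  have hL0 : 0 < L := by linarith
  have h1 : L ^ 8 / 2 ≤ √U := by
    refine Real.le_sqrt_of_sq_le (le_trans ?_ hU)
    have : 0 < L ^ 16 := by positivity
    rw [div_pow, ← pow_mul]
    linarith
  calc 2500 * (N * L ^ 3 / √U) ≤ 2500 * (N * L ^ 3 / (L ^ 8 / 2)) := by gcongr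
    _ = _ := by field_simp; ring

lemma truncation_error_le {L N U : ℝ} (hL : 2 ≤ L) (hN : 0 ≤ N) (hU : L ^ 16 / 2 ≤ U) :
    N / U ^ 2 ≤ 4 * (N / L ^ 5) := by
  have hL0 : 0 < L := by linarith
  calc N / U ^ 2 ≤ N / (L ^ 16 / 2) ^ 2 := by gcongr
    _ = 4 * (N / L ^ 32) := by field_simp; ring
    _ ≤ _ := by
        gcongr
        · linarith
        · norm_num

lemma major_arc_error_le {L N U C : ℝ} (hL : 2 ≤ L) (hN : 0 ≤ N) (hU0 : 0 ≤ U) (hC : 0 ≤ C)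
    (hU : U ≤ L ^ 16) : C * ((U ^ 2) ^ 4 * (N / L ^ 133)) ≤ C * (N / L ^ 5) := by
  have hL0 : 0 < L := by linarith
  calc C * ((U ^ 2) ^ 4 * (N / L ^ 133)) ≤ C * (((L ^ 16) ^ 2) ^ 4 * (N / L ^ 133)) := by gcongr
    _ = _ := by field_simp

lemma pow_le_of_two_mul_pow_le {L N : ℝ} (hL : 2 ≤ L) (hLN : 2 * L ^ 161 ≤ N) {k : ℕ}
    (hk : k ≤ 161) : L ^ k ≤ N := by
  have h1 : L ^ k ≤ L ^ 161 := pow_le_pow_right₀ (by linarith) hk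
  have h2 : 0 < L ^ 161 := by positivity
  linarith

theorem exists_norm_expSum_sub_expSum_model_le : ∃ C : ℝ, 0 < C ∧ ∀ N : ℕ, 3 ≤ N →
    2 ≤ Real.log N → 2 * Real.log N ^ 161 ≤ N → ∀ α : ℝ,
      ‖expSum N (fun n ↦ (ArithmeticFunction.vonMangoldt n : ℂ)) α -
        expSum N (model (⌊Real.log N ^ 16⌋₊ ^ 2)) α‖ ≤ C * (N / Real.log N ^ 5) := by
  obtain ⟨C, hC, h⟩ := exists_norm_expSum_vonMangoldt_sub_le 133
  refine ⟨5005 + C, by positivity, fun N hN hL hLN α ↦ ?_⟩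
  obtain ⟨hU1, hU2⟩ := floor_log_pow_bounds hL
  have hN0 : (0 : ℝ) ≤ N := by positivity
  have hL0 : 0 < Real.log N := by linarith
  set L := Real.log N
  set U := ⌊L ^ 16⌋₊
  have hU0 : (0 : ℝ) ≤ U := by positivity
  have hUpos : 1 ≤ U := by
    have : (0 : ℝ) < U := lt_of_lt_of_le (by positivity) hU1
    exact_mod_cast this
  have hUN : 2 * (U ^ 2) ^ 5 ≤ N := by
    have h1 : ((U : ℝ) ^ 2) ^ 5 ≤ ((L ^ 16) ^ 2) ^ 5 := by gcongr
    have h2 : ((L ^ 16) ^ 2) ^ 5 ≤ L ^ 161 := by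
      rw [← pow_mul, ← pow_mul]
      exact pow_le_pow_right₀ (by linarith) (by norm_num)
    have h3 : 2 * ((U : ℝ) ^ 2) ^ 5 ≤ N := by linarith
    exact_mod_cast h3
  have hUL : ((U ^ 2 : ℕ) : ℝ) ≤ L ^ 133 := by
    push_cast
    calc (U : ℝ) ^ 2 ≤ (L ^ 16) ^ 2 := by gcongr
      _ ≤ L ^ 133 := by
        rw [← pow_mul]
        exact pow_le_pow_right₀ (by linarith) (by norm_num)
  have hU6 : ((U : ℝ) ^ 2) ^ 3 ≤ N / L ^ 5 := by
    rw [le_div_iff₀ (by positivity)]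
    calc ((U : ℝ) ^ 2) ^ 3 * L ^ 5 ≤ ((L ^ 16) ^ 2) ^ 3 * L ^ 5 := by gcongr
      _ = L ^ 101 := by ring
      _ ≤ N := pow_le_of_two_mul_pow_le hL hLN (by norm_num)
  refine (h N U hN hUpos hUN hUL α).trans ?_
  push_cast
  have h1 := minor_arc_error_le hL hN0 hU1
  have h2 := truncation_error_le hL hN0 hU1
  have h3 := major_arc_error_le hL hN0 hU0 hC.le hU2
  linarith

theorem exists_sum_norm_sq_model_le : ∃ C : ℝ, 0 < C ∧ ∀ N : ℕ, 2 ≤ Real.log N →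
    2 * Real.log N ^ 161 ≤ N →
      ∑ n ∈ Icc 1 N, ‖model (⌊Real.log N ^ 16⌋₊ ^ 2) n‖ ^ 2 ≤ C * (N * Real.log N ^ 2) := by
  obtain ⟨C, hC, h⟩ := exists_sum_inv_totient_le (ε := 1 / 64) (by norm_num)
  refine ⟨C + 1, by positivity, fun N hL hLN ↦ ?_⟩
  obtain ⟨hU1, hU2⟩ := floor_log_pow_bounds hL
  have hN0 : (0 : ℝ) ≤ N := by positivity
  have hL0 : 0 < Real.log N := by linarith
  set L := Real.log N
  set U := ⌊L ^ 16⌋₊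
  have hUpos : 1 ≤ U := by
    have : (0 : ℝ) < U := lt_of_lt_of_le (by positivity) hU1
    exact_mod_cast this
  have hP : 1 ≤ U ^ 2 := Nat.one_le_pow _ _ hUpos
  have hP32 : ((U ^ 2 : ℕ) : ℝ) ≤ L ^ 32 := by
    push_cast
    calc (U : ℝ) ^ 2 ≤ (L ^ 16) ^ 2 := by gcongr
      _ = L ^ 32 := by ring
  have h1 : ((U ^ 2 : ℕ) : ℝ) ^ (2 * (1 / 64) : ℝ) ≤ L := by
    calc ((U ^ 2 : ℕ) : ℝ) ^ (2 * (1 / 64) : ℝ) ≤ (L ^ 32) ^ (2 * (1 / 64) : ℝ) := by gcongr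
      _ = L := by
        rw [← Real.rpow_natCast L 32, ← Real.rpow_mul hL0.le]
        norm_num
  have h2 : ((U ^ 2 : ℕ) : ℝ) ^ 4 ≤ N := by
    calc ((U ^ 2 : ℕ) : ℝ) ^ 4 ≤ (L ^ 32) ^ 4 := by gcongr
      _ = L ^ 128 := by ring
      _ ≤ N := pow_le_of_two_mul_pow_le hL hLN (by norm_num)
  have h3 : L ≤ L ^ 2 := by nlinarith
  have h4 : 1 ≤ L ^ 2 := by nlinarith
  have h5 : N * ∑ q ∈ Icc 1 (U ^ 2), 1 / (q.totient : ℝ) ≤ N * (C * L ^ 2) :=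
    mul_le_mul_of_nonneg_left ((h _ hP).trans
      (mul_le_mul_of_nonneg_left (h1.trans h3) hC.le)) hN0
  refine (sum_norm_sq_model_le hP).trans ?_
  have h6 := mul_le_mul_of_nonneg_left h4 hN0
  linarith

theorem exists_norm_repSum_vonMangoldt_sub_le : ∃ C : ℝ, 0 < C ∧ ∀ N : ℕ, 4 ≤ N →
    2 ≤ Real.log N → 2 * Real.log N ^ 161 ≤ N →
      ‖repSum N (fun n ↦ (ArithmeticFunction.vonMangoldt n : ℂ))
          (fun n ↦ (ArithmeticFunction.vonMangoldt n : ℂ))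
          (fun n ↦ (ArithmeticFunction.vonMangoldt n : ℂ)) -
        repSum N (fun _ ↦ 1) (fun _ ↦ 1) (fun _ ↦ 1) *
          ((∑ q ∈ Icc 1 (⌊Real.log N ^ 16⌋₊ ^ 2), singularTerm N q : ℝ) : ℂ)‖ ≤
        C * ((N : ℝ) ^ 2 / Real.log N) := by
  obtain ⟨C₁, hC₁, h₁⟩ := exists_norm_expSum_sub_expSum_model_le
  obtain ⟨C₂, hC₂, h₂⟩ := exists_sum_norm_sq_model_le
  refine ⟨3 / 2 * C₁ * (1 + C₂) + 1, by positivity, fun N hN hL hLN ↦ ?_⟩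
  have h3 := norm_repSum_sub_repSum_le (by lia : 0 < N)
    (fun n ↦ (ArithmeticFunction.vonMangoldt n : ℂ)) (model (⌊Real.log N ^ 16⌋₊ ^ 2))
    (h₁ N (by lia) hL hLN)
  have h4 := h₂ N hL hLN
  have h5 := sum_norm_sq_vonMangoldt_le N
  obtain ⟨hU1, hU2⟩ := floor_log_pow_bounds hL
  have hN0 : (0 : ℝ) ≤ N := by positivity
  have hL0 : 0 < Real.log N := by linarith
  set L := Real.log N
  set U := ⌊L ^ 16⌋₊
  have hUpos : 1 ≤ U := by
    have : (0 : ℝ) < U := lt_of_lt_of_le (by positivity) hU1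
    exact_mod_cast this
  have h6 := norm_repSum_model_sub_le (N := N) (Nat.one_le_pow 2 U hUpos)
  have h7 : N * ((U ^ 2 : ℕ) : ℝ) ^ 5 / 2 ≤ (N : ℝ) ^ 2 / L := by
    have h8 : ((U ^ 2 : ℕ) : ℝ) ^ 5 ≤ N / L := by
      rw [le_div_iff₀ hL0]
      push_cast
      calc ((U : ℝ) ^ 2) ^ 5 * L ≤ ((L ^ 16) ^ 2) ^ 5 * L := by gcongr
        _ = L ^ 161 := by ring
        _ ≤ N := pow_le_of_two_mul_pow_le hL hLN le_rfl
    have h9 := mul_le_mul_of_nonneg_left h8 hN0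
    have h10 : 0 ≤ N * ((U ^ 2 : ℕ) : ℝ) ^ 5 := by positivity
    rw [mul_div_assoc', ← sq] at h9
    linarith
  have h8 : 3 / 2 * (C₁ * (N / L ^ 5)) * (N * L ^ 2 + C₂ * (N * L ^ 2)) ≤
      3 / 2 * C₁ * (1 + C₂) * ((N : ℝ) ^ 2 / L) := by
    calc 3 / 2 * (C₁ * (N / L ^ 5)) * (N * L ^ 2 + C₂ * (N * L ^ 2)) =
          3 / 2 * C₁ * (1 + C₂) * ((N : ℝ) ^ 2 / L ^ 3) := by field_simp
      _ ≤ _ := by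
        gcongr
        exact le_self_pow₀ (by linarith) (by norm_num)
  refine (norm_sub_le_norm_sub_add_norm_sub _ (repSum N (model (U ^ 2)) (model (U ^ 2))
    (model (U ^ 2))) _).trans ?_
  have h9 : 3 / 2 * (C₁ * (N / L ^ 5)) *
      (∑ n ∈ Icc 1 N, ‖(ArithmeticFunction.vonMangoldt n : ℂ)‖ ^ 2 +
        ∑ n ∈ Icc 1 N, ‖model (U ^ 2) n‖ ^ 2) ≤
      3 / 2 * (C₁ * (N / L ^ 5)) * (N * L ^ 2 + C₂ * (N * L ^ 2)) :=
    mul_le_mul_of_nonneg_left (add_le_add h5 h4) (by positivity)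
  linarith

lemma prime_power_error_le {L N : ℝ} (hL : 2 ≤ L) (hLN : 2 * L ^ 161 ≤ N) :
    3 * ((2 * √N * L) * (N * L ^ 2)) ≤ 6 * (N ^ 2 / L) := by
  have hN0 : 0 ≤ N := le_trans (by positivity) hLN
  have h1 : L ^ 4 ≤ √N := Real.le_sqrt_of_sq_le (by
    rw [← pow_mul]
    exact pow_le_of_two_mul_pow_le hL hLN (by norm_num))
  have h2 : √N * L ^ 3 ≤ N / L := by
    rw [le_div_iff₀ (by linarith)]
    calc √N * L ^ 3 * L = √N * L ^ 4 := by ring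
      _ ≤ √N * √N := by gcongr
      _ = N := Real.mul_self_sqrt hN0
  calc 3 * ((2 * √N * L) * (N * L ^ 2)) = 6 * (N * (√N * L ^ 3)) := by ring
    _ ≤ 6 * (N * (N / L)) := by gcongr
    _ = _ := by ring

lemma eventually_log_bounds (M : ℝ) : ∃ N₀ : ℕ, ∀ N : ℕ, N₀ < N →
    4 ≤ N ∧ 2 ≤ Real.log N ∧ M < Real.log N ∧ 2 * Real.log N ^ 161 ≤ N := by
  have h1 : Tendsto (fun N : ℕ ↦ Real.log N) atTop atTop :=
    Real.tendsto_log_atTop.comp tendsto_natCast_atTop_atTop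
  have h2 : ∀ᶠ N : ℕ in atTop, ‖Real.log N ^ 161‖ ≤ 1 / 2 * ‖(N : ℝ)‖ :=
    tendsto_natCast_atTop_atTop.eventually
      ((Real.isLittleO_pow_log_id_atTop (n := 161)).bound (by norm_num : (0 : ℝ) < 1 / 2))
  obtain ⟨N₀, h⟩ := eventually_atTop.mp ((eventually_ge_atTop 4).and
    ((h1.eventually_ge_atTop 2).and ((h1.eventually_gt_atTop M).and h2)))
  refine ⟨N₀, fun N hN ↦ ?_⟩
  obtain ⟨h3, h4, h5, h6⟩ := h N hN.le
  refine ⟨h3, h4, h5, ?_⟩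
  rw [Real.norm_of_nonneg (by positivity), Real.norm_of_nonneg (by positivity)] at h6
  linarith

end Vinogradov

/-- Vinogradov's theorem: every sufficiently large odd number is the sum of three primes. -/
theorem vinogradov_three_primes :
    ∃ N₀ : ℕ, ∀ n : ℕ, N₀ < n → Odd n →
      ∃ p q r : ℕ, p.Prime ∧ q.Prime ∧ r.Prime ∧ n = p + q + r := by
  obtain ⟨C, hC, h⟩ := Vinogradov.exists_norm_repSum_vonMangoldt_sub_le
  obtain ⟨P₀, hP₀⟩ := Vinogradov.exists_half_le_sum_singularTerm
  obtain ⟨N₀, hN₀⟩ := Vinogradov.eventually_log_bounds (max (32 * (C + 6)) P₀)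
  refine ⟨N₀, fun N hN hodd ↦ ?_⟩
  by_contra hne
  obtain ⟨hN4, hL, hM, hLN⟩ := hN₀ N hN
  have hN0 : (0 : ℝ) < N := by exact_mod_cast (by lia : 0 < N)
  have h1 := Vinogradov.norm_repSum_vonMangoldt_le (by lia) hne
  have h2 := Vinogradov.prime_power_error_le hL hLN
  have h3 := h N hN4 hL hLN
  obtain ⟨K, hK, hKeq⟩ := Vinogradov.exists_repSum_one_eq hN4
  obtain ⟨hU1, -⟩ := Vinogradov.floor_log_pow_bounds hL
  set L := Real.log N
  have hP : P₀ ≤ ⌊L ^ 16⌋₊ ^ 2 := by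
    refine le_trans ?_ (Nat.le_self_pow two_ne_zero _)
    refine Nat.le_floor (((le_max_right _ _).trans hM.le).trans ?_)
    exact le_self_pow₀ (by linarith) (by norm_num)
  have hS := hP₀ _ hP N hodd
  set S := ∑ q ∈ Finset.Icc 1 (⌊L ^ 16⌋₊ ^ 2), Vinogradov.singularTerm N q
  rw [hKeq, ← Complex.ofReal_mul] at h3
  have hK0 : 0 ≤ K := le_trans (by positivity) hK
  have h4 : (N : ℝ) ^ 2 / 32 ≤ K * S := by nlinarith
  have h5 : K * S ≤ ‖((K * S : ℝ) : ℂ)‖ := by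
    rw [Complex.norm_real]
    exact le_abs_self _
  have h6 := norm_sub_norm_le ((K * S : ℝ) : ℂ)
    (Vinogradov.repSum N (fun n ↦ (ArithmeticFunction.vonMangoldt n : ℂ))
      (fun n ↦ (ArithmeticFunction.vonMangoldt n : ℂ))
      (fun n ↦ (ArithmeticFunction.vonMangoldt n : ℂ)))
  rw [norm_sub_rev] at h6
  have h7 : (N : ℝ) ^ 2 / 32 ≤ (C + 6) * ((N : ℝ) ^ 2 / L) := by linarith
  have h8 : 32 * (C + 6) < L := (le_max_left _ _).trans_lt hM
  have h9 : (C + 6) * ((N : ℝ) ^ 2 / L) < (N : ℝ) ^ 2 / 32 := by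
    rw [mul_div_assoc', div_lt_div_iff₀ (by linarith) (by norm_num)]
    nlinarith [pow_pos hN0 2]
  linarith
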